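/- arXiv:2005.02003 — 2 statements merged into one kernel-verified Lean document; each statement's English description precedes it below -/
import Mathlib

section
/- There exist constants c0 = c0(n,d) ≥ 1 and c1 = c1(n,d) > 0 with the following property. Let U ⊆ ℝ^n be a nonempty open set; for each k ∈ ℕ let M_k: [0,∞) → [1,∞) and ε_k: [0,∞) → [0,∞) be nondecreasing and E_k ∈ QM(ℝ^n,U,M_k,ε_k); set M(r) = limsup_{k→∞} M_k(r) and ε(r) = limsup_{k→∞} ε_k(r); assume that the measures H^d restricted to E_k ∩ U converge weakly to a Radon measure μ and that ε_0 := limsup_{r→0+} r^{−d} ε(r) < ∞. Then for every x ∈ U ∩ spt μ, Θ^{*d}(μ,x) ≤ (2 c1 M(0+) ω_d^{−1} + 2^d ω_d^{−1} ε_0) · exp(4 d (n−d)^2 c0^2 M(0+)^2). -/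
open MeasureTheory Metric Set Filter Topology
open scoped ENNReal NNReal

noncomputable section

/-- Euclidean space `ℝ^n`. -/
abbrev Euc (n : ℕ) := EuclideanSpace ℝ (Fin n)

/-- A deformation on `ℝⁿ` in the open set `U`: a Lipschitz map `φ : ℝⁿ → ℝⁿ` homotopic to the
identity such that the closure of `W_φ = {x | φ x ≠ x}` is compact and contained in `U`. -/
def IsDeformation (n : ℕ) (U : Set (Euc n)) (φ : Euc n → Euc n) : Prop :=
  (∃ K : ℝ≥0, LipschitzWith K φ) ∧
  (∃ hc : Continuous φ, (ContinuousMap.id (Euc n)).Homotopic ⟨φ, hc⟩) ∧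
  IsCompact (closure {x | φ x ≠ x}) ∧
  closure {x | φ x ≠ x} ⊆ U

/-- Membership in the class `QM(ℝⁿ, U, M, ε)`: `H^d`-restriction to `E` is locally finite,
`E ∩ U` is relatively closed in `U`, and for every deformation `φ` on `ℝⁿ` in `U` one has
`H^d(E ∩ W_φ) ≤ M(r) · H^d(φ(E ∩ W_φ)) + ε(r)` with `r = diam (W_φ ∪ φ(W_φ))`. -/
def MemQM (n : ℕ) (d : ℕ) (U : Set (Euc n)) (M ε : ℝ → ℝ≥0∞) (E : Set (Euc n)) : Prop :=
  IsLocallyFiniteMeasure ((μH[(d : ℝ)] : Measure (Euc n)).restrict E) ∧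
  (∃ F : Set (Euc n), IsClosed F ∧ E ∩ U = F ∩ U) ∧
  ∀ φ : Euc n → Euc n, IsDeformation n U φ →
    μH[(d : ℝ)] (E ∩ {x | φ x ≠ x}) ≤
      M (diam ({x | φ x ≠ x} ∪ φ '' {x | φ x ≠ x})) *
        μH[(d : ℝ)] (φ '' (E ∩ {x | φ x ≠ x})) +
      ε (diam ({x | φ x ≠ x} ∪ φ '' {x | φ x ≠ x}))

/-- Weak convergence of Radon measures: testing against continuous compactly supported
functions. -/
def WeakConv (n : ℕ) (μs : ℕ → Measure (Euc n)) (μ : Measure (Euc n)) : Prop :=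
  ∀ f : Euc n → ℝ, Continuous f → HasCompactSupport f →
    Tendsto (fun k => ∫ x, f x ∂(μs k)) atTop (𝓝 (∫ x, f x ∂μ))

/-- The support `spt μ` of a measure: points all of whose neighborhoods have positive measure. -/
def msupport (n : ℕ) (μ : Measure (Euc n)) : Set (Euc n) :=
  {x | ∀ r : ℝ, 0 < r → 0 < μ (ball x r)}

/-- `ω_d`: the Lebesgue measure of the unit ball of `ℝ^d`. -/
def ωb (d : ℕ) : ℝ≥0∞ := volume (ball (0 : Euc d) 1)

/-- Upper `d`-density `Θ^{*d}(μ,x) = limsup_{r→0+} μ(B̄(x,r))/(ω_d r^d)`. -/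
def upperDensity (n : ℕ) (d : ℕ) (μ : Measure (Euc n)) (x : Euc n) : ℝ≥0∞ :=
  limsup (fun r : ℝ => μ (closedBall x r) / (ωb d * ENNReal.ofReal r ^ d)) (𝓝[>] (0 : ℝ))

/-- Lower `d`-density `Θ_*^d(μ,x) = liminf_{r→0+} μ(B̄(x,r))/(ω_d r^d)`. -/
def lowerDensity (n : ℕ) (d : ℕ) (μ : Measure (Euc n)) (x : Euc n) : ℝ≥0∞ :=
  liminf (fun r : ℝ => μ (closedBall x r) / (ωb d * ENNReal.ofReal r ^ d)) (𝓝[>] (0 : ℝ))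

/-- `limsup_{k→∞}` of a sequence of real-valued gauge functions, with values in `[0,∞]`. -/
def limsupFn (Ms : ℕ → ℝ → ℝ) : ℝ → ℝ≥0∞ :=
  fun r => Filter.limsup (fun k => ENNReal.ofReal (Ms k r)) atTop

/-- Right limit at `0` of a nondecreasing function `[0,∞) → [0,∞]`, i.e. `M(0+)`. -/
def rightLim0 (M : ℝ → ℝ≥0∞) : ℝ≥0∞ := ⨅ r ∈ Set.Ioi (0 : ℝ), M r


namespace UDB

/-! ### One-dimensional folding -/

/-- centre of the cell of `t` -/
def cc (t : ℝ) : ℝ := 2 * (round (t / 2) : ℤ)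

/-- distance to the centre lattice `2ℤ` -/
def tri (t : ℝ) : ℝ := |t - cc t|

lemma tri_nonneg (t : ℝ) : 0 ≤ tri t := abs_nonneg _

lemma tri_le_one (t : ℝ) : tri t ≤ 1 := by
  have := abs_sub_round (t / 2)
  unfold tri cc
  rw [abs_le] at *
  constructor <;> linarith [this.1, this.2]

lemma tri_le (t : ℝ) (z : ℤ) : tri t ≤ |t - 2 * z| := by
  have := round_le (t / 2) z
  unfold tri cc
  have h1 : t - 2 * (round (t / 2) : ℤ) = 2 * (t / 2 - (round (t / 2) : ℤ)) := by ring
  have h2 : t - 2 * z = 2 * (t / 2 - z) := by ring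
  rw [h1, h2, abs_mul, abs_mul]
  gcongr

lemma tri_lip (t t' : ℝ) : tri t ≤ tri t' + |t - t'| := by
  have h := tri_le t (round (t' / 2))
  have h2 : t - 2 * (round (t' / 2) : ℤ) = (t' - cc t') + (t - t') := by unfold cc; ring
  rw [h2] at h
  exact h.trans (abs_add_le _ _)

lemma tri_continuous : Continuous tri := by
  have : LipschitzWith 1 tri := by
    refine LipschitzWith.of_le_add fun x y => ?_
    rw [Real.dist_eq]
    exact tri_lip x y
  exact this.continuous

/-- clip to `[-1,1]` -/
def clip (z : ℝ) : ℝ := max (-1) (min 1 z)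

lemma clip_le (z : ℝ) : clip z ≤ 1 := by simp [clip]

lemma le_clip (z : ℝ) : -1 ≤ clip z := by simp [clip]

lemma clip_mono {a b : ℝ} (h : a ≤ b) : clip a ≤ clip b := by
  unfold clip; gcongr

lemma clip_sub_le {a b : ℝ} (h : a ≤ b) : clip b - clip a ≤ b - a := by
  unfold clip
  rcases max_cases (-1 : ℝ) (min 1 a) with h1 | h1 <;>
  rcases max_cases (-1 : ℝ) (min 1 b) with h2 | h2 <;>
  rcases min_cases (1 : ℝ) a with h3 | h3 <;>
  rcases min_cases (1 : ℝ) b with h4 | h4 <;> linarith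

lemma clip_of_le {z : ℝ} (h : 1 ≤ z) : clip z = 1 := by
  simp [clip, h]

lemma clip_of_ge {z : ℝ} (h : z ≤ -1) : clip z = -1 := by
  have : z ≤ 1 := by linarith
  simp [clip, h, this]

lemma clip_of_mem {z : ℝ} (h1 : -1 ≤ z) (h2 : z ≤ 1) : clip z = z := by
  simp [clip, h1, h2]

/-- the folding map with parameter `s ∈ (0,1]` -/
def hh (s t : ℝ) : ℝ := cc t + clip ((t - cc t) / s)

lemma hh_one (t : ℝ) : hh 1 t = t := by
  have h := abs_le.1 (tri_le_one t)
  unfold hh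
  rw [div_one, clip_of_mem h.1 h.2]; ring

lemma hh_sub_cc (s t : ℝ) : |hh s t - cc t| ≤ 1 := by
  unfold hh
  rw [add_sub_cancel_left, abs_le]
  exact ⟨le_clip _, clip_le _⟩

lemma hh_sub_self (s t : ℝ) (hs : 0 < s) : |hh s t - t| ≤ 1 := by
  have h := abs_le.1 (tri_le_one t)
  have h1 := le_clip ((t - cc t) / s)
  have h2 := clip_le ((t - cc t) / s)
  unfold hh
  rw [abs_le]
  rcases le_total 0 (t - cc t) with h0 | h0
  · have h3 : 0 ≤ clip ((t - cc t) / s) := by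
      have := clip_mono (div_nonneg h0 hs.le)
      rwa [clip_of_mem (by norm_num) (by norm_num)] at this
    constructor <;> linarith
  · have h3 : clip ((t - cc t) / s) ≤ 0 := by
      have := clip_mono (div_nonpos_of_nonpos_of_nonneg h0 hs.le)
      rwa [clip_of_mem (z := 0) (by norm_num) (by norm_num)] at this
    constructor <;> linarith

lemma hh_lip_t_aux (s t t' : ℝ) (hs : 0 < s) (hs1 : s ≤ 1) (htt : t ≤ t') :
    |hh s t' - hh s t| ≤ (t' - t) / s := by
  have h := abs_le.1 (tri_le_one t)
  have h' := abs_le.1 (tri_le_one t')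
  have hr : round (t / 2) ≤ round (t' / 2) := by
    rw [round_eq, round_eq]; apply Int.floor_mono; linarith
  rcases hr.eq_or_lt with he | hl
  · have hc : cc t = cc t' := by unfold cc; rw [he]
    unfold hh
    rw [hc]
    have hle : (t - cc t') / s ≤ (t' - cc t') / s := by gcongr
    have e1 := clip_sub_le hle
    have e2 := clip_mono hle
    have e3 : (t' - cc t') / s - (t - cc t') / s = (t' - t) / s := by ring
    rw [abs_le]; constructor
    · have : 0 ≤ (t' - t) / s := div_nonneg (by linarith) hs.le
      linarith
    · linarith
  · have hc : cc t + 2 ≤ cc t' := by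
      unfold cc
      have : ((round (t / 2) : ℤ) : ℝ) + 1 ≤ ((round (t' / 2) : ℤ) : ℝ) := by exact_mod_cast hl
      linarith
    have hone : 1 ≤ 1 / s := by rw [le_div_iff₀ hs]; linarith
    have e1 : (t - cc t) / s ≤ 1 / s := by gcongr; exact h.2
    have e2 : -(1 / s) ≤ (t' - cc t') / s := by
      rw [← neg_div]; gcongr; exact h'.1
    have f1 := clip_sub_le e1
    have f2 := clip_sub_le e2
    rw [clip_of_le hone] at f1
    rw [clip_of_ge (z := -(1 / s)) (by linarith)] at f2
    have g : (t' - t) / s = (1 / s - (t - cc t) / s) + (cc t' - cc t - 2) / s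
      + ((t' - cc t') / s - -(1 / s)) := by ring
    have g2 : cc t' - cc t - 2 ≤ (cc t' - cc t - 2) / s := by
      rw [le_div_iff₀ hs]
      nlinarith
    unfold hh
    have k1 := le_clip ((t' - cc t') / s)
    have k2 := clip_le ((t - cc t) / s)
    rw [g, abs_of_nonneg (by linarith)]
    linarith

lemma hh_lip_t (s t t' : ℝ) (hs : 0 < s) (hs1 : s ≤ 1) :
    |hh s t - hh s t'| ≤ |t - t'| / s := by
  rcases le_total t t' with h | h
  · rw [abs_sub_comm, abs_sub_comm t, abs_of_nonneg (sub_nonneg.2 h)]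
    exact hh_lip_t_aux s t t' hs hs1 h
  · rw [abs_of_nonneg (sub_nonneg.2 h)]
    exact hh_lip_t_aux s t' t hs hs1 h

lemma clip_scale_aux (y s s' : ℝ) (hs' : 0 < s') (h : s' ≤ s) :
    |clip (y / s) - clip (y / s')| ≤ (s - s') / s := by
  have hs : 0 < s := by linarith
  have key : ∀ y : ℝ, 0 ≤ y → |clip (y / s) - clip (y / s')| ≤ (s - s') / s := by
    intro y hy
    have m : y / s ≤ y / s' := by gcongr
    have m2 := clip_mono m
    rw [abs_sub_comm, abs_of_nonneg (by linarith)]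
    have p1 : 0 ≤ y / s := by positivity
    have p2 : 0 ≤ y / s' := by positivity
    have e : (s - s') / s = 1 - s' / s := by field_simp
    rcases le_total s y with h1 | h1
    · rw [clip_of_le ((le_div_iff₀ hs).2 (by linarith)),
        clip_of_le ((le_div_iff₀ hs').2 (by linarith)), sub_self]
      exact div_nonneg (by linarith) hs.le
    · rw [clip_of_mem (z := y / s) (by linarith) ((div_le_iff₀ hs).2 (by linarith))]
      rcases le_total s' y with h2 | h2
      · have := clip_le (y / s')
        have : s' / s ≤ y / s := by gcongr
        linarith
      · rw [clip_of_mem (z := y / s') (by linarith) ((div_le_iff₀ hs').2 (by linarith))]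
        have : y / s' - y / s = (y / s') * ((s - s') / s) := by field_simp
        rw [this]
        have q : y / s' ≤ 1 := (div_le_iff₀ hs').2 (by linarith)
        have q2 : 0 ≤ (s - s') / s := div_nonneg (by linarith) hs.le
        nlinarith
  rcases le_total 0 y with h0 | h0
  · exact key y h0
  · have := key (-y) (by linarith)
    have cn : ∀ z, clip (-z) = - clip z := by
      intro z
      unfold clip
      rcases max_cases (-1 : ℝ) (min 1 z) with h1 | h1 <;>
      rcases max_cases (-1 : ℝ) (min 1 (-z)) with h2 | h2 <;>
      rcases min_cases (1 : ℝ) z with h3 | h3 <;>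
      rcases min_cases (1 : ℝ) (-z) with h4 | h4 <;> linarith
    rw [neg_div, neg_div, cn, cn] at this
    rwa [show -clip (y / s) - -clip (y / s') = -(clip (y / s) - clip (y / s')) by ring,
      abs_neg] at this

lemma hh_lip_s (s s' t : ℝ) (hs' : 0 < s') (h : s' ≤ s) :
    |hh s t - hh s' t| ≤ (s - s') / s := by
  unfold hh
  rw [add_sub_add_left_eq_sub]
  exact clip_scale_aux _ _ _ hs' h

lemma hh_lip_aux (s s' t t' D : ℝ) (hs' : 0 < s') (h : s' ≤ s) (hs1 : s ≤ 1)
    (hD : |t - t'| ≤ D) (hD2 : s - s' ≤ D) : |hh s t - hh s' t'| ≤ 2 * D / s := by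
  have hs : 0 < s := by linarith
  have e1 := hh_lip_t s t t' hs hs1
  have e2 := hh_lip_s s s' t' hs' h
  have e3 : |t - t'| / s ≤ D / s := by gcongr
  have e4 : (s - s') / s ≤ D / s := by gcongr
  have e5 := abs_sub_le (hh s t) (hh s t') (hh s' t')
  have e6 : 2 * D / s = D / s + D / s := by ring
  linarith

/-- main Lipschitz estimate for `hh` -/
lemma hh_lip (s s' t t' D : ℝ) (hs : 0 < s) (hs' : 0 < s') (hs1 : s ≤ 1) (hs1' : s' ≤ 1)
    (hD : |t - t'| ≤ D) (hD2 : |s - s'| ≤ D) : |hh s t - hh s' t'| ≤ 2 * D / s := by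
  rcases le_total s' s with h | h
  · exact hh_lip_aux s s' t t' D hs' h hs1 hD ((le_abs_self _).trans hD2)
  · rw [abs_sub_comm]
    have := hh_lip_aux s' s t' t D hs h hs1' (by rwa [abs_sub_comm])
      (by rw [abs_sub_comm] at hD2; exact (le_abs_self _).trans hD2)
    refine this.trans ?_
    have : 0 ≤ D := (abs_nonneg _).trans hD
    gcongr

lemma hh_fold (s t : ℝ) (hs : 0 < s) (h : s ≤ tri t) : |hh s t - cc t| = 1 := by
  unfold hh
  rw [add_sub_cancel_left]
  unfold tri at h
  rcases le_abs.1 h with h | h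
  · rw [clip_of_le ((le_div_iff₀ hs).2 (by linarith)), abs_one]
  · rw [clip_of_ge ((div_le_iff₀ hs).2 (by linarith)), abs_neg, abs_one]

/-! ### order statistics -/

lemma exists_ordstat (n d : ℕ) (hdn : d < n) (v : Fin n → ℝ) :
    ∃ m : ℝ, (∃ T : Finset (Fin n), T.card = d + 1 ∧ ∀ i ∈ T, v i ≤ m) ∧
      (∃ T : Finset (Fin n), T.card = n - d ∧ ∀ i ∈ T, m ≤ v i) := by
  have hm := Tuple.monotone_sort v
  set σ := Tuple.sort v
  refine ⟨v (σ ⟨d, hdn⟩), ⟨(Finset.Iic ⟨d, hdn⟩).map σ.toEmbedding, ?_, ?_⟩,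
    ⟨(Finset.Ici ⟨d, hdn⟩).map σ.toEmbedding, ?_, ?_⟩⟩
  · simp
  · intro i hi
    obtain ⟨j, hj, rfl⟩ := Finset.mem_map.1 hi
    exact hm (Finset.mem_Iic.1 hj)
  · simp
  · intro i hi
    obtain ⟨j, hj, rfl⟩ := Finset.mem_map.1 hi
    exact hm (Finset.mem_Ici.1 hj)

/-- the `(d+1)`-st smallest entry -/
def ord (n d : ℕ) (v : Fin n → ℝ) : ℝ :=
  if h : d < n then (exists_ordstat n d h v).choose else 0

lemma ord_low {n d : ℕ} (hdn : d < n) (v : Fin n → ℝ) :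
    ∃ T : Finset (Fin n), T.card = d + 1 ∧ ∀ i ∈ T, v i ≤ ord n d v := by
  unfold ord; rw [dif_pos hdn]; exact (exists_ordstat n d hdn v).choose_spec.1

lemma ord_high {n d : ℕ} (hdn : d < n) (v : Fin n → ℝ) :
    ∃ T : Finset (Fin n), T.card = n - d ∧ ∀ i ∈ T, ord n d v ≤ v i := by
  unfold ord; rw [dif_pos hdn]; exact (exists_ordstat n d hdn v).choose_spec.2

lemma ord_lip {n d : ℕ} (hdn : d < n) (v w : Fin n → ℝ) (D : ℝ) (h : ∀ i, v i ≤ w i + D) :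
    ord n d v ≤ ord n d w + D := by
  obtain ⟨T, hT, hT2⟩ := ord_low hdn w
  obtain ⟨S, hS, hS2⟩ := ord_high hdn v
  have : ¬ Disjoint T S := by
    intro hd
    have h1 := Finset.card_union_of_disjoint hd
    have h2 := Finset.card_le_univ (T ∪ S)
    rw [Fintype.card_fin] at h2
    omega
  obtain ⟨i, hi, hi'⟩ := Finset.not_disjoint_iff.1 this
  linarith [hT2 i hi, hS2 i hi', h i]

lemma ord_le {n d : ℕ} (hdn : d < n) (v : Fin n → ℝ) (c : ℝ) (h : ∀ i, v i ≤ c) :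
    ord n d v ≤ c := by
  obtain ⟨S, hS, hS2⟩ := ord_high hdn v
  have : S.Nonempty := by rw [← Finset.card_pos]; omega
  obtain ⟨i, hi⟩ := this
  exact (hS2 i hi).trans (h i)

lemma le_ord {n d : ℕ} (hdn : d < n) (v : Fin n → ℝ) (c : ℝ) (h : ∀ i, c ≤ v i) :
    c ≤ ord n d v := by
  obtain ⟨S, hS, hS2⟩ := ord_low hdn v
  have : S.Nonempty := by rw [← Finset.card_pos]; omega
  obtain ⟨i, hi⟩ := this
  exact (h i).trans (hS2 i hi)

/-! ### integrability of the singular weight -/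

/-- the exponent `d/(d+1)` -/
def pp (d : ℕ) : ℝ := (d : ℝ) / (d + 1)

lemma pp_nonneg (d : ℕ) : 0 ≤ pp d := by unfold pp; positivity

lemma pp_lt_one (d : ℕ) : pp d < 1 := by
  unfold pp; rw [div_lt_one (by positivity)]; linarith

/-- one dimensional singular weight -/
def wt (d : ℕ) (t : ℝ) : ℝ≥0∞ := ENNReal.ofReal |t| ^ (-(pp d))

lemma wt_measurable (d : ℕ) : Measurable (wt d) := by
  unfold wt
  fun_prop

/-- truncated integral -/
def kap (d : ℕ) : ℝ≥0∞ := ∫⁻ t in Icc (-1 : ℝ) 1, wt d t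

lemma kap_lt_top (d : ℕ) : kap d < ⊤ := by
  have h1 : IntegrableOn (fun t : ℝ => t ^ (-(pp d))) (Ioc 0 1) := by
    rw [← intervalIntegrable_iff_integrableOn_Ioc_of_le zero_le_one]
    exact intervalIntegral.intervalIntegrable_rpow' (by linarith [pp_lt_one d])
  have h2 : ∫⁻ t in Ioc (0 : ℝ) 1, wt d t < ⊤ := by
    have := h1.2
    rw [hasFiniteIntegral_iff_enorm] at this
    refine lt_of_le_of_lt (setLIntegral_mono' measurableSet_Ioc ?_) this
    intro t ht
    unfold wt
    rw [abs_of_pos ht.1, ENNReal.ofReal_rpow_of_pos ht.1, ← ofReal_norm, Real.norm_eq_abs]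
    exact ENNReal.ofReal_le_ofReal (le_abs_self _)
  have h3 : ∫⁻ t in Ico (-1 : ℝ) 0, wt d t = ∫⁻ t in Ioc (0 : ℝ) 1, wt d t := by
    have := (Measure.measurePreserving_neg (volume : Measure ℝ)).setLIntegral_comp_preimage
      (measurableSet_Ioc (a := (0:ℝ)) (b := 1)) (wt_measurable d)
    rw [← this]
    have e : Neg.neg ⁻¹' Ioc (0:ℝ) 1 = Ico (-1) 0 := by
      ext t; simp only [mem_preimage, mem_Ioc, mem_Ico]
      constructor <;> rintro ⟨a, b⟩ <;> constructor <;> linarith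
    rw [e]
    simp [wt]
  have h4 : Icc (-1 : ℝ) 1 ⊆ Ico (-1 : ℝ) 0 ∪ ({0} ∪ Ioc (0 : ℝ) 1) := by
    intro t ht
    rcases lt_trichotomy t 0 with h | h | h
    · exact Or.inl ⟨ht.1, h⟩
    · exact Or.inr (Or.inl h)
    · exact Or.inr (Or.inr ⟨h, ht.2⟩)
  unfold kap
  calc _ ≤ ∫⁻ t in Ico (-1 : ℝ) 0 ∪ ({0} ∪ Ioc (0 : ℝ) 1), wt d t := lintegral_mono_set h4
    _ ≤ (∫⁻ t in Ico (-1 : ℝ) 0, wt d t) + ∫⁻ t in ({0} ∪ Ioc (0 : ℝ) 1), wt d t :=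
      lintegral_union_le _ _ _
    _ ≤ (∫⁻ t in Ico (-1 : ℝ) 0, wt d t) + ((∫⁻ t in ({0} : Set ℝ), wt d t)
        + ∫⁻ t in Ioc (0 : ℝ) 1, wt d t) := by gcongr; exact lintegral_union_le _ _ _
    _ < ⊤ := by
      rw [h3]
      have : ∫⁻ t in ({0} : Set ℝ), wt d t = 0 := by
        rw [Measure.restrict_singleton]; simp
      rw [this, zero_add]
      exact ENNReal.add_lt_top.2 ⟨h2, h2⟩

lemma wt_anti (d : ℕ) {t t' : ℝ} (h : |t| ≤ |t'|) : wt d t' ≤ wt d t := by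
  unfold wt
  rw [ENNReal.rpow_neg, ENNReal.rpow_neg]
  apply ENNReal.inv_le_inv.2
  exact ENNReal.rpow_le_rpow (ENNReal.ofReal_le_ofReal h) (pp_nonneg d)

lemma wt_one (d : ℕ) : wt d 1 = 1 := by simp [wt]

lemma one_le_wt (d : ℕ) (t : ℝ) (h : |t| ≤ 1) : 1 ≤ wt d t := by
  rw [← wt_one d]; exact wt_anti d (by simpa using h)

lemma wt_le_one (d : ℕ) (t : ℝ) (h : 1 ≤ |t|) : wt d t ≤ 1 := by
  rw [← wt_one d]; exact wt_anti d (by simpa using h)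

lemma wt_int (d : ℕ) (t : ℝ) : ∫⁻ a in Icc (0:ℝ) 1, wt d (t - a) ≤ kap d + 1 := by
  have h : ∀ a, wt d (t - a) ≤ (Icc (-1:ℝ) 1).indicator (wt d) (t - a) + 1 := by
    intro a
    by_cases ha : t - a ∈ Icc (-1:ℝ) 1
    · rw [indicator_of_mem ha]; exact le_self_add
    · rw [indicator_of_notMem ha, zero_add]
      apply wt_le_one
      by_contra hc
      exact ha (abs_le.1 (not_le.1 hc).le)
  have hm : Measurable ((Icc (-1:ℝ) 1).indicator (wt d)) :=
    (wt_measurable d).indicator measurableSet_Icc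
  calc _ ≤ ∫⁻ a in Icc (0:ℝ) 1, ((Icc (-1:ℝ) 1).indicator (wt d) (t - a) + 1) :=
        lintegral_mono h
    _ = (∫⁻ a in Icc (0:ℝ) 1, (Icc (-1:ℝ) 1).indicator (wt d) (t - a)) + 1 := by
        rw [lintegral_add_right _ measurable_const]
        simp
    _ ≤ (∫⁻ a, (Icc (-1:ℝ) 1).indicator (wt d) (t - a)) + 1 := by
        gcongr; exact Measure.restrict_le_self
    _ = kap d + 1 := by
        rw [lintegral_sub_left_eq_self (fun a => (Icc (-1:ℝ) 1).indicator (wt d) a) t,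
          lintegral_indicator measurableSet_Icc]
        rfl

lemma wt_tri_int (d : ℕ) (t : ℝ) :
    ∫⁻ a in Icc (0:ℝ) 1, wt d (tri (t - a)) ≤ 3 * (kap d + 1) := by
  set k : ℤ := round (t / 2)
  have hk : |t / 2 - k| ≤ 1 / 2 := abs_sub_round _
  have h : ∀ a ∈ Icc (0:ℝ) 1, wt d (tri (t - a)) ≤
      wt d ((t - 2 * (k - 1 : ℤ)) - a) + wt d ((t - 2 * k) - a)
        + wt d ((t - 2 * (k + 1 : ℤ)) - a) := by
    intro a ha
    have hj : |(t - a) / 2 - (round ((t - a) / 2) : ℤ)| ≤ 1 / 2 := abs_sub_round _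
    have ht : tri (t - a) = |(t - a) - 2 * (round ((t - a) / 2) : ℤ)| := rfl
    set j : ℤ := round ((t - a) / 2)
    rw [abs_le] at hk hj
    have h1 : j ≤ k + 1 := by
      have : (j : ℝ) < k + 2 := by linarith [ha.1, ha.2]
      have : j < k + 2 := by exact_mod_cast this
      omega
    have h2 : k - 1 ≤ j := by
      have : (k : ℝ) - 2 < j := by linarith [ha.1, ha.2]
      have : k - 2 < j := by exact_mod_cast this
      omega
    have hab : wt d (tri (t - a)) = wt d (t - 2 * j - a) := by
      rw [ht]; unfold wt; rw [abs_abs]; congr 3; ring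
    rw [hab]
    have : j = k - 1 ∨ j = k ∨ j = k + 1 := by omega
    rcases this with h | h | h
    · rw [h]; exact le_self_add.trans le_self_add
    · rw [h]; exact le_add_self.trans le_self_add
    · rw [h]; exact le_add_self
  have hm : ∀ c : ℝ, Measurable (fun a => wt d (c - a)) := fun c =>
    (wt_measurable d).comp (measurable_const.sub measurable_id)
  calc _ ≤ ∫⁻ a in Icc (0:ℝ) 1, (wt d ((t - 2 * (k - 1 : ℤ)) - a) + wt d ((t - 2 * k) - a)
        + wt d ((t - 2 * (k + 1 : ℤ)) - a)) := setLIntegral_mono' measurableSet_Icc h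
    _ ≤ (kap d + 1) + (kap d + 1) + (kap d + 1) := by
      rw [lintegral_add_right _ (hm _), lintegral_add_right _ (hm _)]
      gcongr <;> exact wt_int _ _
    _ = 3 * (kap d + 1) := by ring

/-- the product weight -/
def GG (n d : ℕ) (u : Fin n → ℝ) : ℝ≥0∞ := ∏ i, wt d (tri (u i))

lemma GG_measurable (n d : ℕ) : Measurable (GG n d) := by
  unfold GG
  refine Finset.measurable_prod _ fun i _ => ?_
  exact (wt_measurable d).comp (tri_continuous.measurable.comp (measurable_pi_apply i))

lemma ord_GG {n d : ℕ} (hdn : d < n) (u : Fin n → ℝ) :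
    (ENNReal.ofReal (ord n d (fun i => tri (u i))))⁻¹ ^ d ≤ GG n d u := by
  obtain ⟨T, hT, hT2⟩ := ord_low hdn (fun i => tri (u i))
  set m := ord n d (fun i => tri (u i))
  have hm : 0 ≤ m := le_ord hdn _ _ fun i => tri_nonneg _
  have h1 : (ENNReal.ofReal m)⁻¹ ^ d = ∏ i ∈ T, wt d m := by
    rw [Finset.prod_const, hT]
    unfold wt
    rw [abs_of_nonneg hm, ← ENNReal.rpow_natCast, ← ENNReal.rpow_natCast, ← ENNReal.rpow_mul,
      ENNReal.inv_rpow, ← ENNReal.rpow_neg]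
    congr 1
    unfold pp
    push_cast
    field_simp
  rw [h1]
  calc _ ≤ ∏ i ∈ T, wt d (tri (u i)) := by
        apply Finset.prod_le_prod'
        intro i hi
        apply wt_anti
        rw [abs_of_nonneg (tri_nonneg _), abs_of_nonneg hm]
        exact hT2 i hi
    _ ≤ GG n d u := by
        apply Finset.prod_le_prod_of_subset_of_one_le' (Finset.subset_univ _)
        intro i _ _
        apply one_le_wt
        rw [abs_of_nonneg (tri_nonneg _)]
        exact tri_le_one _

/-- uniform probability on the unit cube -/
def PP (n : ℕ) : Measure (Fin n → ℝ) :=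
  Measure.pi (fun _ : Fin n => (volume : Measure ℝ).restrict (Icc 0 1))

instance instProbIcc : IsProbabilityMeasure ((volume : Measure ℝ).restrict (Icc 0 1)) :=
  ⟨by simp⟩

instance instProbPP (n : ℕ) : IsProbabilityMeasure (PP n) := by
  unfold PP; infer_instance

lemma PP_ae (n : ℕ) : ∀ᵐ a ∂(PP n), ∀ i, a i ∈ Icc (0:ℝ) 1 := by
  rw [ae_all_iff]
  intro i
  have := (measurePreserving_eval (fun _ : Fin n => (volume : Measure ℝ).restrict (Icc 0 1)) i)
  have h2 : ∀ᵐ t ∂((volume : Measure ℝ).restrict (Icc 0 1)), t ∈ Icc (0:ℝ) 1 :=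
    ae_restrict_mem measurableSet_Icc
  exact this.quasiMeasurePreserving.ae h2

lemma GG_int (n d : ℕ) (t : Fin n → ℝ) :
    ∫⁻ a, GG n d (fun i => t i - a i) ∂(PP n) ≤ (3 * (kap d + 1)) ^ n := by
  have hm : ∀ i, Measurable (fun b : ℝ => wt d (tri (t i - b))) := fun i =>
    (wt_measurable d).comp (tri_continuous.measurable.comp (measurable_const.sub measurable_id))
  have hi := ProbabilityTheory.iIndepFun_pi
    (μ := (fun _ : Fin n => (volume : Measure ℝ).restrict (Icc 0 1)))
    (X := fun i b => wt d (tri (t i - b))) (fun i => (hm i).aemeasurable)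
  have := ProbabilityTheory.lintegral_prod_eq_prod_lintegral_of_indepFun Finset.univ _ hi
    (fun i => (hm i).comp (measurable_pi_apply i))
  unfold GG PP
  rw [this]
  calc _ ≤ ∏ i : Fin n, (3 * (kap d + 1)) := by
        apply Finset.prod_le_prod'
        intro i _
        have e := (measurePreserving_eval
          (fun _ : Fin n => (volume : Measure ℝ).restrict (Icc 0 1)) i).lintegral_comp (hm i)
        rw [e]
        exact wt_tri_int d (t i)
    _ = _ := by simp

/-- averaging constant -/
def CG (n d : ℕ) : ℝ≥0∞ := (3 * (kap d + 1)) ^ n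

lemma CG_lt_top (n d : ℕ) : CG n d < ⊤ := by
  unfold CG
  apply ENNReal.pow_lt_top
  exact ENNReal.mul_lt_top (by simp) (ENNReal.add_lt_top.2 ⟨kap_lt_top d, by simp⟩)

lemma GG_swap (n d : ℕ) (x0 : Euc n) (l : ℝ) (ν : Measure (Euc n)) [IsFiniteMeasure ν] :
    Measurable (fun a : Fin n → ℝ => ∫⁻ x, GG n d (fun i => (x i - x0 i) / l - a i) ∂ν) ∧
    ∫⁻ a, ∫⁻ x, GG n d (fun i => (x i - x0 i) / l - a i) ∂ν ∂(PP n) ≤ CG n d * ν univ := by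
  have hm : Measurable (fun q : (Fin n → ℝ) × Euc n =>
      GG n d (fun i => (q.2 i - x0 i) / l - q.1 i)) := by
    apply (GG_measurable n d).comp
    rw [measurable_pi_iff]
    intro i
    have h1 : Measurable (fun q : (Fin n → ℝ) × Euc n => q.2 i) :=
      (by fun_prop : Continuous (fun x : Euc n => x i)).measurable.comp measurable_snd
    have h2 : Measurable (fun q : (Fin n → ℝ) × Euc n => q.1 i) :=
      (measurable_pi_apply i).comp measurable_fst
    exact ((h1.sub_const _).div_const _).sub h2
  refine ⟨hm.lintegral_prod_right', ?_⟩
  rw [lintegral_lintegral_swap hm.aemeasurable]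
  calc _ ≤ ∫⁻ x, CG n d ∂ν := lintegral_mono fun x => GG_int n d _
    _ = _ := by simp

lemma exists_good (n d : ℕ) (x0 : Euc n) (l : ℝ) (ν1 ν2 : Measure (Euc n)) [IsFiniteMeasure ν1]
    [IsFiniteMeasure ν2] :
    ∃ a : Fin n → ℝ, (∀ i, a i ∈ Icc (0:ℝ) 1) ∧
      ∫⁻ x, GG n d (fun i => (x i - x0 i) / l - a i) ∂ν1 ≤ CG n d * ν1 univ ∧
      ∫⁻ x, GG n d (fun i => (x i - x0 i) / l - a i) ∂ν2 < ⊤ := by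
  obtain ⟨m1, h1⟩ := GG_swap n d x0 l ν1
  obtain ⟨m2, h2⟩ := GG_swap n d x0 l ν2
  have h3 := ae_lt_top m2 (lt_of_le_of_lt h2
    (ENNReal.mul_lt_top (CG_lt_top n d) (measure_lt_top _ _))).ne
  have h4 := (PP_ae n).and h3
  obtain ⟨a, ha, ha2⟩ := exists_notMem_null_le_lintegral m1.aemeasurable (ae_iff.1 h4)
  simp only [mem_ofPred_eq, not_not] at ha
  exact ⟨a, ha.1, ha2.trans h1, ha.2⟩

/-! ### the skeleton -/

lemma euc_dist_le {n : ℕ} (x y : Euc n) (D : ℝ) (hD : 0 ≤ D) (h : ∀ i, |x i - y i| ≤ D) :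
    dist x y ≤ n * D := by
  rw [EuclideanSpace.dist_eq]
  apply Real.sqrt_le_iff.2
  refine ⟨by positivity, ?_⟩
  calc ∑ i, dist (x i) (y i) ^ 2 ≤ ∑ i : Fin n, D ^ 2 := by
        apply Finset.sum_le_sum
        intro i _
        rw [Real.dist_eq]
        exact pow_le_pow_left₀ (abs_nonneg _) (h i) 2
    _ = n * D ^ 2 := by simp
    _ ≤ (n * D) ^ 2 := by
        rw [mul_pow]
        gcongr
        have : (n : ℝ) ≤ (n : ℝ) ^ 2 := by exact_mod_cast Nat.le_self_pow (by norm_num) n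
        exact this

lemma euc_coord_le {n : ℕ} (x y : Euc n) (i : Fin n) : |x i - y i| ≤ dist x y := by
  have := PiLp.norm_apply_le (x - y) i
  rwa [← dist_eq_norm, Real.norm_eq_abs] at this

/-- unit cell skeleton -/
def Sk (n d : ℕ) : Set (Euc n) :=
  {w | (∀ i, |w i| ≤ 1) ∧ ∃ T : Finset (Fin n), T.card = n - d ∧ ∀ i ∈ T, |w i| = 1}

lemma Sk_piece (n d : ℕ) (hdn : d < n) (T : Finset (Fin n)) (hT : T.card = n - d)
    (e : Fin n → ℝ) :
    μH[(d : ℝ)] {w : Euc n | (∀ i, |w i| ≤ 1) ∧ ∀ i ∈ T, w i = e i} < ⊤ := by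
  classical
  let f : ({i // i ∉ T} → ℝ) → Euc n := fun v =>
    WithLp.toLp 2 (fun i => if h : i ∉ T then v ⟨i, h⟩ else e i)
  have hf : LipschitzWith n f := by
    apply LipschitzWith.of_dist_le_mul
    intro v w
    have := euc_dist_le (f v) (f w) (dist v w) dist_nonneg (by
      intro i
      by_cases h : i ∉ T
      · simp only [f, h, not_false_eq_true, dite_true]
        rw [← Real.dist_eq]
        exact dist_le_pi_dist v w ⟨i, h⟩
      · simp only [f, h, dite_false, sub_self, abs_zero]
        exact dist_nonneg)
    simpa using this
  have hsub : {w : Euc n | (∀ i, |w i| ≤ 1) ∧ ∀ i ∈ T, w i = e i} ⊆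
      f '' (Set.pi univ fun _ => Icc (-1:ℝ) 1) := by
    rintro w ⟨h1, h2⟩
    refine ⟨fun i => w i.1, fun i _ => abs_le.1 (h1 i.1), ?_⟩
    ext i
    by_cases h : i ∉ T
    · simp [f, h]
    · simp only [f, h, dite_false]
      exact (h2 i (not_not.1 h)).symm
  have hcard : Fintype.card {i // i ∉ T} = d := by
    rw [Fintype.card_subtype_compl]
    simp [hT]; omega
  refine lt_of_le_of_lt (measure_mono hsub) ?_
  refine lt_of_le_of_lt (hf.hausdorffMeasure_image_le (by positivity) _) ?_
  have hv := hausdorffMeasure_pi_real (ι := {i // i ∉ T})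
  rw [hcard] at hv
  rw [hv, ENNReal.rpow_natCast]
  refine ENNReal.mul_lt_top (ENNReal.pow_lt_top (by simp)) ?_
  exact (isCompact_univ_pi fun _ => isCompact_Icc).measure_lt_top

lemma Sk_lt_top (n d : ℕ) (hdn : d < n) : μH[(d : ℝ)] (Sk n d) < ⊤ := by
  have hsub : Sk n d ⊆ ⋃ p : {T : Finset (Fin n) // T.card = n - d} × (Fin n → Bool),
      {w : Euc n | (∀ i, |w i| ≤ 1) ∧ ∀ i ∈ p.1.1, w i = if p.2 i then 1 else -1} := by
    rintro w ⟨h1, T, hT, h2⟩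
    refine mem_iUnion.2 ⟨(⟨T, hT⟩, fun i => decide (w i = 1)), h1, ?_⟩
    intro i hi
    have := h2 i hi
    by_cases h : w i = 1
    · simp [h]
    · rcases eq_or_eq_neg_of_abs_eq this with h' | h'
      · exact absurd h' h
      · simp [h']
  refine lt_of_le_of_lt (measure_mono hsub) ?_
  refine lt_of_le_of_lt (measure_iUnion_fintype_le _ _) ?_
  rw [ENNReal.sum_lt_top]
  intro p _
  exact Sk_piece n d hdn p.1.1 p.1.2 _

/-- scaled grid skeleton, cells indexed by `|c i| ≤ N` -/
def SkN (n d : ℕ) (b : Euc n) (l : ℝ) (N : ℕ) : Set (Euc n) :=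
  {z | ∃ c : Fin n → ℤ, (∀ i, |c i| ≤ N) ∧ ∃ w ∈ Sk n d, ∀ i, z i = b i + l * (2 * c i + w i)}

lemma SkN_le (n d : ℕ) (b : Euc n) (l : ℝ) (hl : 0 ≤ l) (N : ℕ) :
    μH[(d : ℝ)] (SkN n d b l N) ≤
      (2 * N + 1 : ℝ≥0∞) ^ n * (ENNReal.ofReal l ^ d * μH[(d : ℝ)] (Sk n d)) := by
  classical
  let g : (Fin n → ℤ) → Euc n → Euc n := fun c w =>
    WithLp.toLp 2 (fun i => b i + l * (2 * c i + w i))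
  have hg : ∀ c, LipschitzWith (Real.toNNReal l) (g c) := by
    intro c
    apply LipschitzWith.of_dist_le_mul
    intro v w
    rw [Real.coe_toNNReal _ hl, dist_eq_norm, dist_eq_norm]
    have : g c v - g c w = l • (v - w) := by
      ext i; simp [g]; ring
    rw [this, norm_smul, Real.norm_of_nonneg hl]
  let S : Finset (Fin n → ℤ) := Fintype.piFinset (fun _ => Finset.Icc (-(N:ℤ)) N)
  have hsub : SkN n d b l N ⊆ ⋃ c ∈ S, g c '' (Sk n d) := by
    rintro z ⟨c, hc, w, hw, h⟩
    refine mem_iUnion₂.2 ⟨c, ?_, w, hw, ?_⟩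
    · simp only [S, Fintype.mem_piFinset, Finset.mem_Icc]
      exact fun i => abs_le.1 (hc i)
    · ext i; simp [g, h]
  have hcard : (S.card : ℝ≥0∞) = (2 * N + 1 : ℝ≥0∞) ^ n := by
    simp only [S, Fintype.card_piFinset, Int.card_Icc, Finset.prod_const, Finset.card_univ,
      Fintype.card_fin]
    have : ((N : ℤ) + 1 - -(N : ℤ)).toNat = 2 * N + 1 := by omega
    rw [this]; push_cast; rfl
  refine (measure_mono hsub).trans ((measure_biUnion_finset_le _ _).trans ?_)
  calc _ ≤ ∑ c ∈ S, (ENNReal.ofReal l ^ d * μH[(d : ℝ)] (Sk n d)) := by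
        apply Finset.sum_le_sum
        intro c _
        have := (hg c).hausdorffMeasure_image_le (d := d) (by positivity) (Sk n d)
        rw [ENNReal.rpow_natCast] at this
        exact this
    _ = _ := by rw [Finset.sum_const, nsmul_eq_mul, hcard]

/-! ### the deformation -/

/-- the `m` function at scale `l`, grid based at `b` -/
def mm (n d : ℕ) (b : Euc n) (l : ℝ) (x : Euc n) : ℝ :=
  ord n d (fun i => tri ((x i - b i) / l))

/-- cutoff -/
def eta (n : ℕ) (x0 : Euc n) (ρ l : ℝ) (x : Euc n) : ℝ := max 0 ((dist x x0 - ρ) / l)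

/-- folding parameter -/
def ss (n d : ℕ) (b x0 : Euc n) (l ρ δ : ℝ) (x : Euc n) : ℝ :=
  min 1 (max δ (max (mm n d b l x) (eta n x0 ρ l x)))

/-- the deformation -/
def phi (n d : ℕ) (b x0 : Euc n) (l ρ δ : ℝ) (x : Euc n) : Euc n :=
  WithLp.toLp 2 (fun i => b i + l * hh (ss n d b x0 l ρ δ x) ((x i - b i) / l))

lemma coord_scaled {n : ℕ} (b : Euc n) {l : ℝ} (hl : 0 < l) (x y : Euc n) (i : Fin n) :
    |(x i - b i) / l - (y i - b i) / l| ≤ dist x y / l := by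
  rw [← sub_div, sub_sub_sub_cancel_right, abs_div, abs_of_pos hl]
  gcongr
  exact euc_coord_le x y i

lemma mm_lip {n d : ℕ} (hdn : d < n) (b : Euc n) {l : ℝ} (hl : 0 < l) (x y : Euc n) :
    mm n d b l x ≤ mm n d b l y + dist x y / l := by
  unfold mm
  apply ord_lip hdn
  intro i
  exact (tri_lip _ _).trans (by gcongr; exact coord_scaled b hl x y i)

lemma mm_nonneg {n d : ℕ} (hdn : d < n) (b : Euc n) (l : ℝ) (x : Euc n) : 0 ≤ mm n d b l x :=
  le_ord hdn _ _ fun _ => tri_nonneg _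

lemma mm_le_one {n d : ℕ} (hdn : d < n) (b : Euc n) (l : ℝ) (x : Euc n) : mm n d b l x ≤ 1 :=
  ord_le hdn _ _ fun _ => tri_le_one _

lemma continuous_of_le_add {X : Type*} [PseudoMetricSpace X] (f : X → ℝ) {l : ℝ} (hl : 0 < l)
    (h : ∀ x y, f x ≤ f y + dist x y / l) : Continuous f := by
  have : LipschitzWith (Real.toNNReal (1 / l)) f := by
    refine LipschitzWith.of_le_add_mul _ fun x y => ?_
    rw [Real.coe_toNNReal _ (by positivity)]
    have := h x y
    rwa [div_eq_inv_mul, ← one_div] at this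
  exact this.continuous

lemma mm_continuous {n d : ℕ} (hdn : d < n) (b : Euc n) {l : ℝ} (hl : 0 < l) :
    Continuous (mm n d b l) := continuous_of_le_add _ hl (mm_lip hdn b hl)

lemma eta_lip {n : ℕ} (x0 : Euc n) (ρ : ℝ) {l : ℝ} (hl : 0 < l) (x y : Euc n) :
    eta n x0 ρ l x ≤ eta n x0 ρ l y + dist x y / l := by
  unfold eta
  have h0 : 0 ≤ dist x y / l := by positivity
  apply max_le
  · have := le_max_left 0 ((dist y x0 - ρ) / l); linarith
  · have := le_max_right 0 ((dist y x0 - ρ) / l)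
    have h : (dist x x0 - ρ) / l ≤ (dist y x0 - ρ) / l + dist x y / l := by
      rw [← add_div]; gcongr; linarith [dist_triangle x y x0]
    linarith

lemma ss_lip {n d : ℕ} (hdn : d < n) (b x0 : Euc n) {l : ℝ} (hl : 0 < l) (ρ δ : ℝ) (x y : Euc n) :
    ss n d b x0 l ρ δ x ≤ ss n d b x0 l ρ δ y + dist x y / l := by
  unfold ss
  have h0 : 0 ≤ dist x y / l := by positivity
  rw [← min_add_add_right, ← max_add_add_right, ← max_add_add_right]
  apply min_le_min (by linarith)
  apply max_le_max (by linarith)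
  exact max_le_max (mm_lip hdn b hl x y) (eta_lip x0 ρ hl x y)

lemma ss_continuous {n d : ℕ} (hdn : d < n) (b x0 : Euc n) {l : ℝ} (hl : 0 < l) (ρ δ : ℝ) :
    Continuous (ss n d b x0 l ρ δ) := continuous_of_le_add _ hl (ss_lip hdn b x0 hl ρ δ)

lemma ss_abs {n d : ℕ} (hdn : d < n) (b x0 : Euc n) {l : ℝ} (hl : 0 < l) (ρ δ : ℝ) (x y : Euc n) :
    |ss n d b x0 l ρ δ x - ss n d b x0 l ρ δ y| ≤ dist x y / l := by
  rw [abs_le]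
  have h1 := ss_lip hdn b x0 hl ρ δ x y
  have h2 := ss_lip hdn b x0 hl ρ δ y x
  rw [dist_comm] at h2
  constructor <;> linarith

lemma ss_le_one (n d : ℕ) (b x0 : Euc n) (l ρ δ : ℝ) (x : Euc n) : ss n d b x0 l ρ δ x ≤ 1 :=
  min_le_left _ _

lemma le_ss (n d : ℕ) (b x0 : Euc n) (l ρ δ : ℝ) (hδ : δ ≤ 1) (x : Euc n) :
    δ ≤ ss n d b x0 l ρ δ x := le_min hδ (le_max_left _ _)

lemma mm_le_ss {n d : ℕ} (hdn : d < n) (b x0 : Euc n) (l ρ δ : ℝ) (x : Euc n) :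
    mm n d b l x ≤ ss n d b x0 l ρ δ x :=
  le_min (mm_le_one hdn b l x) ((le_max_left _ _).trans (le_max_right _ _))

lemma phi_lip {n d : ℕ} (hdn : d < n) (b x0 : Euc n) {l : ℝ} (hl : 0 < l) (ρ : ℝ) {δ : ℝ}
    (hδ : 0 < δ) (hδ1 : δ ≤ 1) (x y : Euc n) :
    dist (phi n d b x0 l ρ δ x) (phi n d b x0 l ρ δ y) ≤
      2 * n * dist x y / ss n d b x0 l ρ δ x := by
  have hx : 0 < ss n d b x0 l ρ δ x := hδ.trans_le (le_ss n d b x0 l ρ δ hδ1 x)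
  have hy : 0 < ss n d b x0 l ρ δ y := hδ.trans_le (le_ss n d b x0 l ρ δ hδ1 y)
  have := euc_dist_le (phi n d b x0 l ρ δ x) (phi n d b x0 l ρ δ y)
    (2 * dist x y / ss n d b x0 l ρ δ x) (by positivity) (by
      intro i
      simp only [phi]
      rw [add_sub_add_left_eq_sub, ← mul_sub, abs_mul, abs_of_pos hl]
      have := hh_lip _ _ _ _ _ hx hy (ss_le_one ..) (ss_le_one ..) (coord_scaled b hl x y i)
        (ss_abs hdn b x0 hl ρ δ x y)
      calc _ ≤ l * (2 * (dist x y / l) / ss n d b x0 l ρ δ x) := by gcongr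
        _ = _ := by field_simp)
  refine this.trans (le_of_eq ?_)
  ring

lemma phi_dist {n d : ℕ} (b x0 : Euc n) {l : ℝ} (hl : 0 < l) (ρ : ℝ) {δ : ℝ}
    (hδ : 0 < δ) (hδ1 : δ ≤ 1) (x : Euc n) :
    dist (phi n d b x0 l ρ δ x) x ≤ n * l := by
  apply euc_dist_le _ _ _ hl.le
  intro i
  have hx : 0 < ss n d b x0 l ρ δ x := hδ.trans_le (le_ss n d b x0 l ρ δ hδ1 x)
  have h := hh_sub_self (ss n d b x0 l ρ δ x) ((x i - b i) / l) hx
  simp only [phi]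
  have e : b i + l * hh (ss n d b x0 l ρ δ x) ((x i - b i) / l) - x i =
      l * (hh (ss n d b x0 l ρ δ x) ((x i - b i) / l) - (x i - b i) / l) := by
    field_simp; ring
  rw [e, abs_mul, abs_of_pos hl]
  nlinarith

lemma phi_fixed {n d : ℕ} (b x0 : Euc n) {l : ℝ} (hl : 0 < l) (ρ δ : ℝ) (x : Euc n)
    (h : ρ + l ≤ dist x x0) : phi n d b x0 l ρ δ x = x := by
  have he : 1 ≤ eta n x0 ρ l x := by
    refine le_trans ?_ (le_max_right _ _)
    rw [le_div_iff₀ hl]; linarith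
  have hs : ss n d b x0 l ρ δ x = 1 :=
    min_eq_left (he.trans ((le_max_right _ _).trans (le_max_right _ _)))
  ext i
  simp only [phi, hs, hh_one]
  field_simp; ring

lemma phi_moved_subset {n d : ℕ} (b x0 : Euc n) {l : ℝ} (hl : 0 < l) (ρ δ : ℝ) :
    {x | phi n d b x0 l ρ δ x ≠ x} ⊆ ball x0 (ρ + l) := by
  intro x hx
  by_contra h
  exact hx (phi_fixed b x0 hl ρ δ x (by simpa [mem_ball] using h))

lemma phi_skel {n d : ℕ} (hdn : d < n) (b x0 : Euc n) {l : ℝ} (hl : 0 < l) (ρ : ℝ) {δ : ℝ}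
    (hδ : 0 < δ) (N : ℕ) (hb : ∀ i, |x0 i - b i| ≤ l) (hN : ρ / l + 2 ≤ 2 * N)
    (x : Euc n) (hx : dist x x0 ≤ ρ) (hm : δ ≤ mm n d b l x) :
    phi n d b x0 l ρ δ x ∈ SkN n d b l N := by
  have he : eta n x0 ρ l x = 0 := by
    apply max_eq_left
    exact div_nonpos_of_nonpos_of_nonneg (by linarith) hl.le
  have hs : ss n d b x0 l ρ δ x = mm n d b l x := by
    unfold ss
    rw [he, max_eq_left (mm_nonneg hdn b l x), max_eq_right hm, min_eq_right (mm_le_one hdn b l x)]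
  have hpos : 0 < mm n d b l x := hδ.trans_le hm
  obtain ⟨T, hT, hT2⟩ := ord_high hdn (fun i => tri ((x i - b i) / l))
  refine ⟨fun i => round ((x i - b i) / l / 2), ?_, WithLp.toLp 2 (fun i =>
    hh (mm n d b l x) ((x i - b i) / l) - cc ((x i - b i) / l)), ⟨?_, T, hT, ?_⟩, ?_⟩
  · intro i
    have h1 : |((x i - b i) / l / 2) - (round ((x i - b i) / l / 2) : ℤ)| ≤ 1 / 2 :=
      abs_sub_round _
    have h2 : |(x i - b i) / l| ≤ ρ / l + 1 := by
      rw [abs_div, abs_of_pos hl, div_le_iff₀ hl, add_mul, div_mul_cancel₀ _ hl.ne', one_mul]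
      have := euc_coord_le x x0 i
      have h3 := abs_sub_le (x i) (x0 i) (b i)
      linarith [hb i]
    rw [abs_le] at h1 h2
    have h4 : |((round ((x i - b i) / l / 2) : ℤ) : ℝ)| ≤ N := by
      rw [abs_le]; constructor <;> linarith
    exact_mod_cast h4
  · intro i; exact hh_sub_cc _ _
  · intro i hi; exact hh_fold _ _ hpos (hT2 i hi)
  · intro i
    simp only [phi, hs]
    unfold cc
    ring

lemma phi_deformation {n d : ℕ} (hdn : d < n) (b x0 : Euc n) {l : ℝ} (hl : 0 < l) (ρ : ℝ) {δ : ℝ}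
    (hδ : 0 < δ) (hδ1 : δ ≤ 1) (U : Set (Euc n)) (hU : closedBall x0 (ρ + l) ⊆ U) :
    IsDeformation n U (phi n d b x0 l ρ δ) := by
  have hL : LipschitzWith (Real.toNNReal (2 * n / δ)) (phi n d b x0 l ρ δ) := by
    apply LipschitzWith.of_dist_le_mul
    intro x y
    rw [Real.coe_toNNReal _ (by positivity)]
    refine (phi_lip hdn b x0 hl ρ hδ hδ1 x y).trans ?_
    have : 2 * n / δ * dist x y = 2 * n * dist x y / δ := by ring
    rw [this]
    have := le_ss n d b x0 l ρ δ hδ1 x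
    gcongr
  have hsub : closure {x | phi n d b x0 l ρ δ x ≠ x} ⊆ closedBall x0 (ρ + l) :=
    closure_minimal ((phi_moved_subset b x0 hl ρ δ).trans ball_subset_closedBall)
      isClosed_closedBall
  refine ⟨⟨_, hL⟩, ⟨hL.continuous, ⟨ContinuousMap.Homotopy.affine _ _⟩⟩, ?_, hsub.trans hU⟩
  exact (isCompact_closedBall x0 (ρ + l)).of_isClosed_subset isClosed_closure hsub

lemma phi_diam {n d : ℕ} (b x0 : Euc n) {l : ℝ} (hl : 0 < l) {ρ : ℝ} (hρ : 0 ≤ ρ) {δ : ℝ}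
    (hδ : 0 < δ) (hδ1 : δ ≤ 1) :
    diam ({x | phi n d b x0 l ρ δ x ≠ x} ∪
      phi n d b x0 l ρ δ '' {x | phi n d b x0 l ρ δ x ≠ x}) ≤ 2 * (ρ + (n + 1) * l) := by
  have h : {x | phi n d b x0 l ρ δ x ≠ x} ∪
      phi n d b x0 l ρ δ '' {x | phi n d b x0 l ρ δ x ≠ x} ⊆
      closedBall x0 (ρ + (n + 1) * l) := by
    have hn : (0:ℝ) ≤ n * l := by positivity
    rintro y (hy | ⟨x, hx, rfl⟩)
    · have := phi_moved_subset b x0 hl ρ δ hy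
      rw [mem_ball] at this
      rw [mem_closedBall]; linarith
    · have := phi_moved_subset b x0 hl ρ δ hx
      rw [mem_ball] at this
      have h2 := phi_dist (d := d) b x0 hl ρ hδ hδ1 x
      rw [mem_closedBall]
      linarith [dist_triangle (phi n d b x0 l ρ δ x) x x0]
  exact (diam_mono h isBounded_closedBall).trans (diam_closedBall (by positivity))

/-- local Lipschitz estimate for the Hausdorff measure of images -/
lemma phi_image {n d : ℕ} (hdn : d < n) (b x0 : Euc n) {l : ℝ} (hl : 0 < l) (ρ : ℝ) {δ : ℝ}
    (hδ : 0 < δ) (hδ1 : δ ≤ 1) (A : Set (Euc n)) (hA : MeasurableSet A) :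
    μH[(d : ℝ)] (phi n d b x0 l ρ δ '' A) ≤
      (4 * n : ℝ≥0∞) ^ d * ∫⁻ x in A, GG n d (fun i => (x i - b i) / l) ∂μH[(d : ℝ)] := by
  set s := ss n d b x0 l ρ δ with hs
  have hspos : ∀ x, 0 < s x := fun x => hδ.trans_le (le_ss n d b x0 l ρ δ hδ1 x)
  have hsc : Continuous s := ss_continuous hdn b x0 hl ρ δ
  let B : ℕ → Set (Euc n) := fun j => A ∩ s ⁻¹' (Ioc ((1/2:ℝ)^(j+1)) ((1/2:ℝ)^j))
  have hBm : ∀ j, MeasurableSet (B j) := fun j => hA.inter (hsc.measurable measurableSet_Ioc)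
  have hun : A = ⋃ j, B j := by
    ext x
    simp only [B, mem_iUnion, mem_inter_iff, mem_preimage]
    constructor
    · intro hx
      obtain ⟨j, hj⟩ := exists_nat_pow_near_of_lt_one (hspos x) (ss_le_one ..)
        (by norm_num : (0:ℝ) < 1/2) (by norm_num : (1/2:ℝ) < 1)
      exact ⟨j, hx, hj⟩
    · rintro ⟨j, hx, _⟩; exact hx
  have hdisj : Pairwise (Function.onFun Disjoint B) := by
    have key : ∀ i j, i < j → Disjoint (B i) (B j) := by
      intro i j hij
      rw [Set.disjoint_left]
      rintro x ⟨_, hi⟩ ⟨_, hj⟩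
      have : (1/2:ℝ)^j ≤ (1/2:ℝ)^(i+1) :=
        pow_le_pow_of_le_one (by norm_num) (by norm_num) hij
      linarith [hi.1, hj.2]
    intro i j hij
    rcases lt_or_gt_of_ne hij with h | h
    · exact key i j h
    · exact (key j i h).symm
  have hpiece : ∀ j, μH[(d : ℝ)] (phi n d b x0 l ρ δ '' (B j)) ≤
      (4 * n : ℝ≥0∞) ^ d * ∫⁻ x in B j, GG n d (fun i => (x i - b i) / l) ∂μH[(d : ℝ)] := by
    intro j
    have hL : LipschitzOnWith (2 * n * 2 ^ (j+1)) (phi n d b x0 l ρ δ) (B j) := by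
      apply LipschitzOnWith.of_dist_le_mul
      intro x hx y _
      refine (phi_lip hdn b x0 hl ρ hδ hδ1 x y).trans ?_
      have h1 : (1/2:ℝ)^(j+1) ≤ ss n d b x0 l ρ δ x := hx.2.1.le
      calc 2 * n * dist x y / ss n d b x0 l ρ δ x ≤ 2 * n * dist x y / (1/2:ℝ)^(j+1) := by gcongr
        _ = _ := by push_cast; rw [one_div, inv_pow, div_inv_eq_mul]; ring
    have h2 := hL.hausdorffMeasure_image_le (d := d) (by positivity)
    rw [ENNReal.rpow_natCast] at h2
    refine h2.trans ?_
    have e : ((2 * n * 2 ^ (j+1) : ℝ≥0) : ℝ≥0∞) ^ d = (4 * n : ℝ≥0∞) ^ d * ((2:ℝ≥0∞)^j) ^ d := by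
      rw [← mul_pow]; push_cast; congr 1; ring
    rw [e, mul_assoc]
    gcongr
    calc ((2:ℝ≥0∞)^j)^d * μH[(d : ℝ)] (B j) = ∫⁻ x in B j, ((2:ℝ≥0∞)^j)^d ∂μH[(d : ℝ)] := by simp
      _ ≤ _ := by
        apply setLIntegral_mono' (hBm j)
        intro x hx
        refine le_trans ?_ (ord_GG hdn _)
        gcongr
        rw [ENNReal.le_inv_iff_le_inv]
        have h3 : mm n d b l x ≤ (1/2:ℝ)^j := (mm_le_ss hdn b x0 l ρ δ x).trans hx.2.2
        refine (ENNReal.ofReal_le_ofReal h3).trans (le_of_eq ?_)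
        rw [ENNReal.ofReal_pow (by norm_num), one_div, ENNReal.ofReal_inv_of_pos (by norm_num),
          ENNReal.inv_pow]
        simp
  calc μH[(d : ℝ)] (phi n d b x0 l ρ δ '' A)
      = μH[(d : ℝ)] (⋃ j, phi n d b x0 l ρ δ '' (B j)) := by rw [← image_iUnion, ← hun]
    _ ≤ ∑' j, μH[(d : ℝ)] (phi n d b x0 l ρ δ '' (B j)) := measure_iUnion_le _
    _ ≤ ∑' j, (4 * n : ℝ≥0∞) ^ d *
        ∫⁻ x in B j, GG n d (fun i => (x i - b i) / l) ∂μH[(d : ℝ)] := ENNReal.tsum_le_tsum hpiece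
    _ = _ := by
      rw [ENNReal.tsum_mul_left, ← lintegral_iUnion hBm hdisj, ← hun]

/-! ### the core inequality -/

lemma GG_top_of_mm {n d : ℕ} (hd : 1 ≤ d) (hdn : d < n) (b : Euc n) (l : ℝ) (x : Euc n)
    (h : mm n d b l x ≤ 0) : GG n d (fun i => (x i - b i) / l) = ⊤ := by
  have h1 := ord_GG hdn (fun i => (x i - b i) / l)
  have h2 : ENNReal.ofReal (ord n d (fun i => tri ((x i - b i) / l))) = 0 :=
    ENNReal.ofReal_eq_zero.2 h
  rw [h2, ENNReal.inv_zero, ENNReal.top_pow (by omega)] at h1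
  exact top_le_iff.1 h1

lemma small_part {n d : ℕ} (hd : 1 ≤ d) (hdn : d < n) (b : Euc n) {l : ℝ} (hl : 0 < l)
    (ν : Measure (Euc n)) [IsFiniteMeasure ν]
    (hfin : ∫⁻ x, GG n d (fun i => (x i - b i) / l) ∂ν < ⊤) :
    Tendsto (fun j : ℕ => ∫⁻ x in {x | mm n d b l x < 1 / ((j : ℝ) + 1)},
      GG n d (fun i => (x i - b i) / l) ∂ν) atTop (𝓝 0) := by
  have hm : Measurable (fun x : Euc n => GG n d (fun i => (x i - b i) / l)) := by
    apply (GG_measurable n d).comp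
    rw [measurable_pi_iff]
    intro i
    exact ((by fun_prop : Continuous (fun x : Euc n => x i)).measurable.sub_const _).div_const _
  apply tendsto_setLIntegral_zero hfin.ne
  have hmm := (mm_continuous hdn b hl).measurable
  have hs : ∀ j : ℕ, MeasurableSet {x | mm n d b l x < 1 / ((j : ℝ) + 1)} := fun j =>
    hmm measurableSet_Iio
  have hanti : Antitone (fun j : ℕ => {x | mm n d b l x < 1 / ((j : ℝ) + 1)}) := by
    intro i j hij x hx
    simp only [mem_ofPred_eq] at *
    refine hx.trans_le ?_
    have : (i : ℝ) ≤ j := by exact_mod_cast hij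
    gcongr
  have ht := tendsto_measure_iInter_atTop (μ := ν) (fun j => (hs j).nullMeasurableSet) hanti
    ⟨0, measure_ne_top _ _⟩
  have h0 : ν (⋂ j : ℕ, {x | mm n d b l x < 1 / ((j : ℝ) + 1)}) = 0 := by
    have hae := ae_lt_top hm hfin.ne
    refine measure_mono_null ?_ (ae_iff.1 hae)
    intro x hx
    simp only [mem_ofPred_eq, mem_iInter] at *
    have : mm n d b l x ≤ 0 := by
      by_contra hc
      obtain ⟨j, hj⟩ := exists_nat_one_div_lt (not_le.1 hc)
      exact absurd (hx j) (not_lt.2 hj.le)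
    rw [GG_top_of_mm hd hdn b l x this]
    simp
  rw [h0] at ht
  exact ht

lemma core {n d : ℕ} (hd : 1 ≤ d) (hdn : d < n) (U : Set (Euc n)) (M ε : ℝ → ℝ)
    (hM : MonotoneOn M (Ici 0)) (hε : MonotoneOn ε (Ici 0)) (E : Set (Euc n))
    (hE : MemQM n d U (fun r => ENNReal.ofReal (M r)) (fun r => ENNReal.ofReal (ε r)) E)
    (x0 : Euc n) {l ρ : ℝ} (hl : 0 < l) (hρ : 0 ≤ ρ) (hU : closedBall x0 (ρ + l) ⊆ U)
    (N : ℕ) (hN : ρ / l + 2 ≤ 2 * N) (R : ℝ) (hR : 2 * (ρ + (n + 1) * l) ≤ R) :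
    μH[(d : ℝ)] (E ∩ closedBall x0 ρ) ≤ (ENNReal.ofReal (M R) + 1) *
      ((2 * N + 1 : ℝ≥0∞) ^ n * (ENNReal.ofReal l ^ d * μH[(d : ℝ)] (Sk n d)) +
        (4 * n : ℝ≥0∞) ^ d * CG n d *
          μH[(d : ℝ)] (E ∩ (closedBall x0 (ρ + l) \ closedBall x0 ρ))) +
      ENNReal.ofReal (ε R) := by
  obtain ⟨hfin, ⟨F, hF, hEF⟩, hQ⟩ := hE
  have hmeas : ∀ V : Set (Euc n), V ⊆ U → MeasurableSet V → MeasurableSet (E ∩ V) := by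
    intro V hV hVm
    have : E ∩ V = F ∩ V := by
      have h1 : E ∩ V = (E ∩ U) ∩ V := by rw [inter_assoc, inter_eq_right.2 hV]
      rw [h1, hEF, inter_assoc, inter_eq_right.2 hV]
    rw [this]
    exact hF.measurableSet.inter hVm
  set H : Measure (Euc n) := μH[(d : ℝ)] with hH
  have hcb : closedBall x0 ρ ⊆ closedBall x0 (ρ + l) := closedBall_subset_closedBall (by linarith)
  set A := E ∩ closedBall x0 ρ with hAdef
  set L := E ∩ (closedBall x0 (ρ + l) \ closedBall x0 ρ) with hLdef
  have hA : MeasurableSet A := hmeas _ (hcb.trans hU) measurableSet_closedBall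
  have hL : MeasurableSet L := hmeas _ (sdiff_subset.trans hU)
    (measurableSet_closedBall.diff measurableSet_closedBall)
  have hbig : H (E ∩ closedBall x0 (ρ + l)) < ⊤ := by
    have := (isCompact_closedBall x0 (ρ + l)).measure_lt_top (μ := H.restrict E)
    rwa [Measure.restrict_apply measurableSet_closedBall, inter_comm] at this
  have hAfin : H A < ⊤ := lt_of_le_of_lt (measure_mono (inter_subset_inter_right _ hcb)) hbig
  have hLfin : H L < ⊤ :=
    lt_of_le_of_lt (measure_mono (inter_subset_inter_right _ sdiff_subset)) hbig
  have : IsFiniteMeasure (H.restrict A) := ⟨by simpa using hAfin⟩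
  have : IsFiniteMeasure (H.restrict L) := ⟨by simpa using hLfin⟩
  obtain ⟨a, ha, ha1, ha2⟩ := exists_good n d x0 l (H.restrict L) (H.restrict A)
  set b : Euc n := WithLp.toLp 2 (fun i => x0 i + l * a i) with hb
  have hG : ∀ x : Euc n, (fun i => (x i - x0 i) / l - a i) = (fun i => (x i - b i) / l) := by
    intro x; ext i; simp only [hb]; field_simp; ring
  simp only [hG] at ha1 ha2
  rw [Measure.restrict_apply_univ] at ha1
  have hbx : ∀ i, |x0 i - b i| ≤ l := by
    intro i
    simp only [hb]
    rw [show x0 i - (x0 i + l * a i) = -(l * a i) by ring, abs_neg, abs_mul, abs_of_pos hl,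
      abs_of_nonneg (ha i).1]
    nlinarith [(ha i).2]
  set Kt : ℝ≥0∞ := (2 * N + 1 : ℝ≥0∞) ^ n * (ENNReal.ofReal l ^ d * H (Sk n d)) with hKt
  set I : ℝ → ℝ≥0∞ := fun δ => ∫⁻ x in {x | mm n d b l x < δ},
      GG n d (fun i => (x i - b i) / l) ∂(H.restrict A) with hI
  have step : ∀ δ : ℝ, 0 < δ → δ ≤ 1 → H A ≤ (ENNReal.ofReal (M R) + 1) *
      ((Kt + (4 * n : ℝ≥0∞) ^ d * CG n d * H L) + (4 * n : ℝ≥0∞) ^ d * I δ) +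
      ENNReal.ofReal (ε R) := by
    intro δ hδ hδ1
    set φ := phi n d b x0 l ρ δ with hφ
    set W := {x | φ x ≠ x} with hW
    have hWsub : W ⊆ ball x0 (ρ + l) := phi_moved_subset b x0 hl ρ δ
    have hdiam := phi_diam (d := d) b x0 hl hρ hδ hδ1
    have hq := hQ φ (phi_deformation hdn b x0 hl ρ hδ hδ1 U hU)
    have hMle : M (diam (W ∪ φ '' W)) ≤ M R :=
      hM (mem_Ici.2 diam_nonneg) (mem_Ici.2 (diam_nonneg.trans (hdiam.trans hR))) (hdiam.trans hR)
    have hεle : ε (diam (W ∪ φ '' W)) ≤ ε R :=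
      hε (mem_Ici.2 diam_nonneg) (mem_Ici.2 (diam_nonneg.trans (hdiam.trans hR))) (hdiam.trans hR)
    have hS : MeasurableSet {x | mm n d b l x < δ} :=
      (mm_continuous hdn b hl).measurable measurableSet_Iio
    have hAimg : H (φ '' A) ≤ Kt + (4 * n : ℝ≥0∞) ^ d * I δ := by
      have hsub : φ '' A ⊆ SkN n d b l N ∪ φ '' (A ∩ {x | mm n d b l x < δ}) := by
        rintro _ ⟨x, hx, rfl⟩
        rcases lt_or_ge (mm n d b l x) δ with h | h
        · exact Or.inr ⟨x, ⟨hx, h⟩, rfl⟩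
        · exact Or.inl (phi_skel hdn b x0 hl ρ hδ N hbx hN x hx.2 h)
      refine (measure_mono hsub).trans ((measure_union_le _ _).trans ?_)
      refine add_le_add (SkN_le n d b l hl.le N) ?_
      refine (phi_image hdn b x0 hl ρ hδ hδ1 _ (hA.inter hS)).trans (le_of_eq ?_)
      rw [hI]
      simp only
      rw [Measure.restrict_restrict hS, inter_comm]
    have hLimg : H (φ '' L) ≤ (4 * n : ℝ≥0∞) ^ d * CG n d * H L := by
      refine (phi_image hdn b x0 hl ρ hδ hδ1 _ hL).trans ?_
      rw [mul_assoc]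
      gcongr
    have hWimg : H (φ '' (E ∩ W)) ≤ H (φ '' A) + H (φ '' L) := by
      refine (measure_mono ?_).trans (measure_union_le _ _)
      rw [← image_union]
      apply image_mono
      rintro x ⟨hx, hxW⟩
      by_cases h : x ∈ closedBall x0 ρ
      · exact Or.inl ⟨hx, h⟩
      · exact Or.inr ⟨hx, ball_subset_closedBall (hWsub hxW), h⟩
    have hdiff : H (A \ W) ≤ H (φ '' A) := by
      apply measure_mono
      rintro x ⟨hx, hxW⟩
      refine ⟨x, hx, ?_⟩
      simpa [hW] using hxW
    have hAW : H (A ∩ W) ≤ H (E ∩ W) :=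
      measure_mono (inter_subset_inter_left _ inter_subset_left)
    calc H A ≤ H (A ∩ W) + H (A \ W) := measure_le_inter_add_sdiff _ _ _
      _ ≤ (ENNReal.ofReal (M R) * (H (φ '' A) + H (φ '' L)) + ENNReal.ofReal (ε R))
          + H (φ '' A) := by
        refine add_le_add (hAW.trans (hq.trans ?_)) hdiff
        exact add_le_add (mul_le_mul' (ENNReal.ofReal_le_ofReal hMle) hWimg)
          (ENNReal.ofReal_le_ofReal hεle)
      _ ≤ (ENNReal.ofReal (M R) * (H (φ '' A) + H (φ '' L)) + ENNReal.ofReal (ε R))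
          + (H (φ '' A) + H (φ '' L)) := by gcongr; exact le_self_add
      _ = (ENNReal.ofReal (M R) + 1) * (H (φ '' A) + H (φ '' L)) + ENNReal.ofReal (ε R) := by ring
      _ ≤ (ENNReal.ofReal (M R) + 1) * ((Kt + (4 * n : ℝ≥0∞) ^ d * I δ)
          + (4 * n : ℝ≥0∞) ^ d * CG n d * H L) + ENNReal.ofReal (ε R) := by gcongr
      _ = _ := by ring
  have hlim := small_part hd hdn b hl (H.restrict A) ha2
  have hlim2 : Tendsto (fun j : ℕ => (ENNReal.ofReal (M R) + 1) *
      ((Kt + (4 * n : ℝ≥0∞) ^ d * CG n d * H L) + (4 * n : ℝ≥0∞) ^ d * I (1 / ((j : ℝ) + 1))) +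
      ENNReal.ofReal (ε R)) atTop (𝓝 ((ENNReal.ofReal (M R) + 1) *
      ((Kt + (4 * n : ℝ≥0∞) ^ d * CG n d * H L) + (4 * n : ℝ≥0∞) ^ d * 0) +
      ENNReal.ofReal (ε R))) := by
    refine Tendsto.add ?_ tendsto_const_nhds
    refine ENNReal.Tendsto.const_mul ?_ (Or.inr (by simp))
    refine Tendsto.add tendsto_const_nhds ?_
    refine ENNReal.Tendsto.const_mul hlim (Or.inr ?_)
    exact (ENNReal.pow_lt_top (ENNReal.mul_lt_top (by simp) (by simp))).ne
  rw [mul_zero, add_zero] at hlim2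
  refine ge_of_tendsto' hlim2 fun j => step _ (by positivity) ?_
  rw [div_le_one (by positivity)]
  linarith [(Nat.cast_nonneg j : (0:ℝ) ≤ j)]

/-! ### iteration -/

/-- real constants -/
def K0 (n d : ℕ) : ℝ := ((μH[(d : ℝ)] : Measure (Euc n)) (Sk n d)).toReal

/-- real constant for the layer term -/
def C0 (n d : ℕ) : ℝ := ((4 * n : ℝ≥0∞) ^ d * CG n d).toReal

lemma K0_nonneg (n d : ℕ) : 0 ≤ K0 n d := ENNReal.toReal_nonneg

lemma C0_nonneg (n d : ℕ) : 0 ≤ C0 n d := ENNReal.toReal_nonneg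

/-- mass in a closed ball -/
def ff (n d : ℕ) (E : Set (Euc n)) (x0 : Euc n) (ρ : ℝ) : ℝ :=
  ((μH[(d : ℝ)] : Measure (Euc n)) (E ∩ closedBall x0 ρ)).toReal

lemma core_real {n d : ℕ} (hd : 1 ≤ d) (hdn : d < n) (U : Set (Euc n)) (M ε : ℝ → ℝ)
    (hM : MonotoneOn M (Ici 0)) (hε : MonotoneOn ε (Ici 0)) (E : Set (Euc n))
    (hE : MemQM n d U (fun r => ENNReal.ofReal (M r)) (fun r => ENNReal.ofReal (ε r)) E)
    (x0 : Euc n) {l ρ : ℝ} (hl : 0 < l) (hρ : 0 ≤ ρ) (hU : closedBall x0 (ρ + l) ⊆ U)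
    (N : ℕ) (hN : ρ / l + 2 ≤ 2 * N) (R : ℝ) (hR : 2 * (ρ + (n + 1) * l) ≤ R)
    (Mb eb : ℝ) (hMb : M R ≤ Mb) (hMb0 : 0 ≤ Mb) (heb : ε R ≤ eb) (heb0 : 0 ≤ eb) :
    ff n d E x0 ρ ≤ (Mb + 1) * ((2 * N + 1) ^ n * (l ^ d * K0 n d) +
      C0 n d * (ff n d E x0 (ρ + l) - ff n d E x0 ρ)) + eb := by
  have h := core hd hdn U M ε hM hε E hE x0 hl hρ hU N hN R hR
  obtain ⟨hfin, -, -⟩ := hE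
  have hcb : closedBall x0 ρ ⊆ closedBall x0 (ρ + l) := closedBall_subset_closedBall (by linarith)
  have hfin' : ∀ t, (μH[(d : ℝ)] : Measure (Euc n)) (E ∩ closedBall x0 t) < ⊤ := by
    intro t
    have := (isCompact_closedBall x0 t).measure_lt_top
      (μ := (μH[(d : ℝ)] : Measure (Euc n)).restrict E)
    rwa [Measure.restrict_apply measurableSet_closedBall, inter_comm] at this
  set H : Measure (Euc n) := μH[(d : ℝ)] with hH
  have hLeq : H (E ∩ (closedBall x0 (ρ + l) \ closedBall x0 ρ)) =
      ENNReal.ofReal (ff n d E x0 (ρ + l) - ff n d E x0 ρ) := by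
    have h1 := measure_inter_add_sdiff (μ := H) (E ∩ closedBall x0 (ρ + l))
      (measurableSet_closedBall (x := x0) (ε := ρ))
    rw [inter_assoc, inter_eq_right.2 hcb, inter_sdiff_assoc] at h1
    have hx : H (E ∩ (closedBall x0 (ρ + l) \ closedBall x0 ρ)) ≠ ⊤ :=
      (lt_of_le_of_lt (measure_mono (inter_subset_inter_right _ sdiff_subset)) (hfin' (ρ + l))).ne
    have h2 : ff n d E x0 (ρ + l) = ff n d E x0 ρ +
        (H (E ∩ (closedBall x0 (ρ + l) \ closedBall x0 ρ))).toReal := by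
      unfold ff
      rw [← ENNReal.toReal_add (hfin' ρ).ne hx, h1]
    rw [h2, add_sub_cancel_left, ENNReal.ofReal_toReal hx]
  have hnn : 0 ≤ ff n d E x0 (ρ + l) - ff n d E x0 ρ := by
    unfold ff
    rw [sub_nonneg]
    exact ENNReal.toReal_mono (hfin' _).ne (measure_mono (inter_subset_inter_right _ hcb))
  have hK : H (Sk n d) = ENNReal.ofReal (K0 n d) := (ENNReal.ofReal_toReal (Sk_lt_top n d hdn).ne).symm
  have hC : (4 * n : ℝ≥0∞) ^ d * CG n d = ENNReal.ofReal (C0 n d) := by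
    refine (ENNReal.ofReal_toReal ?_).symm
    exact (ENNReal.mul_lt_top (ENNReal.pow_lt_top (ENNReal.mul_lt_top (by simp) (by simp)))
      (CG_lt_top n d)).ne
  have hNN : (2 * N + 1 : ℝ≥0∞) = ENNReal.ofReal (2 * N + 1) := by
    rw [ENNReal.ofReal_add (by positivity) (by norm_num), ENNReal.ofReal_mul (by norm_num)]
    simp
  have k1 := K0_nonneg n d
  have k2 := C0_nonneg n d
  rw [hLeq, hK, hC, hNN] at h
  have h' : H (E ∩ closedBall x0 ρ) ≤ ENNReal.ofReal ((Mb + 1) * ((2 * N + 1) ^ n * (l ^ d * K0 n d) +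
      C0 n d * (ff n d E x0 (ρ + l) - ff n d E x0 ρ)) + eb) := by
    refine h.trans ?_
    have hNr0 : (0:ℝ) ≤ 2 * N + 1 := by positivity
    generalize (2 * (N:ℝ) + 1) = Nr at hNr0 ⊢
    generalize ff n d E x0 (ρ + l) - ff n d E x0 ρ = Df at hnn ⊢
    rw [ENNReal.ofReal_add (by positivity) heb0, ENNReal.ofReal_mul (by positivity),
      ENNReal.ofReal_add hMb0 (by norm_num), ENNReal.ofReal_one,
      ENNReal.ofReal_add (by positivity) (by positivity), ENNReal.ofReal_mul (by positivity),
      ENNReal.ofReal_mul (by positivity), ENNReal.ofReal_mul (by positivity),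
      ENNReal.ofReal_pow (by positivity), ENNReal.ofReal_pow (by positivity)]
    gcongr
  exact ENNReal.toReal_le_of_le_ofReal (by positivity) h'

lemma iter {n d : ℕ} (hd : 1 ≤ d) (hdn : d < n) (U : Set (Euc n)) (M ε : ℝ → ℝ)
    (hM : MonotoneOn M (Ici 0)) (hε : MonotoneOn ε (Ici 0)) (E : Set (Euc n))
    (hE : MemQM n d U (fun r => ENNReal.ofReal (M r)) (fun r => ENNReal.ofReal (ε r)) E)
    (x0 : Euc n) {r : ℝ} (hr : 0 < r) (hU : closedBall x0 (2 * r) ⊆ U)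
    (J : ℕ) (hJ : n + 1 ≤ J)
    (Mb eb : ℝ) (hMb : M (6 * r) ≤ Mb) (hMb0 : 0 ≤ Mb) (heb : ε (6 * r) ≤ eb) (heb0 : 0 ≤ eb) :
    ff n d E x0 r ≤ Real.exp (-(J / (1 + (Mb + 1) * C0 n d))) * ff n d E x0 (2 * r) +
      J * ((Mb + 1) * ((2 * J + 3) ^ n * (r ^ d * K0 n d)) + eb) := by
  have k1 := K0_nonneg n d
  have k2 := C0_nonneg n d
  have hJ0 : (0:ℝ) < J := by
    have : 0 < J := by omega
    exact_mod_cast this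
  have hJ1 : (n:ℝ) + 1 ≤ J := by exact_mod_cast hJ
  have hJone : (1:ℝ) ≤ J := by linarith [(Nat.cast_nonneg n : (0:ℝ) ≤ n)]
  set l := r / J with hl
  have hl0 : 0 < l := by positivity
  have hJl : J * l = r := by rw [hl]; field_simp
  have hlr : l ≤ r := div_le_self hr.le hJone
  set Lc := (Mb + 1) * C0 n d with hLc
  have hLc0 : 0 ≤ Lc := by positivity
  set S := (Mb + 1) * ((2 * J + 3) ^ n * (r ^ d * K0 n d)) + eb with hS
  have hS0 : 0 ≤ S := by positivity
  set θ := Lc / (1 + Lc) with hθ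
  have hθ0 : 0 ≤ θ := by positivity
  have hθ1 : θ ≤ 1 := by rw [hθ, div_le_one (by positivity)]; linarith
  have one : ∀ i : ℕ, i < J → ff n d E x0 (r + i * l) ≤
      θ * ff n d E x0 (r + (i + 1 : ℕ) * l) + S := by
    intro i hi
    have hi1 : (i:ℝ) + 1 ≤ J := by exact_mod_cast hi
    have hil : (i + 1) * l ≤ r := by rw [← hJl]; gcongr
    have h := core_real hd hdn U M ε hM hε E hE x0 (l := l) (ρ := r + i * l) hl0 (by positivity)
      ((closedBall_subset_closedBall (by linarith)).trans hU) (J + 1)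
      (by
        have : (r + i * l) / l = J + i := by rw [← hJl]; field_simp
        rw [this]; push_cast; linarith) (6 * r)
      (by
        have : (n + 1) * l ≤ r := by rw [← hJl]; gcongr
        linarith) Mb eb hMb hMb0 heb heb0
    have e : r + i * l + l = r + (i + 1 : ℕ) * l := by push_cast; ring
    rw [e] at h
    set u := ff n d E x0 (r + i * l)
    set v := ff n d E x0 (r + (i + 1 : ℕ) * l)
    have hld : l ^ d ≤ r ^ d := by gcongr
    have h2 : (Mb + 1) * ((2 * (J + 1 : ℕ) + 1) ^ n * (l ^ d * K0 n d)) + eb ≤ S := by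
      rw [hS]
      have : (2 * ((J + 1 : ℕ) : ℝ) + 1) = 2 * J + 3 := by push_cast; ring
      rw [this]
      gcongr
    have h3 : u * (1 + Lc) ≤ Lc * v + S := by
      rw [hLc] at *
      nlinarith
    have h4 : u ≤ (Lc * v + S) / (1 + Lc) := by rwa [le_div_iff₀ (by positivity)]
    refine h4.trans ?_
    rw [add_div, hθ]
    have h5 : S / (1 + Lc) ≤ S := div_le_self hS0 (by linarith)
    have h6 : Lc * v / (1 + Lc) = Lc / (1 + Lc) * v := by ring
    linarith
  have many : ∀ i : ℕ, i ≤ J → ff n d E x0 r ≤ θ ^ i * ff n d E x0 (r + i * l) + i * S := by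
    intro i
    induction i with
    | zero => intro _; simp
    | succ i ih =>
      intro hi
      have h1 := ih (by omega)
      have h2 := one i (by omega)
      have hp : 0 ≤ θ ^ i := by positivity
      have hp1 : θ ^ i ≤ 1 := pow_le_one₀ hθ0 hθ1
      calc _ ≤ θ ^ i * (θ * ff n d E x0 (r + (i + 1 : ℕ) * l) + S) + i * S := by
            refine h1.trans ?_; gcongr
        _ = θ ^ (i+1) * ff n d E x0 (r + (i + 1 : ℕ) * l) + θ ^ i * S + i * S := by ring
        _ ≤ θ ^ (i+1) * ff n d E x0 (r + (i + 1 : ℕ) * l) + 1 * S + i * S := by gcongr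
        _ = _ := by push_cast; ring
  have h := many J le_rfl
  rw [hJl, ← two_mul] at h
  refine h.trans ?_
  have hexp : θ ^ J ≤ Real.exp (-(J / (1 + Lc))) := by
    have : θ ≤ Real.exp (-(1 / (1 + Lc))) := by
      refine le_trans (le_of_eq ?_) (Real.add_one_le_exp _)
      rw [hθ]; field_simp; ring
    calc θ ^ J ≤ Real.exp (-(1 / (1 + Lc))) ^ J := by gcongr
      _ = _ := by rw [← Real.exp_nat_mul]; congr 1; ring
  have : 0 ≤ ff n d E x0 (2 * r) := ENNReal.toReal_nonneg
  gcongr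

/-! ### passing to the limit -/

/-- test function -/
def gt (n : ℕ) (x0 : Euc n) (r : ℝ) (y : Euc n) : ℝ := max 0 (min 1 (2 - dist y x0 / r))

lemma gt_cont (n : ℕ) (x0 : Euc n) (r : ℝ) : Continuous (gt n x0 r) := by
  unfold gt; fun_prop

lemma gt_nonneg (n : ℕ) (x0 : Euc n) (r : ℝ) (y : Euc n) : 0 ≤ gt n x0 r y := le_max_left _ _

lemma gt_le_one (n : ℕ) (x0 : Euc n) (r : ℝ) (y : Euc n) : gt n x0 r y ≤ 1 :=
  max_le zero_le_one (min_le_left _ _)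

lemma gt_eq_one {n : ℕ} {x0 : Euc n} {r : ℝ} (hr : 0 < r) {y : Euc n} (h : y ∈ closedBall x0 r) :
    gt n x0 r y = 1 := by
  have : dist y x0 / r ≤ 1 := by rw [div_le_one hr]; exact h
  unfold gt
  rw [min_eq_left (by linarith), max_eq_right zero_le_one]

lemma gt_eq_zero {n : ℕ} {x0 : Euc n} {r : ℝ} (hr : 0 < r) {y : Euc n}
    (h : y ∉ closedBall x0 (2 * r)) : gt n x0 r y = 0 := by
  rw [mem_closedBall, not_le] at h
  have : 2 ≤ dist y x0 / r := by rw [le_div_iff₀ hr]; exact h.le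
  unfold gt
  exact max_eq_left ((min_le_right _ _).trans (by linarith))

lemma gt_supp {n : ℕ} {x0 : Euc n} {r : ℝ} (hr : 0 < r) : HasCompactSupport (gt n x0 r) :=
  HasCompactSupport.intro (isCompact_closedBall x0 (2 * r)) fun _ h => gt_eq_zero hr h

lemma gt_low {n : ℕ} {x0 : Euc n} {r : ℝ} (hr : 0 < r) (ν : Measure (Euc n))
    [IsLocallyFiniteMeasure ν] : (ν (closedBall x0 r)).toReal ≤ ∫ y, gt n x0 r y ∂ν := by
  have h1 : ∫ y, (closedBall x0 r).indicator (fun _ => (1:ℝ)) y ∂ν =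
      (ν (closedBall x0 r)).toReal := by
    rw [integral_indicator measurableSet_closedBall]; simp [Measure.real]
  rw [← h1]
  apply integral_mono
  · rw [integrable_indicator_iff measurableSet_closedBall]
    exact integrableOn_const ((isCompact_closedBall x0 r).measure_lt_top).ne
  · exact (gt_cont n x0 r).integrable_of_hasCompactSupport (gt_supp hr)
  · intro y
    by_cases h : y ∈ closedBall x0 r
    · simp only [indicator_of_mem h, gt_eq_one hr h]; exact le_rfl
    · simp only [indicator_of_notMem h]; exact gt_nonneg _ _ _ _

lemma gt_high {n : ℕ} {x0 : Euc n} {r : ℝ} (hr : 0 < r) (ν : Measure (Euc n))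
    [IsLocallyFiniteMeasure ν] : ∫ y, gt n x0 r y ∂ν ≤ (ν (closedBall x0 (2 * r))).toReal := by
  have h1 : ∫ y, (closedBall x0 (2 * r)).indicator (fun _ => (1:ℝ)) y ∂ν =
      (ν (closedBall x0 (2 * r))).toReal := by
    rw [integral_indicator measurableSet_closedBall]; simp [Measure.real]
  rw [← h1]
  apply integral_mono
  · exact (gt_cont n x0 r).integrable_of_hasCompactSupport (gt_supp hr)
  · rw [integrable_indicator_iff measurableSet_closedBall]
    exact integrableOn_const ((isCompact_closedBall x0 (2 * r)).measure_lt_top).ne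
  · intro y
    by_cases h : y ∈ closedBall x0 (2 * r)
    · simp only [indicator_of_mem h]; exact gt_le_one _ _ _ _
    · simp only [indicator_of_notMem h, gt_eq_zero hr h]; exact le_rfl

lemma limit_ineq {n d : ℕ} (hd : 1 ≤ d) (hdn : d < n) (U : Set (Euc n)) (Ms εs : ℕ → ℝ → ℝ)
    (hM : ∀ k, MonotoneOn (Ms k) (Ici 0)) (hε : ∀ k, MonotoneOn (εs k) (Ici 0))
    (Es : ℕ → Set (Euc n))
    (hE : ∀ k, MemQM n d U (fun r => ENNReal.ofReal (Ms k r))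
      (fun r => ENNReal.ofReal (εs k r)) (Es k))
    (μ : Measure (Euc n)) [IsLocallyFiniteMeasure μ]
    (hw : WeakConv n (fun k => (μH[(d : ℝ)] : Measure (Euc n)).restrict (Es k ∩ U)) μ)
    (x0 : Euc n) {r : ℝ} (hr : 0 < r) (hU : closedBall x0 (8 * r) ⊆ U)
    (J : ℕ) (hJ : n + 1 ≤ J) (Mb eb : ℝ) (hMb0 : 0 ≤ Mb) (heb0 : 0 ≤ eb)
    (hMb : ∀ᶠ k in atTop, Ms k (12 * r) ≤ Mb) (heb : ∀ᶠ k in atTop, εs k (12 * r) ≤ eb) :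
    (μ (closedBall x0 r)).toReal ≤ Real.exp (-(J / (1 + (Mb + 1) * C0 n d))) *
      (μ (closedBall x0 (8 * r))).toReal +
      J * ((Mb + 1) * ((2 * J + 3) ^ n * ((2 * r) ^ d * K0 n d)) + eb) := by
  set q := Real.exp (-(J / (1 + (Mb + 1) * C0 n d))) with hq
  set S := J * ((Mb + 1) * ((2 * J + 3) ^ n * ((2 * r) ^ d * K0 n d)) + eb) with hS
  have hq0 : 0 ≤ q := (Real.exp_pos _).le
  have t1 := hw (gt n x0 r) (gt_cont n x0 r) (gt_supp hr)
  have hr4 : 0 < 4 * r := by linarith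
  have t2 := hw (gt n x0 (4 * r)) (gt_cont n x0 _) (gt_supp hr4)
  have hfin : ∀ k, IsLocallyFiniteMeasure ((μH[(d : ℝ)] : Measure (Euc n)).restrict (Es k ∩ U)) := by
    intro k
    have := (hE k).1
    have hle : (μH[(d : ℝ)] : Measure (Euc n)).restrict (Es k ∩ U) ≤
        (μH[(d : ℝ)] : Measure (Euc n)).restrict (Es k) :=
      Measure.restrict_mono inter_subset_left le_rfl
    exact Measure.isLocallyFiniteMeasure_of_le hle
  have hmass : ∀ k t, closedBall x0 t ⊆ U →
      (((μH[(d : ℝ)] : Measure (Euc n)).restrict (Es k ∩ U)) (closedBall x0 t)).toReal =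
        ff n d (Es k) x0 t := by
    intro k t ht
    rw [Measure.restrict_apply measurableSet_closedBall]
    unfold ff
    congr 2
    ext y
    constructor
    · rintro ⟨a, b, c⟩; exact ⟨b, a⟩
    · rintro ⟨a, b⟩; exact ⟨b, a, ht b⟩
  have key : ∀ᶠ k in atTop,
      ∫ y, gt n x0 r y ∂((μH[(d : ℝ)] : Measure (Euc n)).restrict (Es k ∩ U)) ≤
      q * ∫ y, gt n x0 (4 * r) y ∂((μH[(d : ℝ)] : Measure (Euc n)).restrict (Es k ∩ U)) + S := by
    filter_upwards [hMb, heb] with k h1 h2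
    have := hfin k
    have e6 : 6 * (2 * r) = 12 * r := by ring
    have e4 : 2 * (2 * r) = 4 * r := by ring
    have hU4 : closedBall x0 (4 * r) ⊆ U :=
      (closedBall_subset_closedBall (by linarith)).trans hU
    have hU2 : closedBall x0 (2 * r) ⊆ U :=
      (closedBall_subset_closedBall (by linarith)).trans hU
    have hi := iter hd hdn U (Ms k) (εs k) (hM k) (hε k) (Es k) (hE k) x0 (r := 2 * r)
      (by linarith) (by rwa [e4]) J hJ Mb eb (by rwa [e6]) hMb0 (by rwa [e6]) heb0
    rw [e4] at hi
    have g1 := gt_high (x0 := x0) hr ((μH[(d : ℝ)] : Measure (Euc n)).restrict (Es k ∩ U))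
    have g2 := gt_low (x0 := x0) hr4 ((μH[(d : ℝ)] : Measure (Euc n)).restrict (Es k ∩ U))
    rw [hmass k _ hU2] at g1
    rw [hmass k _ hU4] at g2
    refine g1.trans (hi.trans ?_)
    gcongr
  have t3 := (t2.const_mul q).add_const S
  have h := le_of_tendsto_of_tendsto t1 t3 key
  have g1 := gt_low (x0 := x0) hr μ
  have g2 := gt_high (x0 := x0) hr4 μ
  rw [show 2 * (4 * r) = 8 * r by ring] at g2
  refine g1.trans (h.trans ?_)
  gcongr

/-! ### growth -/

lemma growth (F : ℝ → ℝ) (hF0 : ∀ r, 0 ≤ F r) (hFm : Monotone F) (d : ℕ) {r1 q G : ℝ}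
    (hr1 : 0 < r1) (hG : 0 ≤ G) (hq0 : 0 ≤ q) (hq : q * 8 ^ d ≤ 1 / 2)
    (h : ∀ r, 0 < r → 8 * r ≤ r1 → F r ≤ q * F (8 * r) + G * r ^ d) :
    ∃ r2, 0 < r2 ∧ ∀ r, 0 < r → r < r2 → F r ≤ (1 + 2 * G) * r ^ d := by
  set B := F r1 * 8 ^ d / r1 ^ d with hB
  have hB0 : 0 ≤ B := by have := hF0 r1; positivity
  have ind : ∀ j : ℕ, ∀ r, r1 * (1/8) ^ (j+1) ≤ r → r ≤ r1 * (1/8) ^ j →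
      F r ≤ ((1/2) ^ j * B + 2 * G) * r ^ d := by
    intro j
    induction j with
    | zero =>
      intro r ha hb
      simp only [pow_zero, mul_one, zero_add, pow_one, one_mul] at *
      have hr : 0 < r := by linarith
      have h1 : F r ≤ F r1 := hFm hb
      have h2 : F r1 ≤ B * r ^ d := by
        have h3 : r1 ^ d ≤ (8 * r) ^ d := by
          have : r1 ≤ 8 * r := by linarith
          gcongr
        rw [hB, div_mul_eq_mul_div, le_div_iff₀ (by positivity)]
        rw [mul_pow] at h3
        have := mul_le_mul_of_nonneg_left h3 (hF0 r1)
        linarith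
      have h3 : 0 ≤ G * r ^ d := by positivity
      nlinarith
    | succ j ih =>
      intro r ha hb
      have hr : 0 < r := lt_of_lt_of_le (by positivity) ha
      have h8 : r1 * (1/8) ^ (j+1) ≤ 8 * r := by
        rw [pow_succ _ (j+1)] at ha; linarith
      have h8' : 8 * r ≤ r1 * (1/8) ^ j := by
        rw [pow_succ] at hb; linarith
      have hle : r1 * (1/8:ℝ) ^ j ≤ r1 := by
        have : (1/8:ℝ)^j ≤ 1 := pow_le_one₀ (by norm_num) (by norm_num)
        nlinarith
      have h1 := h r hr (h8'.trans hle)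
      have h2 := ih (8 * r) h8 h8'
      have h3 : q * F (8 * r) ≤ q * (((1/2) ^ j * B + 2 * G) * (8 * r) ^ d) := by gcongr
      have h4 : q * (((1/2) ^ j * B + 2 * G) * (8 * r) ^ d) =
          (q * 8 ^ d) * (((1/2) ^ j * B + 2 * G) * r ^ d) := by rw [mul_pow]; ring
      have h5 : (q * 8 ^ d) * (((1/2) ^ j * B + 2 * G) * r ^ d) ≤
          (1 / 2) * (((1/2) ^ j * B + 2 * G) * r ^ d) := by gcongr
      calc F r ≤ (1 / 2) * (((1/2) ^ j * B + 2 * G) * r ^ d) + G * r ^ d := by linarith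
        _ = _ := by rw [pow_succ]; ring
  obtain ⟨j0, hj0⟩ : ∃ j0 : ℕ, (1/2:ℝ) ^ j0 * B ≤ 1 := by
    obtain ⟨j0, hj⟩ := exists_pow_lt_of_lt_one (show (0:ℝ) < 1 / (B + 1) by positivity)
      (show (1/2:ℝ) < 1 by norm_num)
    refine ⟨j0, ?_⟩
    rw [lt_div_iff₀ (by positivity)] at hj
    have : 0 ≤ (1/2:ℝ) ^ j0 := by positivity
    linarith
  refine ⟨r1 * (1/8) ^ j0, by positivity, fun r hr hlt => ?_⟩
  have hr1r : r < r1 := by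
    refine hlt.trans_le ?_
    have : (1/8:ℝ)^j0 ≤ 1 := pow_le_one₀ (by norm_num) (by norm_num)
    nlinarith
  obtain ⟨j, hj1, hj2⟩ := exists_nat_pow_near_of_lt_one (x := r / r1) (y := 1 / 8)
    (by positivity) (by rw [div_le_one hr1]; exact hr1r.le) (by norm_num) (by norm_num)
  rw [lt_div_iff₀ hr1] at hj1
  rw [div_le_iff₀ hr1] at hj2
  have hk := ind j r (by linarith) (by linarith)
  have hjj : j0 ≤ j := by
    by_contra hc
    push Not at hc
    have : (1/8:ℝ) ^ j0 ≤ (1/8) ^ (j+1) :=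
      pow_le_pow_of_le_one (by norm_num) (by norm_num) hc
    nlinarith
  have h6 : (1/2:ℝ) ^ j * B ≤ 1 := by
    refine le_trans ?_ hj0
    have : (1/2:ℝ) ^ j ≤ (1/2) ^ j0 := pow_le_pow_of_le_one (by norm_num) (by norm_num) hjj
    gcongr
  refine hk.trans ?_
  gcongr

/-! ### constants -/

/-- bound for the number of layers -/
def aa (n d : ℕ) : ℝ := (3 * d + 1) * (1 + 3 * C0 n d) + n + 2

/-- bound for the source constant -/
def QQ (n d : ℕ) : ℝ := aa n d * (3 * ((2 * aa n d + 3) ^ n * (2 ^ d * K0 n d)) + 2 * 12 ^ d)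

/-- the constant in the exponent -/
def c00 (n d : ℕ) : ℝ := 1 + 2 * QQ n d + (n + 2)

/-- number of layers -/
def JJ (n d : ℕ) (m : ℝ) : ℕ := ⌈(3 * d + 1) * (1 + (2 * m + 1) * C0 n d)⌉₊ + n + 1

/-- source constant -/
def Gc (n d : ℕ) (m e : ℝ) : ℝ :=
  JJ n d m * ((2 * m + 1) * ((2 * JJ n d m + 3) ^ n * (2 ^ d * K0 n d)) + (e + 2) * 12 ^ d)

lemma aa_pos (n d : ℕ) : 0 < aa n d := by
  have := C0_nonneg n d
  unfold aa; positivity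

lemma QQ_nonneg (n d : ℕ) : 0 ≤ QQ n d := by
  have := aa_pos n d
  have := K0_nonneg n d
  unfold QQ; positivity

lemma JJ_le (n d : ℕ) {m : ℝ} (hm : 1 ≤ m) : (JJ n d m : ℝ) ≤ aa n d * m := by
  have hC := C0_nonneg n d
  have h1 := Nat.ceil_lt_add_one (a := (3 * d + 1) * (1 + (2 * m + 1) * C0 n d)) (by positivity)
  have h2 : (3 * d + 1) * (1 + (2 * m + 1) * C0 n d) ≤ (3 * d + 1) * (1 + 3 * C0 n d) * m := by
    rw [mul_assoc]
    gcongr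
    nlinarith
  unfold JJ aa
  push_cast
  have hn : (0:ℝ) ≤ n := Nat.cast_nonneg n
  nlinarith

lemma JJ_exp (n d : ℕ) {m : ℝ} (hm : 1 ≤ m) :
    Real.exp (-(JJ n d m / (1 + (2 * m + 1) * C0 n d))) * 8 ^ d ≤ 1 / 2 := by
  have hC := C0_nonneg n d
  have h1 := Nat.le_ceil ((3 * d + 1) * (1 + (2 * m + 1) * C0 n d))
  have hp : 0 < 1 + (2 * m + 1) * C0 n d := by positivity
  have h2 : (3 * d + 1 : ℝ) ≤ JJ n d m / (1 + (2 * m + 1) * C0 n d) := by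
    rw [le_div_iff₀ hp]
    unfold JJ
    push_cast
    have hn : (0:ℝ) ≤ n := Nat.cast_nonneg n
    linarith
  have h3 : Real.exp (-(JJ n d m / (1 + (2 * m + 1) * C0 n d))) ≤ Real.exp (-1) ^ (3 * d + 1) := by
    rw [← Real.exp_nat_mul]
    apply Real.exp_le_exp.2
    push_cast
    linarith
  have h4 : Real.exp (-1) ≤ 1 / 2 := by
    rw [Real.exp_neg, one_div]
    have := Real.add_one_le_exp (1:ℝ)
    gcongr
    linarith
  have h5 : Real.exp (-1) ^ (3 * d + 1) ≤ (1 / 2) ^ (3 * d + 1) := by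
    have := (Real.exp_pos (-1)).le
    gcongr
  calc _ ≤ (1 / 2 : ℝ) ^ (3 * d + 1) * 8 ^ d := by gcongr; exact h3.trans h5
    _ = 1 / 2 := by
      rw [pow_succ, pow_mul, mul_right_comm, ← mul_pow]; norm_num

lemma Gc_le (n d : ℕ) {m e : ℝ} (hm : 1 ≤ m) (he : 0 ≤ e) :
    Gc n d m e ≤ QQ n d * m ^ (n + 2) * (1 + e) := by
  have ha := aa_pos n d
  have hK := K0_nonneg n d
  have hJ := JJ_le n d hm
  have h1 : (2 * JJ n d m + 3 : ℝ) ≤ (2 * aa n d + 3) * m := by nlinarith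
  have h2 : (2 * JJ n d m + 3 : ℝ) ^ n ≤ (2 * aa n d + 3) ^ n * m ^ n := by
    rw [← mul_pow]; gcongr
  have hmn : 1 ≤ m ^ (n + 1) := one_le_pow₀ hm
  unfold Gc QQ
  set P := (2 * aa n d + 3) ^ n * (2 ^ d * K0 n d) with hP
  have hP0 : 0 ≤ P := by positivity
  calc _ ≤ (aa n d * m) * ((3 * m) * (((2 * aa n d + 3) ^ n * m ^ n) * (2 ^ d * K0 n d)) +
        (2 * (1 + e)) * 12 ^ d) := by
        gcongr
        · linarith
        · linarith
    _ = (aa n d * m) * (3 * P * m ^ (n+1) * 1 + 2 * 12 ^ d * (1 + e) * 1) := by rw [hP]; ring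
    _ ≤ (aa n d * m) * (3 * P * m ^ (n+1) * (1 + e) + 2 * 12 ^ d * (1 + e) * m ^ (n+1)) := by
        gcongr
        linarith
    _ = _ := by ring

lemma final_arith {n d : ℕ} (hd : 1 ≤ d) (hdn : d < n) {m e : ℝ} (hm : 1 ≤ m) (he : 0 ≤ e) :
    1 + 2 * Gc n d m e ≤ (2 * m + 2 ^ d * e) *
      Real.exp (4 * d * ((n : ℝ) - d) ^ 2 * (c00 n d) ^ 2 * m ^ 2) := by
  have hQ := QQ_nonneg n d
  have hG := Gc_le n d hm he
  have hmn : 1 ≤ m ^ (n + 2) := one_le_pow₀ hm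
  have h1 : 1 + 2 * Gc n d m e ≤ ((1 + 2 * QQ n d) * m ^ (n + 2)) * (1 + e) := by
    have : 1 ≤ m ^ (n+2) * (1 + e) := by nlinarith
    nlinarith
  have hd2 : (2:ℝ) ≤ 2 ^ d := by
    calc (2:ℝ) = 2 ^ 1 := by norm_num
      _ ≤ 2 ^ d := pow_le_pow_right₀ (by norm_num) hd
  have h2 : 1 + e ≤ 2 * m + 2 ^ d * e := by nlinarith
  have hc1 : 1 ≤ c00 n d := by
    unfold c00
    have hn : (0:ℝ) ≤ n := Nat.cast_nonneg n
    linarith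
  have hdr : (1:ℝ) ≤ d := by exact_mod_cast hd
  have hnd : (1:ℝ) ≤ (n:ℝ) - d := by
    have : (d:ℝ) + 1 ≤ n := by exact_mod_cast hdn
    linarith
  have h3 : (1 + 2 * QQ n d) * m ^ (n + 2) ≤
      Real.exp (4 * d * ((n : ℝ) - d) ^ 2 * (c00 n d) ^ 2 * m ^ 2) := by
    have a1 : 1 + 2 * QQ n d ≤ Real.exp (1 + 2 * QQ n d) := by
      have := Real.add_one_le_exp (1 + 2 * QQ n d); linarith
    have a2 : m ^ (n+2) ≤ Real.exp ((n + 2 : ℕ) * m) := by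
      rw [Real.exp_nat_mul]
      have := Real.add_one_le_exp m
      have h0 : m ≤ Real.exp m := by linarith
      gcongr
    have a3 : (1 + 2 * QQ n d) + (n + 2 : ℕ) * m ≤
        4 * d * ((n : ℝ) - d) ^ 2 * (c00 n d) ^ 2 * m ^ 2 := by
      have b1 : (1 + 2 * QQ n d) + (n + 2 : ℕ) * m ≤ c00 n d * m := by
        unfold c00; push_cast; nlinarith
      have b2 : c00 n d * m ≤ (c00 n d) ^ 2 * m ^ 2 := by
        have : 1 ≤ c00 n d * m := by nlinarith
        nlinarith
      have b3 : (1:ℝ) ≤ 4 * d * ((n : ℝ) - d) ^ 2 := by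
        have : 1 ≤ ((n : ℝ) - d) ^ 2 := one_le_pow₀ hnd
        nlinarith
      have b4 : 0 ≤ (c00 n d) ^ 2 * m ^ 2 := by positivity
      nlinarith
    calc _ ≤ Real.exp (1 + 2 * QQ n d) * Real.exp ((n + 2 : ℕ) * m) := by gcongr
      _ = Real.exp ((1 + 2 * QQ n d) + (n + 2 : ℕ) * m) := (Real.exp_add _ _).symm
      _ ≤ _ := Real.exp_le_exp.2 a3
  calc _ ≤ _ := h1
    _ ≤ Real.exp (4 * d * ((n : ℝ) - d) ^ 2 * (c00 n d) ^ 2 * m ^ 2) * (2 * m + 2 ^ d * e) := by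
      gcongr
    _ = _ := mul_comm _ _

/-! ### conclusion -/

lemma ωb_ne_zero (d : ℕ) : ωb d ≠ 0 := by
  unfold ωb
  exact (measure_ball_pos _ _ one_pos).ne'

lemma ωb_ne_top (d : ℕ) : ωb d ≠ ⊤ := by
  unfold ωb
  exact measure_ball_lt_top.ne

lemma main_growth {n d : ℕ} (hd : 1 ≤ d) (hdn : d < n) (U : Set (Euc n)) (hUo : IsOpen U)
    (Ms εs : ℕ → ℝ → ℝ)
    (hM : ∀ k, MonotoneOn (Ms k) (Ici 0)) (hε : ∀ k, MonotoneOn (εs k) (Ici 0))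
    (Es : ℕ → Set (Euc n))
    (hE : ∀ k, MemQM n d U (fun r => ENNReal.ofReal (Ms k r))
      (fun r => ENNReal.ofReal (εs k r)) (Es k))
    (μ : Measure (Euc n)) [IsLocallyFiniteMeasure μ]
    (hw : WeakConv n (fun k => (μH[(d : ℝ)] : Measure (Euc n)).restrict (Es k ∩ U)) μ)
    (x0 : Euc n) (hx : x0 ∈ U) {m e : ℝ} (hm : 1 ≤ m) (he : 0 ≤ e)
    (hm' : rightLim0 (limsupFn Ms) = ENNReal.ofReal m)
    (he' : Filter.limsup (fun r : ℝ => limsupFn εs r / ENNReal.ofReal (r ^ d))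
        (𝓝[>] (0 : ℝ)) = ENNReal.ofReal e) :
    ∃ r2, 0 < r2 ∧ ∀ r, 0 < r → r < r2 →
      (μ (closedBall x0 r)).toReal ≤ (1 + 2 * Gc n d m e) * r ^ d := by
  -- radius for M
  obtain ⟨r0, hr0, hMr0⟩ : ∃ r0 : ℝ, 0 < r0 ∧ ∀ᶠ k in atTop, Ms k r0 ≤ 2 * m := by
    have h1 : rightLim0 (limsupFn Ms) < ENNReal.ofReal (m + 1) := by
      rw [hm']; exact (ENNReal.ofReal_lt_ofReal_iff (by linarith)).2 (by linarith)
    unfold rightLim0 at h1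
    simp only [iInf_lt_iff] at h1
    obtain ⟨r0, hr0, h2⟩ := h1
    refine ⟨r0, hr0, ?_⟩
    unfold limsupFn at h2
    filter_upwards [eventually_lt_of_limsup_lt h2] with k hk
    have := (ENNReal.ofReal_lt_ofReal_iff (by linarith)).1 hk
    linarith
  obtain ⟨s0, hs0, hεs⟩ : ∃ s0 : ℝ, 0 < s0 ∧ ∀ r, 0 < r → r < s0 →
      ∀ᶠ k in atTop, εs k r ≤ (e + 2) * r ^ d := by
    have h1 : Filter.limsup (fun r : ℝ => limsupFn εs r / ENNReal.ofReal (r ^ d))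
        (𝓝[>] (0 : ℝ)) < ENNReal.ofReal (e + 2) := by
      rw [he']; exact (ENNReal.ofReal_lt_ofReal_iff (by linarith)).2 (by linarith)
    have h2 := eventually_lt_of_limsup_lt h1
    rw [eventually_nhdsWithin_iff, Metric.eventually_nhds_iff] at h2
    obtain ⟨s0, hs0, h3⟩ := h2
    refine ⟨s0, hs0, fun r hr hrs => ?_⟩
    have h4 := h3 (y := r) (by rw [Real.dist_eq, sub_zero, abs_of_pos hr]; exact hrs) hr
    have hrd : 0 < r ^ d := by positivity
    rw [ENNReal.div_lt_iff (Or.inl (by simpa using hrd)) (Or.inl ENNReal.ofReal_ne_top),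
      ← ENNReal.ofReal_mul (by linarith)] at h4
    unfold limsupFn at h4
    filter_upwards [eventually_lt_of_limsup_lt h4] with k hk
    exact ((ENNReal.ofReal_lt_ofReal_iff (by positivity)).1 hk).le
  obtain ⟨t0, ht0, hball⟩ := Metric.isOpen_iff.1 hUo x0 hx
  have hC := C0_nonneg n d
  have hK := K0_nonneg n d
  have hG0 : 0 ≤ Gc n d m e := by unfold Gc; positivity
  have hr1 : 0 < min (r0 / 2) (min (s0 / 2) (t0 / 2)) := by positivity
  refine growth (fun r => (μ (closedBall x0 r)).toReal) (fun r => ENNReal.toReal_nonneg) ?_ d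
    hr1 hG0 (Real.exp_pos _).le (JJ_exp n d hm) ?_
  · intro a b hab
    exact ENNReal.toReal_mono ((isCompact_closedBall x0 b).measure_lt_top).ne
      (measure_mono (closedBall_subset_closedBall hab))
  · intro r hr h8
    have e1 : 8 * r ≤ r0 / 2 := h8.trans (min_le_left _ _)
    have e2 : 8 * r ≤ s0 / 2 := h8.trans ((min_le_right _ _).trans (min_le_left _ _))
    have e3 : 8 * r ≤ t0 / 2 := h8.trans ((min_le_right _ _).trans (min_le_right _ _))
    have h := limit_ineq hd hdn U Ms εs hM hε Es hE μ hw x0 hr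
      ((closedBall_subset_ball (by linarith)).trans hball) (JJ n d m)
      (by unfold JJ; omega) (2 * m) ((e + 2) * (12 * r) ^ d) (by linarith) (by positivity)
      (by
        filter_upwards [hMr0] with k hk
        refine le_trans (hM k ?_ ?_ ?_) hk
        · exact mem_Ici.2 (by linarith)
        · exact mem_Ici.2 hr0.le
        · linarith)
      (hεs (12 * r) (by linarith) (by linarith))
    refine h.trans (le_of_eq ?_)
    unfold Gc
    rw [mul_pow, mul_pow]
    ring

end UDB

/-- uniform upper density bound for the limit measure, Lemma 3.5.
There exist `c0 = c0(n,d) ≥ 1` and `c1 = c1(n,d) > 0` such that, with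
`ε_0 = limsup_{r→0+} r^{-d} ε(r) < ∞`, for every `x ∈ U ∩ spt μ`,
`Θ^{*d}(μ,x) ≤ (2 c1 M(0+) ω_d⁻¹ + 2^d ω_d⁻¹ ε_0) · exp(4 d (n−d)² c0² M(0+)²)`. -/
theorem upper_density_bound
    (n d : ℕ) (hd : 1 ≤ d) (hdn : d < n) :
    ∃ c0 c1 : ℝ, 1 ≤ c0 ∧ 0 < c1 ∧
      ∀ (U : Set (Euc n)), IsOpen U → U.Nonempty →
      ∀ (Ms εs : ℕ → ℝ → ℝ),
      (∀ k, MonotoneOn (Ms k) (Ici (0 : ℝ))) →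
      (∀ k, ∀ r, 0 ≤ r → 1 ≤ Ms k r) →
      (∀ k, MonotoneOn (εs k) (Ici (0 : ℝ))) →
      (∀ k, ∀ r, 0 ≤ r → 0 ≤ εs k r) →
      ∀ (Es : ℕ → Set (Euc n)),
      (∀ k, MemQM n d U (fun r => ENNReal.ofReal (Ms k r))
        (fun r => ENNReal.ofReal (εs k r)) (Es k)) →
      ∀ μ : Measure (Euc n), IsLocallyFiniteMeasure μ →
      WeakConv n (fun k => (μH[(d : ℝ)] : Measure (Euc n)).restrict (Es k ∩ U)) μ →
      ∀ ε0 : ℝ≥0∞,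
      ε0 = Filter.limsup (fun r : ℝ => limsupFn εs r / ENNReal.ofReal (r ^ d))
        (𝓝[>] (0 : ℝ)) →
      ε0 < ⊤ →
      ∀ x ∈ U ∩ msupport n μ,
        upperDensity n d μ x ≤
          (2 * ENNReal.ofReal c1 * rightLim0 (limsupFn Ms) * (ωb d)⁻¹ +
              2 ^ d * (ωb d)⁻¹ * ε0) *
            ENNReal.ofReal (Real.exp (4 * d * ((n : ℝ) - d) ^ 2 * c0 ^ 2 *
              (rightLim0 (limsupFn Ms)).toReal ^ 2)) := by
  refine ⟨UDB.c00 n d, 1, ?_, one_pos, ?_⟩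
  · have := UDB.QQ_nonneg n d
    unfold UDB.c00
    have hn : (0:ℝ) ≤ n := Nat.cast_nonneg n
    linarith
  intro U hUo _ Ms εs hM hM1 hε _ Es hE μ hμ hw ε0 hε0 hετ x hx
  have hω0 := UDB.ωb_ne_zero d
  have hωt := UDB.ωb_ne_top d
  have hωi : (ωb d)⁻¹ ≠ 0 := ENNReal.inv_ne_zero.2 hωt
  by_cases htop : rightLim0 (limsupFn Ms) = ⊤
  · rw [htop]
    have : (2 * ENNReal.ofReal 1 * ⊤ * (ωb d)⁻¹ + 2 ^ d * (ωb d)⁻¹ * ε0) = ⊤ := by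
      rw [ENNReal.mul_top (by simp), ENNReal.top_mul hωi, top_add]
    rw [this, ENNReal.top_mul]
    · exact le_top
    · exact (ENNReal.ofReal_pos.2 (Real.exp_pos _)).ne'
  have hm' : rightLim0 (limsupFn Ms) = ENNReal.ofReal (rightLim0 (limsupFn Ms)).toReal :=
    (ENNReal.ofReal_toReal htop).symm
  have he' : ε0 = ENNReal.ofReal ε0.toReal := (ENNReal.ofReal_toReal hετ.ne).symm
  have hone : 1 ≤ rightLim0 (limsupFn Ms) := by
    unfold rightLim0
    refine le_iInf₂ fun r hr => ?_
    unfold limsupFn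
    refine Filter.le_limsup_of_frequently_le (Filter.Frequently.of_forall fun k => ?_)
    rw [← ENNReal.ofReal_one]
    exact ENNReal.ofReal_le_ofReal (hM1 k r (le_of_lt hr))
  have hm : 1 ≤ (rightLim0 (limsupFn Ms)).toReal := by
    rw [← ENNReal.toReal_one]
    exact ENNReal.toReal_mono htop hone
  have he : 0 ≤ ε0.toReal := ENNReal.toReal_nonneg
  generalize (rightLim0 (limsupFn Ms)).toReal = m at hm' hm ⊢
  generalize ε0.toReal = e at he' he
  obtain ⟨r2, hr2, hgr⟩ := UDB.main_growth hd hdn U hUo Ms εs hM hε Es hE μ hw x hx.1 hm he hm'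
    (by rw [← hε0]; exact he')
  have hfa := UDB.final_arith hd hdn hm he
  have hex := Real.exp_pos (4 * d * ((n : ℝ) - d) ^ 2 * (UDB.c00 n d) ^ 2 * m ^ 2)
  generalize Real.exp (4 * d * ((n : ℝ) - d) ^ 2 * (UDB.c00 n d) ^ 2 * m ^ 2) = X at hfa hex ⊢
  have hup : upperDensity n d μ x ≤ ENNReal.ofReal ((2 * m + 2 ^ d * e) * X) * (ωb d)⁻¹ := by
    unfold upperDensity
    refine Filter.limsup_le_of_le (by isBoundedDefault) ?_
    have hev : ∀ᶠ r : ℝ in 𝓝[>] 0, r < r2 := nhdsWithin_le_nhds (Iio_mem_nhds hr2)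
    filter_upwards [hev, self_mem_nhdsWithin] with r hr hr0
    have hr0' : 0 < r := hr0
    have h1 := hgr r hr0' hr
    have hrd : 0 < r ^ d := by positivity
    have h2 : μ (closedBall x r) ≤ ENNReal.ofReal ((2 * m + 2 ^ d * e) * X) * ENNReal.ofReal r ^ d := by
      rw [← ENNReal.ofReal_pow hr0'.le, ← ENNReal.ofReal_mul (by positivity),
        ← ENNReal.ofReal_toReal ((isCompact_closedBall x r).measure_lt_top (μ := μ)).ne]
      apply ENNReal.ofReal_le_ofReal
      refine h1.trans ?_
      gcongr
    have hp0 : ENNReal.ofReal r ^ d ≠ 0 := pow_ne_zero _ (ENNReal.ofReal_pos.2 hr0').ne'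
    have hpt : ENNReal.ofReal r ^ d ≠ ⊤ := ENNReal.pow_ne_top ENNReal.ofReal_ne_top
    apply ENNReal.div_le_of_le_mul
    calc μ (closedBall x r) ≤ ENNReal.ofReal ((2 * m + 2 ^ d * e) * X) * ENNReal.ofReal r ^ d := h2
      _ = ENNReal.ofReal ((2 * m + 2 ^ d * e) * X) * ((ωb d)⁻¹ * ωb d) * ENNReal.ofReal r ^ d := by
        rw [ENNReal.inv_mul_cancel hω0 hωt, mul_one]
      _ = _ := by ring
  refine hup.trans (le_of_eq ?_)
  rw [hm', he', ENNReal.ofReal_one, ENNReal.ofReal_mul (by positivity),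
    ENNReal.ofReal_add (by positivity) (by positivity), ENNReal.ofReal_mul (by norm_num),
    ENNReal.ofReal_mul (by positivity), ENNReal.ofReal_pow (by norm_num)]
  simp only [ENNReal.ofReal_ofNat]
  ring
end
end

section
/- There exist constants c0 = c0(n,d) ≥ 1 and c1 = c1(n,d) > 0 with the following property. Let U ⊆ ℝ^n be a nonempty open set, M: [0,∞) → [1,∞) and ε: [0,∞) → [0,∞) nondecreasing, and E ∈ QM(ℝ^n,U,M,ε). Let η > 1 and r0 > 0 satisfy 2(n−d) c0 (ln η)^{−1/2} M(η r0) ≤ 1. Then for every x ∈ E ∩ U and every r with 0 < r < min(r0, η^{−1} dist(x, ℝ^n∖U)), one has H^d(E ∩ B̄(x,r)) ≤ 2 c1 M(2ηr) (ηr)^d + ε(2ηr). -/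
open MeasureTheory Metric Set Filter Topology
open scoped ENNReal NNReal

noncomputable section

/-- distance to the half-integers -/
def tt (u : ℝ) : ℝ := |Int.fract u - 1/2|

lemma tt_nonneg (u : ℝ) : 0 ≤ tt u := abs_nonneg _

lemma tt_le (u : ℝ) : tt u ≤ 1/2 := by
  unfold tt
  rw [abs_le]
  constructor <;> linarith [Int.fract_nonneg u, Int.fract_lt_one u]

lemma tt_ge (u : ℝ) (k : ℤ) : 1/2 - |u - k| ≤ tt u := by
  unfold tt
  have h1 := Int.floor_add_fract u
  have h2 := Int.fract_nonneg u
  have h3 := Int.fract_lt_one u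
  rcases le_or_gt k ⌊u⌋ with h | h
  · have : (k:ℝ) ≤ ⌊u⌋ := by exact_mod_cast h
    linarith [le_abs_self (u - k), neg_le_abs (Int.fract u - 1/2)]
  · have : (⌊u⌋:ℝ) + 1 ≤ k := by exact_mod_cast h
    linarith [neg_le_abs (u - k), le_abs_self (Int.fract u - 1/2)]

lemma exists_int_between {u v : ℝ} (huv : u ≤ v) (h : ⌊u⌋ ≠ ⌊v⌋) : u ≤ ⌊v⌋ ∧ (⌊v⌋:ℝ) ≤ v := by
  refine ⟨?_, Int.floor_le v⟩
  have h1 : ⌊u⌋ < ⌊v⌋ := lt_of_le_of_ne (Int.floor_mono huv) h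
  have : (⌊u⌋:ℝ) + 1 ≤ ⌊v⌋ := by exact_mod_cast h1
  linarith [Int.lt_floor_add_one u]

lemma tt_lip_aux {u v : ℝ} (huv : u ≤ v) : |tt u - tt v| ≤ v - u := by
  by_cases h : ⌊u⌋ = ⌊v⌋
  · unfold tt
    refine (abs_abs_sub_abs_le_abs_sub _ _).trans ?_
    have h1 := Int.floor_add_fract u
    have h2 := Int.floor_add_fract v
    have h3 : (⌊u⌋:ℝ) = ⌊v⌋ := by exact_mod_cast h
    rw [abs_le]; constructor <;> linarith
  · obtain ⟨h1, h2⟩ := exists_int_between huv h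
    have a1 := tt_ge u ⌊v⌋
    have a2 := tt_ge v ⌊v⌋
    rw [abs_of_nonpos (by linarith)] at a1
    rw [abs_of_nonneg (by linarith)] at a2
    have := tt_le u
    have := tt_le v
    rw [abs_le]; constructor <;> linarith

lemma tt_lip (u v : ℝ) : |tt u - tt v| ≤ |u - v| := by
  rcases le_total u v with h | h
  · rw [abs_sub_comm u v, abs_of_nonneg (sub_nonneg.2 h)]; exact tt_lip_aux h
  · rw [abs_sub_comm (tt u), abs_of_nonneg (sub_nonneg.2 h)]; exact tt_lip_aux h

/-- clamp to `[-1/2,1/2]` -/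
def clp (w : ℝ) : ℝ := max (-(1/2)) (min (1/2) w)

lemma clp_lip (u v : ℝ) : |clp u - clp v| ≤ |u - v| := by
  unfold clp
  refine (abs_max_sub_max_le_max _ _ _ _).trans (max_le (by simp) ?_)
  exact (abs_min_sub_min_le_max _ _ _ _).trans (max_le (by simp) le_rfl)

lemma clp_ge (w : ℝ) : -(1/2) ≤ clp w := le_max_left _ _
lemma clp_le (w : ℝ) : clp w ≤ 1/2 := max_le (by norm_num) (min_le_left _ _)

lemma clp_of_ge {w : ℝ} (h : 1/2 ≤ w) : clp w = 1/2 := by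
  unfold clp; rw [min_eq_left h]; norm_num
lemma clp_of_le {w : ℝ} (h : w ≤ -(1/2)) : clp w = -(1/2) := by
  unfold clp; rw [min_eq_right (by linarith), max_eq_left h]

/-- one coordinate of the projection on the skeleton -/
def hh (u σ : ℝ) : ℝ := ⌊u⌋ + 1/2 + clp ((Int.fract u - 1/2) / (2 * σ))

lemma hh_near (u σ : ℝ) : |hh u σ - u| ≤ 1 := by
  unfold hh
  have h1 := Int.floor_add_fract u
  have h2 := Int.fract_nonneg u
  have h3 := Int.fract_lt_one u
  have h4 := clp_ge ((Int.fract u - 1/2) / (2 * σ))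
  have h5 := clp_le ((Int.fract u - 1/2) / (2 * σ))
  rw [abs_le]; constructor <;> linarith

lemma hh_int (u σ : ℝ) (hσ : 0 < σ) (h : σ ≤ tt u) : ∃ k : ℤ, hh u σ = k := by
  unfold tt at h
  unfold hh
  rcases le_abs.1 h with h | h
  · refine ⟨⌊u⌋ + 1, ?_⟩
    rw [clp_of_ge]
    · push_cast; ring
    · rw [le_div_iff₀ (by positivity)]; linarith
  · refine ⟨⌊u⌋, ?_⟩
    rw [clp_of_le]
    · ring
    · rw [div_le_iff₀ (by positivity)]; linarith

lemma hh_sub_int (u σ : ℝ) (hσ : 0 < σ) (hσ2 : σ ≤ 1/2) (k : ℤ) :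
    |hh u σ - k| ≤ |u - k| / (2 * σ) := by
  have h1 := Int.floor_add_fract u
  have h2 := Int.fract_nonneg u
  have h3 := Int.fract_lt_one u
  have h4 := clp_ge ((Int.fract u - 1/2) / (2 * σ))
  have h5 := clp_le ((Int.fract u - 1/2) / (2 * σ))
  have hp : 0 < 2 * σ := by linarith
  have key : ∀ y : ℝ, 0 ≤ y → y ≤ y / (2 * σ) := fun y hy => by
    rw [le_div_iff₀ hp]; nlinarith
  unfold hh
  rcases le_or_gt k ⌊u⌋ with h | h
  · have h6 : (k:ℝ) ≤ ⌊u⌋ := by exact_mod_cast h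
    rw [abs_of_nonneg (by linarith), abs_of_nonneg (by linarith)]
    rcases le_total ((Int.fract u - 1/2) / (2 * σ)) (-(1/2)) with h7 | h7
    · rw [clp_of_le h7]
      have := key (u - k) (by linarith)
      linarith
    · have h8 : clp ((Int.fract u - 1/2) / (2 * σ)) ≤ (Int.fract u - 1/2) / (2 * σ) :=
        max_le h7 (min_le_right _ _)
      have := key (⌊u⌋ - k + 1/2) (by linarith)
      have e : (u - k) / (2 * σ) = (⌊u⌋ - k + 1/2) / (2 * σ) + (Int.fract u - 1/2) / (2 * σ) := by
        rw [← add_div]; congr 1; linarith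
      rw [e]; linarith
  · have h6 : (⌊u⌋:ℝ) + 1 ≤ k := by exact_mod_cast h
    rw [abs_of_nonpos (by linarith), abs_of_nonpos (by linarith)]
    rcases le_total (1/2) ((Int.fract u - 1/2) / (2 * σ)) with h7 | h7
    · rw [clp_of_ge h7]
      have := key (-(u - k)) (by linarith)
      linarith
    · have h8 : (Int.fract u - 1/2) / (2 * σ) ≤ clp ((Int.fract u - 1/2) / (2 * σ)) := by
        unfold clp; rw [min_eq_right h7]; exact le_max_right _ _
      have := key (k - ⌊u⌋ - 1/2) (by linarith)
      have e : -(u - k) / (2 * σ) = (k - ⌊u⌋ - 1/2) / (2 * σ) - (Int.fract u - 1/2) / (2 * σ) := by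
        rw [← sub_div]; congr 1; linarith
      rw [e]; linarith

lemma hh_lip_aux {u v σ : ℝ} (hσ : 0 < σ) (hσ2 : σ ≤ 1/2) (huv : u ≤ v) :
    |hh u σ - hh v σ| ≤ (v - u) / (2 * σ) := by
  have hp : 0 < 2 * σ := by linarith
  by_cases h : ⌊u⌋ = ⌊v⌋
  · unfold hh
    have h1 := Int.floor_add_fract u
    have h2 := Int.floor_add_fract v
    have h3 : (⌊u⌋:ℝ) = ⌊v⌋ := by exact_mod_cast h
    rw [h3, add_sub_add_left_eq_sub]
    refine (clp_lip _ _).trans ?_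
    rw [← sub_div, abs_div, abs_of_pos hp]
    gcongr
    rw [abs_le]; constructor <;> linarith
  · obtain ⟨h1, h2⟩ := exists_int_between huv h
    have a1 := hh_sub_int u σ hσ hσ2 ⌊v⌋
    have a2 := hh_sub_int v σ hσ hσ2 ⌊v⌋
    rw [abs_of_nonpos (show u - ⌊v⌋ ≤ 0 by linarith)] at a1
    rw [abs_of_nonneg (show 0 ≤ v - ⌊v⌋ by linarith), abs_sub_comm] at a2
    refine (abs_sub_le _ (⌊v⌋:ℝ) _).trans ((add_le_add a1 a2).trans (le_of_eq ?_))
    rw [← add_div]; congr 1; ring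

lemma hh_lip {u v σ : ℝ} (hσ : 0 < σ) (hσ2 : σ ≤ 1/2) :
    |hh u σ - hh v σ| ≤ |u - v| / (2 * σ) := by
  rcases le_total u v with h | h
  · rw [abs_sub_comm u v, abs_of_nonneg (sub_nonneg.2 h)]; exact hh_lip_aux hσ hσ2 h
  · rw [abs_sub_comm (hh u σ), abs_of_nonneg (sub_nonneg.2 h)]; exact hh_lip_aux hσ hσ2 h

lemma hh_lip_right_aux {u σ σ' : ℝ} (hσ : 0 < σ) (h : σ ≤ σ') :
    |hh u σ - hh u σ'| ≤ (σ' - σ) / (2 * σ) := by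
  have hσ' : 0 < σ' := by linarith
  unfold hh
  rw [add_sub_add_left_eq_sub]
  set w := Int.fract u - 1/2
  have hnn : 0 ≤ (σ' - σ) / (2 * σ) := div_nonneg (by linarith) (by linarith)
  rcases le_total σ' w with h1 | h1
  · rw [clp_of_ge, clp_of_ge]
    · simpa using hnn
    · rw [le_div_iff₀ (by positivity)]; linarith
    · rw [le_div_iff₀ (by positivity)]; linarith
  rcases le_total w (-σ') with h2 | h2
  · rw [clp_of_le, clp_of_le]
    · simpa using hnn
    · rw [div_le_iff₀ (by positivity)]; linarith
    · rw [div_le_iff₀ (by positivity)]; linarith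
  refine (clp_lip _ _).trans ?_
  have e : w / (2 * σ) - w / (2 * σ') = (w / σ') * ((σ' - σ) / (2 * σ)) := by
    field_simp
  rw [e, abs_mul, abs_of_nonneg hnn]
  have : |w / σ'| ≤ 1 := by
    rw [abs_div, abs_of_pos hσ', div_le_one hσ', abs_le]; exact ⟨h2, h1⟩
  nlinarith

lemma hh_lip_right {u σ σ' σ0 : ℝ} (h0 : 0 < σ0) (hσ : σ0 ≤ σ) (h : σ0 ≤ σ') :
    |hh u σ - hh u σ'| ≤ |σ - σ'| / (2 * σ0) := by
  rcases le_total σ σ' with h1 | h1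
  · rw [abs_sub_comm σ, abs_of_nonneg (sub_nonneg.2 h1)]
    refine (hh_lip_right_aux (by linarith) h1).trans ?_
    exact div_le_div_of_nonneg_left (by linarith) (by linarith) (by linarith)
  · rw [abs_sub_comm (hh u σ), abs_of_nonneg (sub_nonneg.2 h1)]
    refine (hh_lip_right_aux (by linarith) h1).trans ?_
    exact div_le_div_of_nonneg_left (by linarith) (by linarith) (by linarith)

/-- one dimensional averaging -/
lemma vol_tt (c δ : ℝ) :
    (volume.restrict (Ico (0:ℝ) 1)) {a | tt (c + a) < δ} ≤ ENNReal.ofReal (4 * δ) := by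
  rcases le_or_gt δ 0 with hδ | hδ
  · have : {a | tt (c + a) < δ} = ∅ := by
      ext a; simp; linarith [tt_nonneg (c + a)]
    rw [this]; simp
  have hcont : Continuous (fun a : ℝ => tt (c + a)) := by
    have : LipschitzWith 1 (fun a : ℝ => tt (c + a)) := by
      refine LipschitzWith.of_dist_le_mul fun x y => ?_
      rw [Real.dist_eq, Real.dist_eq]
      refine (tt_lip _ _).trans ?_
      simp
    exact this.continuous
  rw [Measure.restrict_apply (isOpen_lt hcont continuous_const).measurableSet]
  have hsub : {a | tt (c + a) < δ} ∩ Ico (0:ℝ) 1 ⊆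
      ball ((⌊c⌋:ℝ) + 1/2 - c) δ ∪ ball ((⌊c⌋:ℝ) + 3/2 - c) δ := by
    rintro a ⟨ha, ha0, ha1⟩
    have h1 := Int.floor_add_fract (c + a)
    have hm1 : ⌊c⌋ ≤ ⌊c + a⌋ := Int.floor_mono (by linarith)
    have hm2 : ⌊c + a⌋ < ⌊c⌋ + 2 := by
      rw [Int.floor_lt]; push_cast; linarith [Int.lt_floor_add_one c]
    simp only [Set.mem_ofPred_eq, tt, abs_lt] at ha
    have : ⌊c + a⌋ = ⌊c⌋ ∨ ⌊c + a⌋ = ⌊c⌋ + 1 := by omega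
    rcases this with h | h
    · left
      have h' : (⌊c + a⌋:ℝ) = ⌊c⌋ := by exact_mod_cast h
      rw [mem_ball, Real.dist_eq, abs_lt]; constructor <;> linarith
    · right
      have h' : (⌊c + a⌋:ℝ) = ⌊c⌋ + 1 := by exact_mod_cast h
      rw [mem_ball, Real.dist_eq, abs_lt]; constructor <;> linarith
  refine (measure_mono hsub).trans ((measure_union_le _ _).trans ?_)
  rw [Real.volume_ball, Real.volume_ball, ← ENNReal.ofReal_add (by positivity) (by positivity)]
  apply le_of_eq; congr 1; ring

/-- the `(d+1)`-st smallest of the numbers `tt (z i)` -/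
def tau {n : ℕ} (d : ℕ) [Nonempty (Fin (d+1) ↪ Fin n)] (z : Fin n → ℝ) : ℝ :=
  Finset.univ.inf' Finset.univ_nonempty (fun f : Fin (d+1) ↪ Fin n =>
    Finset.univ.sup' Finset.univ_nonempty (fun j : Fin (d+1) => tt (z (f j))))

lemma tau_lt {n d : ℕ} [Nonempty (Fin (d+1) ↪ Fin n)] (z : Fin n → ℝ) (δ : ℝ) :
    tau d z < δ ↔ ∃ f : Fin (d+1) ↪ Fin n, ∀ j, tt (z (f j)) < δ := by
  simp [tau, Finset.inf'_lt_iff, Finset.sup'_lt_iff]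

lemma tau_le_half {n d : ℕ} [Nonempty (Fin (d+1) ↪ Fin n)] (z : Fin n → ℝ) :
    tau d z ≤ 1/2 := by
  obtain ⟨f⟩ := ‹Nonempty (Fin (d+1) ↪ Fin n)›
  refine (Finset.inf'_le _ (Finset.mem_univ f)).trans ?_
  exact Finset.sup'_le _ _ fun j _ => tt_le _

lemma tau_lip_aux {n d : ℕ} [Nonempty (Fin (d+1) ↪ Fin n)] (z z' : Fin n → ℝ) (D : ℝ)
    (h : ∀ i, |z i - z' i| ≤ D) : tau d z ≤ tau d z' + D := by
  by_contra! hc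
  have h1 : tau d z' < tau d z - D := by linarith
  rw [tau_lt] at h1
  obtain ⟨f, hf⟩ := h1
  have : tau d z < tau d z := by
    rw [tau_lt]
    refine ⟨f, fun j => ?_⟩
    have h2 := hf j
    have h3 := (le_abs_self _).trans ((tt_lip (z (f j)) (z' (f j))).trans (h (f j)))
    linarith
  exact lt_irrefl _ this

lemma tau_lip {n d : ℕ} [Nonempty (Fin (d+1) ↪ Fin n)] (z z' : Fin n → ℝ) (D : ℝ)
    (h : ∀ i, |z i - z' i| ≤ D) : |tau d z - tau d z'| ≤ D := by
  rw [abs_le]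
  have h1 := tau_lip_aux (d := d) z z' D h
  have h2 := tau_lip_aux (d := d) z' z D (fun i => by rw [abs_sub_comm]; exact h i)
  constructor <;> linarith

lemma tau_cont {n d : ℕ} [Nonempty (Fin (d+1) ↪ Fin n)] :
    Continuous (tau d : (Fin n → ℝ) → ℝ) := by
  have : LipschitzWith 1 (tau d : (Fin n → ℝ) → ℝ) := by
    refine LipschitzWith.of_dist_le_mul fun x y => ?_
    rw [Real.dist_eq]
    refine tau_lip _ _ _ fun i => ?_
    simpa [Real.dist_eq] using dist_le_pi_dist x y i
  exact this.continuous

/-- at most `d` coordinates are below `tau` -/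
lemma card_lt_tau {n d : ℕ} [Nonempty (Fin (d+1) ↪ Fin n)] (z : Fin n → ℝ) :
    (Finset.univ.filter (fun i => tt (z i) < tau d z)).card ≤ d := by
  by_contra! hc
  have : Nonempty (Fin (d+1) ↪ (Finset.univ.filter (fun i => tt (z i) < tau d z))) := by
    apply Function.Embedding.nonempty_of_card_le
    rw [Fintype.card_coe, Fintype.card_fin]; exact hc
  obtain ⟨f⟩ := this
  have : tau d z < tau d z := by
    rw [tau_lt]
    refine ⟨f.trans (Function.Embedding.subtype _), fun j => ?_⟩
    have := (f j).2
    rw [Finset.mem_filter] at this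
    exact this.2
  exact lt_irrefl _ this

/-- uniform measure on the unit cube -/
def cubeM (n : ℕ) : Measure (Fin n → ℝ) :=
  Measure.pi (fun _ => volume.restrict (Ico (0:ℝ) 1))

instance cube_factor_prob : IsProbabilityMeasure (volume.restrict (Ico (0:ℝ) 1)) :=
  ⟨by simp⟩

instance cube_prob (n : ℕ) : IsProbabilityMeasure (cubeM n) := by
  unfold cubeM; infer_instance

lemma cube_tau {n d : ℕ} [Nonempty (Fin (d+1) ↪ Fin n)] (c : Fin n → ℝ) (δ : ℝ) :
    cubeM n {a | tau d (c + a) < δ} ≤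
      (Fintype.card (Fin (d+1) ↪ Fin n) : ℝ≥0∞) * ENNReal.ofReal (4 * δ) ^ (d+1) := by
  classical
  have hsub : {a | tau d (c + a) < δ} ⊆ ⋃ f : Fin (d+1) ↪ Fin n,
      Set.pi univ (fun i => if i ∈ Finset.univ.map f then {b : ℝ | tt (c i + b) < δ} else univ) := by
    intro a ha
    obtain ⟨f, hf⟩ := (tau_lt _ _).1 ha
    refine mem_iUnion.2 ⟨f, fun i _ => ?_⟩
    dsimp only
    split_ifs with hi
    · obtain ⟨j, _, rfl⟩ := Finset.mem_map.1 hi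
      exact hf j
    · trivial
  refine (measure_mono hsub).trans ((measure_iUnion_le _).trans ?_)
  rw [tsum_fintype]
  refine (Finset.sum_le_card_nsmul _ _ (ENNReal.ofReal (4 * δ) ^ (d+1)) fun f _ => ?_).trans ?_
  · unfold cubeM
    rw [Measure.pi_pi]
    rw [← Finset.prod_subset (Finset.subset_univ (Finset.univ.map f))]
    · refine (Finset.prod_le_pow_card _ _ (ENNReal.ofReal (4 * δ)) ?_).trans ?_
      · intro i hi
        rw [if_pos hi]
        exact vol_tt _ _
      · simp
    · intro i _ hi
      rw [if_neg hi, measure_univ]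
  · simp

/-- averaging over translations -/
lemma avg_tau {n d : ℕ} [Nonempty (Fin (d+1) ↪ Fin n)] (ν : Measure (Euc n)) [IsFiniteMeasure ν]
    (s δ : ℝ) :
    ∫⁻ a, ν {y | tau d ((fun i => s⁻¹ * y i) + a) < δ} ∂(cubeM n) ≤
      (Fintype.card (Fin (d+1) ↪ Fin n) : ℝ≥0∞) * ENNReal.ofReal (4 * δ) ^ (d+1) * ν univ := by
  have hm : MeasurableSet {p : (Fin n → ℝ) × Euc n | tau d ((fun i => s⁻¹ * p.2 i) + p.1) < δ} := by
    apply IsOpen.measurableSet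
    refine isOpen_lt (tau_cont.comp ?_) continuous_const
    fun_prop
  generalize hS : {p : (Fin n → ℝ) × Euc n | tau d ((fun i => s⁻¹ * p.2 i) + p.1) < δ} = S at hm
  have e1 : ∀ a : Fin n → ℝ, {y : Euc n | tau d ((fun i => s⁻¹ * y i) + a) < δ} = Prod.mk a ⁻¹' S := by
    intro a; rw [← hS]; rfl
  have e2 : ∀ y : Euc n, {a | tau d ((fun i => s⁻¹ * y i) + a) < δ} = (fun a => (a, y)) ⁻¹' S := by
    intro a; rw [← hS]; rfl
  have h3 : ∀ y : Euc n, cubeM n ((fun a => (a, y)) ⁻¹' S) ≤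
      (Fintype.card (Fin (d+1) ↪ Fin n) : ℝ≥0∞) * ENNReal.ofReal (4 * δ) ^ (d+1) := by
    intro y; rw [← e2 y]; exact cube_tau _ _
  simp_rw [e1]
  rw [← Measure.prod_apply hm, Measure.prod_apply_symm hm]
  refine (lintegral_mono h3).trans ?_
  rw [lintegral_const]

lemma avg_meas {n d : ℕ} [Nonempty (Fin (d+1) ↪ Fin n)] (ν : Measure (Euc n)) [IsFiniteMeasure ν]
    (s δ : ℝ) :
    Measurable (fun a => ν {y | tau d ((fun i => s⁻¹ * y i) + a) < δ}) := by
  have hm : MeasurableSet {p : (Fin n → ℝ) × Euc n | tau d ((fun i => s⁻¹ * p.2 i) + p.1) < δ} := by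
    apply IsOpen.measurableSet
    refine isOpen_lt (tau_cont.comp ?_) continuous_const
    fun_prop
  exact measurable_measure_prodMk_left hm

lemma euc_dist_le {n : ℕ} (y y' : Euc n) (D : ℝ) (hD : 0 ≤ D) (h : ∀ i, |y i - y' i| ≤ D) :
    dist y y' ≤ n * D := by
  rw [EuclideanSpace.dist_eq]
  have h1 : ∑ i, dist (y i) (y' i) ^ 2 ≤ n * D ^ 2 := by
    refine (Finset.sum_le_card_nsmul _ _ (D ^ 2) fun i _ => ?_).trans (by simp)
    rw [Real.dist_eq]
    exact pow_le_pow_left₀ (abs_nonneg _) (h i) 2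
  apply Real.sqrt_le_iff.2
  refine ⟨by positivity, h1.trans ?_⟩
  rw [mul_pow]
  have : (n:ℝ) ≤ (n:ℝ)^2 := by
    have : n ≤ n ^ 2 := Nat.le_self_pow (by norm_num) n
    exact_mod_cast this
  gcongr

lemma euc_coord_le {n : ℕ} (y y' : Euc n) (i : Fin n) : |y i - y' i| ≤ dist y y' := by
  have := PiLp.dist_apply_le (p := 2) y y' i
  rwa [Real.dist_eq] at this

/-- the union of the `d`-faces of the unit cube at the origin -/
def Wd (n d : ℕ) : Set (Euc n) :=
  {w | (∀ i, 0 ≤ w i ∧ w i ≤ 1) ∧ (Finset.univ.filter (fun i => w i ≠ 0)).card ≤ d}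

open Classical in
lemma Wd_finite (n d : ℕ) (hdn : d ≤ n) : μH[(d:ℝ)] (Wd n d) < ∞ := by
  let g : (T : Finset (Fin n)) → (T → ℝ) → Euc n := fun T w =>
    WithLp.toLp 2 (fun i => if h : i ∈ T then w ⟨i, h⟩ else 0)
  have hg : ∀ T, LipschitzWith (n : ℝ≥0) (g T) := by
    intro T
    refine LipschitzWith.of_dist_le_mul fun w w' => ?_
    refine euc_dist_le _ _ _ dist_nonneg fun i => ?_
    simp only [g]
    split_ifs with h
    · simpa [Real.dist_eq] using dist_le_pi_dist w w' ⟨i, h⟩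
    · simp
  have hsub : Wd n d ⊆ ⋃ T ∈ Finset.powersetCard d (Finset.univ : Finset (Fin n)),
      g T '' (Set.Icc 0 1) := by
    rintro w ⟨h1, h2⟩
    obtain ⟨T, hT1, hT2⟩ := Finset.exists_superset_card_eq h2 (by simpa using hdn)
    refine mem_iUnion₂.2 ⟨T, Finset.mem_powersetCard.2 ⟨Finset.subset_univ _, hT2⟩,
      fun i => w i, ⟨fun i => (h1 i).1, fun i => (h1 i).2⟩, ?_⟩
    ext i
    simp only [g]
    split_ifs with h
    · rfl
    · by_contra hne
      exact h (hT1 (by simpa using fun h0 : w i = 0 => hne h0.symm))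
  refine (measure_mono hsub).trans_lt ((measure_biUnion_finset_le _ _).trans_lt ?_)
  refine ENNReal.sum_lt_top.2 fun T hT => ?_
  have hc : Fintype.card T = d := by
    rw [Fintype.card_coe]; exact (Finset.mem_powersetCard.1 hT).2
  refine ((hg T).hausdorffMeasure_image_le (by positivity) _).trans_lt ?_
  have hv : (μH[(d:ℝ)] : Measure (T → ℝ)) = volume := by
    rw [← hc]; exact hausdorffMeasure_pi_real
  rw [hv]
  refine ENNReal.mul_lt_top (ENNReal.rpow_lt_top_of_nonneg (by positivity) (by simp)) ?_
  exact isCompact_Icc.measure_lt_top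

open Classical in
/-- the `d`-skeleton of the grid of step `s` shifted by `a`, in a ball -/
def Skel {n : ℕ} (d : ℕ) (x : Euc n) (r s : ℝ) (a : Fin n → ℝ) : Set (Euc n) :=
  {w | w ∈ closedBall x (3 * r) ∧
    (Finset.univ.filter (fun i => ¬ ∃ k : ℤ, s⁻¹ * w i + a i = k)).card ≤ d}

open Classical in
lemma skel_bound (n d : ℕ) (hdn : d ≤ n) : ∃ C : ℝ≥0, ∀ (x : Euc n) (r s : ℝ) (a : Fin n → ℝ),
    0 < s → s ≤ r → μH[(d:ℝ)] (Skel d x r s a) ≤ C * ENNReal.ofReal (r ^ d * (r / s) ^ (n - d)) := by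
  have hfin := Wd_finite n d hdn
  refine ⟨8 ^ n * (μH[(d:ℝ)] (Wd n d)).toNNReal, fun x r s a hs hsr => ?_⟩
  have hr : 0 < r := by linarith
  let lo : Fin n → ℤ := fun i => ⌊s⁻¹ * (x i - 3 * r) + a i⌋
  let hi : Fin n → ℤ := fun i => ⌊s⁻¹ * (x i + 3 * r) + a i⌋
  let B : Finset (Fin n → ℤ) := Fintype.piFinset (fun i => Finset.Icc (lo i) (hi i))
  let g : (Fin n → ℤ) → Euc n → Euc n := fun m w =>
    WithLp.toLp 2 (fun i => s * (m i - a i)) + s • w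
  have hg : ∀ m, LipschitzWith s.toNNReal (g m) := by
    intro m
    refine LipschitzWith.of_dist_le_mul fun w w' => ?_
    simp only [g]
    rw [dist_add_left, dist_smul₀, Real.norm_of_nonneg hs.le, Real.coe_toNNReal _ hs.le]
  have hsub : Skel d x r s a ⊆ ⋃ m ∈ B, g m '' Wd n d := by
    rintro w ⟨h1, h2⟩
    rw [mem_closedBall] at h1
    refine mem_iUnion₂.2 ⟨fun i => ⌊s⁻¹ * w i + a i⌋, ?_,
      WithLp.toLp 2 (fun i => Int.fract (s⁻¹ * w i + a i)), ⟨?_, ?_⟩, ?_⟩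
    · refine Fintype.mem_piFinset.2 fun i => Finset.mem_Icc.2 ?_
      have h3 := abs_le.1 ((euc_coord_le w x i).trans h1)
      constructor
      · apply Int.floor_mono
        gcongr; linarith
      · apply Int.floor_mono
        gcongr; linarith
    · intro i
      exact ⟨Int.fract_nonneg _, (Int.fract_lt_one _).le⟩
    · refine (Finset.card_le_card ?_).trans h2
      intro i
      simp only [Finset.mem_filter, Finset.mem_univ, true_and]
      rintro h3 ⟨k, hk⟩
      apply h3
      rw [hk]; simp
    · ext i
      have := Int.floor_add_fract (s⁻¹ * w i + a i)
      simp only [g, PiLp.add_apply, PiLp.smul_apply, smul_eq_mul]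
      rw [← mul_add]
      have e : (⌊s⁻¹ * w i + a i⌋:ℝ) - a i + Int.fract (s⁻¹ * w i + a i) = s⁻¹ * w i := by linarith
      rw [e]; field_simp
  have hBcard : (B.card : ℝ) ≤ (8 * (r / s)) ^ n := by
    simp only [B]
    rw [Fintype.card_piFinset]
    push_cast
    have : ∀ i ∈ (Finset.univ : Finset (Fin n)), ((Finset.Icc (lo i) (hi i)).card : ℝ) ≤ 8 * (r/s) := by
      intro i _
      rw [Int.card_Icc]
      have hle : lo i ≤ hi i := by
        apply Int.floor_mono
        gcongr; linarith
      have : (((hi i + 1 - lo i).toNat : ℤ) : ℝ) = hi i + 1 - lo i := by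
        rw [Int.toNat_of_nonneg (by omega)]; push_cast; ring
      rw [Int.cast_natCast] at this
      rw [this]
      have h1 : (hi i : ℝ) ≤ s⁻¹ * (x i + 3 * r) + a i := Int.floor_le _
      have h2 : s⁻¹ * (x i - 3 * r) + a i < lo i + 1 := Int.lt_floor_add_one _
      have h3 : 1 ≤ r / s := by rwa [one_le_div hs]
      have h4 : r / s = s⁻¹ * r := by rw [div_eq_inv_mul]
      rw [h4] at h3 ⊢
      linarith
    refine (Finset.prod_le_prod (fun i _ => Nat.cast_nonneg _) this).trans ?_
    simp
  refine (measure_mono hsub).trans ((measure_biUnion_finset_le _ _).trans ?_)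
  have hone : ∀ m ∈ B, μH[(d:ℝ)] (g m '' Wd n d) ≤ ENNReal.ofReal (s ^ d) * μH[(d:ℝ)] (Wd n d) := by
    intro m _
    refine ((hg m).hausdorffMeasure_image_le (by positivity) _).trans (le_of_eq ?_)
    rw [ENNReal.rpow_natCast, ENNReal.ofReal_pow hs.le]; rfl
  refine (Finset.sum_le_card_nsmul _ _ _ hone).trans ?_
  rw [nsmul_eq_mul]
  have e1 : (B.card : ℝ≥0∞) ≤ ENNReal.ofReal ((8 * (r / s)) ^ n) := by
    rw [← ENNReal.ofReal_natCast]; exact ENNReal.ofReal_le_ofReal hBcard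
  have e2 : (8 * (r / s)) ^ n * s ^ d = 8 ^ n * (r ^ d * (r / s) ^ (n - d)) := by
    have : (r / s) ^ n = (r/s)^(n-d) * (r / s) ^ d := by rw [← pow_add, Nat.sub_add_cancel hdn]
    rw [mul_pow, this, div_pow r s d]
    field_simp
  rw [← mul_assoc]
  calc _ ≤ ENNReal.ofReal ((8 * (r / s)) ^ n) * ENNReal.ofReal (s ^ d) * μH[(d:ℝ)] (Wd n d) := by
        gcongr
    _ = ENNReal.ofReal (8 ^ n) * ENNReal.ofReal (r ^ d * (r / s) ^ (n - d)) * μH[(d:ℝ)] (Wd n d) := by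
        rw [← ENNReal.ofReal_mul (by positivity), e2, ENNReal.ofReal_mul (by positivity)]
    _ = _ := by
        rw [ENNReal.coe_mul, ENNReal.coe_toNNReal hfin.ne]
        have : ENNReal.ofReal (8 ^ n) = ((8 ^ n : ℝ≥0) : ℝ≥0∞) := by
          rw [ENNReal.ofReal_pow (by norm_num)]; simp
        rw [this]; ring

/-- rescaled grid coordinates -/
def zc {n : ℕ} (s : ℝ) (a : Fin n → ℝ) (y : Euc n) : Fin n → ℝ := (fun i => s⁻¹ * y i) + a

/-- projection on the skeleton of the grid of step `s`, regularised at level `σ0` -/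
def Qm {n : ℕ} (d : ℕ) [Nonempty (Fin (d+1) ↪ Fin n)] (s : ℝ) (a : Fin n → ℝ) (σ0 : ℝ)
    (y : Euc n) : Euc n :=
  WithLp.toLp 2 (fun i => s * (hh (zc s a y i) (max (tau d (zc s a y)) σ0) - a i))

lemma zc_sub {n : ℕ} {s : ℝ} (hs : 0 < s) (a : Fin n → ℝ) (y y' : Euc n) (i : Fin n) :
    |zc s a y i - zc s a y' i| ≤ s⁻¹ * dist y y' := by
  have : zc s a y i - zc s a y' i = s⁻¹ * (y i - y' i) := by simp [zc]; ring
  rw [this, abs_mul, abs_of_pos (inv_pos.2 hs)]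
  have := euc_coord_le y y' i
  gcongr

lemma Qm_lip {n d : ℕ} [Nonempty (Fin (d+1) ↪ Fin n)] {s σ0 : ℝ} (hs : 0 < s) (h0 : 0 < σ0)
    (h1 : σ0 ≤ 1/2) (a : Fin n → ℝ) (y y' : Euc n) :
    dist (Qm d s a σ0 y) (Qm d s a σ0 y') ≤ n * (dist y y' / σ0) := by
  refine euc_dist_le _ _ _ (by positivity) fun i => ?_
  simp only [Qm]
  set z := zc s a y
  set z' := zc s a y'
  set σ := max (tau d z) σ0
  set σ' := max (tau d z') σ0
  have hσ : σ0 ≤ σ := le_max_right _ _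
  have hσ' : σ0 ≤ σ' := le_max_right _ _
  have hσ2 : σ ≤ 1/2 := max_le (tau_le_half _) h1
  have b1 : |hh (z i) σ - hh (z' i) σ| ≤ (s⁻¹ * dist y y') / (2 * σ0) := by
    refine (hh_lip (by linarith) hσ2).trans ?_
    have := zc_sub hs a y y' i
    gcongr
  have b2 : |hh (z' i) σ - hh (z' i) σ'| ≤ (s⁻¹ * dist y y') / (2 * σ0) := by
    refine (hh_lip_right h0 hσ hσ').trans ?_
    have h2 : |tau d z - tau d z'| ≤ s⁻¹ * dist y y' := tau_lip _ _ _ (zc_sub hs a y y')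
    have h3 : |σ - σ'| ≤ s⁻¹ * dist y y' := (abs_max_sub_max_le_abs _ _ _).trans h2
    gcongr
  have e : s * (hh (z i) σ - a i) - s * (hh (z' i) σ' - a i) =
      s * ((hh (z i) σ - hh (z' i) σ) + (hh (z' i) σ - hh (z' i) σ')) := by ring
  rw [e, abs_mul, abs_of_pos hs]
  calc s * |(hh (z i) σ - hh (z' i) σ) + (hh (z' i) σ - hh (z' i) σ')|
      ≤ s * ((s⁻¹ * dist y y') / (2 * σ0) + (s⁻¹ * dist y y') / (2 * σ0)) := by
        gcongr; exact (abs_add_le _ _).trans (add_le_add b1 b2)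
    _ = dist y y' / σ0 := by field_simp; ring

lemma Qm_near {n d : ℕ} [Nonempty (Fin (d+1) ↪ Fin n)] {s σ0 : ℝ} (hs : 0 < s)
    (a : Fin n → ℝ) (y : Euc n) : dist (Qm d s a σ0 y) y ≤ n * s := by
  refine euc_dist_le _ _ _ hs.le fun i => ?_
  simp only [Qm]
  have e : ∀ w : ℝ, s * (w - a i) - y i = s * (w - zc s a y i) := by
    intro w; simp [zc]; field_simp; ring
  rw [e, abs_mul, abs_of_pos hs]
  have := hh_near (zc s a y i) (max (tau d (zc s a y)) σ0)
  nlinarith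

/-- radial cutoff -/
def chi {n : ℕ} (x : Euc n) (ρ s : ℝ) (y : Euc n) : ℝ := max 0 (min 1 ((ρ + s - dist y x) / s))

lemma chi_nonneg {n : ℕ} (x : Euc n) (ρ s : ℝ) (y : Euc n) : 0 ≤ chi x ρ s y := le_max_left _ _
lemma chi_le_one {n : ℕ} (x : Euc n) (ρ s : ℝ) (y : Euc n) : chi x ρ s y ≤ 1 :=
  max_le zero_le_one (min_le_left _ _)

lemma chi_in {n : ℕ} (x : Euc n) {ρ s : ℝ} (hs : 0 < s) (y : Euc n) (h : dist y x ≤ ρ) :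
    chi x ρ s y = 1 := by
  unfold chi
  rw [min_eq_left, max_eq_right zero_le_one]
  rw [le_div_iff₀ hs]; linarith

lemma chi_out {n : ℕ} (x : Euc n) {ρ s : ℝ} (hs : 0 < s) (y : Euc n) (h : ρ + s ≤ dist y x) :
    chi x ρ s y = 0 := by
  unfold chi
  apply max_eq_left
  refine (min_le_right _ _).trans ?_
  exact div_nonpos_of_nonpos_of_nonneg (by linarith) hs.le

lemma chi_lip {n : ℕ} (x : Euc n) {ρ s : ℝ} (hs : 0 < s) (y y' : Euc n) :
    |chi x ρ s y - chi x ρ s y'| ≤ dist y y' / s := by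
  have hnn : 0 ≤ dist y y' / s := by positivity
  unfold chi
  refine (abs_max_sub_max_le_max _ _ _ _).trans (max_le (by simpa using hnn) ?_)
  refine (abs_min_sub_min_le_max _ _ _ _).trans (max_le (by simpa using hnn) ?_)
  rw [← sub_div, abs_div, abs_of_pos hs]
  gcongr
  rw [sub_sub_sub_cancel_left]
  rw [dist_comm y y']
  exact abs_dist_sub_le _ _ _

/-- the deformation -/
def phi {n : ℕ} (d : ℕ) [Nonempty (Fin (d+1) ↪ Fin n)] (x : Euc n) (ρ s : ℝ) (a : Fin n → ℝ)
    (σ0 : ℝ) (y : Euc n) : Euc n :=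
  y + chi x ρ s y • (Qm d s a σ0 y - y)

lemma phi_near {n d : ℕ} [Nonempty (Fin (d+1) ↪ Fin n)] (x : Euc n) {ρ s : ℝ} (hs : 0 < s)
    (a : Fin n → ℝ) (σ0 : ℝ) (y : Euc n) : dist (phi d x ρ s a σ0 y) y ≤ n * s := by
  have h := Qm_near (d := d) (σ0 := σ0) hs a y
  rw [dist_eq_norm] at h ⊢
  unfold phi
  rw [add_sub_cancel_left, norm_smul, Real.norm_of_nonneg (chi_nonneg _ _ _ _)]
  have := chi_le_one x ρ s y
  nlinarith [norm_nonneg (Qm d s a σ0 y - y)]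

lemma phi_lip {n d : ℕ} [Nonempty (Fin (d+1) ↪ Fin n)] (x : Euc n) {ρ s σ0 : ℝ} (hs : 0 < s)
    (h0 : 0 < σ0) (h1 : σ0 ≤ 1/2) (a : Fin n → ℝ) :
    LipschitzWith (Real.toNNReal (1 + n + n / σ0)) (phi d x ρ s a σ0) := by
  refine LipschitzWith.of_dist_le_mul fun y y' => ?_
  rw [Real.coe_toNNReal _ (by positivity)]
  have e : phi d x ρ s a σ0 y - phi d x ρ s a σ0 y' =
      (1 - chi x ρ s y) • (y - y') + chi x ρ s y • (Qm d s a σ0 y - Qm d s a σ0 y') +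
      (chi x ρ s y - chi x ρ s y') • (Qm d s a σ0 y' - y') := by
    unfold phi; module
  have q1 := Qm_lip (d := d) hs h0 h1 a y y'
  have q2 := Qm_near (d := d) (σ0 := σ0) hs a y'
  have q3 := chi_lip (ρ := ρ) x hs y y'
  have c0 := chi_nonneg x ρ s y
  have c1 := chi_le_one x ρ s y
  rw [dist_eq_norm (phi d x ρ s a σ0 y), e]
  rw [dist_eq_norm (Qm d s a σ0 y)] at q1
  rw [dist_eq_norm (Qm d s a σ0 y')] at q2
  refine (norm_add₃_le).trans ?_
  rw [norm_smul, norm_smul, norm_smul, Real.norm_of_nonneg c0,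
    Real.norm_of_nonneg (by linarith : 0 ≤ 1 - chi x ρ s y), Real.norm_eq_abs, ← dist_eq_norm y y']
  have t1 : (1 - chi x ρ s y) * dist y y' ≤ 1 * dist y y' := by gcongr; linarith
  have t2 : chi x ρ s y * ‖Qm d s a σ0 y - Qm d s a σ0 y'‖ ≤ 1 * (n * (dist y y' / σ0)) := by
    gcongr
  have t3 : |chi x ρ s y - chi x ρ s y'| * ‖Qm d s a σ0 y' - y'‖ ≤ dist y y' / s * (n * s) := by
    gcongr
  have t4 : dist y y' / s * (n * s) = n * dist y y' := by field_simp
  have t5 : (1 + n + n / σ0) * dist y y' = 1 * dist y y' + 1 * (n * (dist y y' / σ0)) + n * dist y y' := by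
    ring
  linarith

lemma phi_skel {n d : ℕ} [Nonempty (Fin (d+1) ↪ Fin n)] (x : Euc n) {r ρ s σ0 : ℝ} (hs : 0 < s)
    (h0 : 0 < σ0) (hnr : n * s ≤ r) (hρ : ρ + s ≤ 2 * r) (a : Fin n → ℝ) (y : Euc n)
    (hy : dist y x ≤ ρ) (ht : σ0 ≤ tau d (zc s a y)) : phi d x ρ s a σ0 y ∈ Skel d x r s a := by
  classical
  constructor
  · rw [mem_closedBall]
    have := phi_near (d := d) (ρ := ρ) x hs a σ0 y
    have := dist_triangle (phi d x ρ s a σ0 y) y x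
    linarith
  · have e : phi d x ρ s a σ0 y = Qm d s a σ0 y := by
      unfold phi; rw [chi_in x hs y hy]; simp
    rw [e]
    refine (Finset.card_le_card ?_).trans (card_lt_tau (d := d) (zc s a y))
    intro i
    simp only [Finset.mem_filter, Finset.mem_univ, true_and]
    intro hi
    by_contra! hc
    apply hi
    obtain ⟨k, hk⟩ := hh_int (zc s a y i) (tau d (zc s a y)) (by linarith) hc
    refine ⟨k, ?_⟩
    simp only [Qm]
    rw [max_eq_left ht, hk]
    field_simp
    ring

lemma phi_congr {n d : ℕ} [Nonempty (Fin (d+1) ↪ Fin n)] (x : Euc n) {ρ s σ0 σ1 : ℝ}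
    (a : Fin n → ℝ) (y : Euc n) (h1 : σ1 ≤ σ0) (ht : σ0 ≤ tau d (zc s a y)) :
    phi d x ρ s a σ1 y = phi d x ρ s a σ0 y := by
  unfold phi Qm
  rw [max_eq_left ht, max_eq_left (h1.trans ht)]

/-- measure of the image of a layer -/
lemma phi_layer {n d : ℕ} [Nonempty (Fin (d+1) ↪ Fin n)] (hn : 1 ≤ n) (x : Euc n) {ρ s σ1 : ℝ}
    (hs : 0 < s) (a : Fin n → ℝ) (j : ℕ) (hσ : σ1 ≤ (1/2)^(j+1)) (A : Set (Euc n))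
    (hA : ∀ y ∈ A, (1/2)^(j+1) ≤ max (tau d (zc s a y)) σ1) :
    μH[(d:ℝ)] (phi d x ρ s a σ1 '' A) ≤ ENNReal.ofReal (4 * n * 2 ^ j) ^ d * μH[(d:ℝ)] A := by
  have hp : (0:ℝ) < (1/2)^(j+1) := by positivity
  have hh2 : ((1:ℝ)/2)^(j+1) ≤ 1/2 := by
    rw [pow_succ]
    have : ((1:ℝ)/2)^j ≤ 1 := pow_le_one₀ (by norm_num) (by norm_num)
    linarith
  have hL := phi_lip (d := d) (ρ := ρ) x hs hp hh2 a
  have himg : phi d x ρ s a σ1 '' A = phi d x ρ s a ((1/2)^(j+1)) '' A := by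
    refine image_congr fun y hy => ?_
    rcases le_max_iff.1 (hA y hy) with h | h
    · exact phi_congr x a y hσ h
    · rw [le_antisymm hσ h]
  rw [himg]
  refine (hL.hausdorffMeasure_image_le (by positivity) _).trans ?_
  rw [ENNReal.rpow_natCast]
  gcongr
  apply ENNReal.ofReal_le_ofReal
  have h1 : (1:ℝ) ≤ n := by exact_mod_cast hn
  have h2 : (1:ℝ) ≤ 2 ^ j := one_le_pow₀ (by norm_num)
  have h3 : (n:ℝ) / (1/2)^(j+1) = 2 * n * 2 ^ j := by
    rw [one_div, inv_pow, div_inv_eq_mul, pow_succ]; ring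
  rw [h3]
  nlinarith

lemma const_calc (n d j : ℕ) (N : ℝ≥0∞) (m : ℝ≥0∞) :
    ENNReal.ofReal (4 * n * 2 ^ j) ^ d * (N * ENNReal.ofReal (4 * (1/2)^j) ^ (d+1) * m) =
      (ENNReal.ofReal ((4 * n) ^ d * 4 ^ (d+1)) * N) * (ENNReal.ofReal ((1/2)^j) * m) := by
  have e : ENNReal.ofReal (4 * n * 2 ^ j) ^ d * ENNReal.ofReal (4 * (1/2)^j) ^ (d+1) =
      ENNReal.ofReal ((4 * n) ^ d * 4 ^ (d+1)) * ENNReal.ofReal ((1/2)^j) := by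
    rw [← ENNReal.ofReal_pow (by positivity), ← ENNReal.ofReal_pow (by positivity),
      ← ENNReal.ofReal_mul (by positivity), ← ENNReal.ofReal_mul (by positivity)]
    congr 1
    have : ((2:ℝ) ^ j) ^ d * ((1/2)^j)^d = 1 := by
      rw [← mul_pow, ← mul_pow]; norm_num
    calc (4 * (n:ℝ) * 2 ^ j) ^ d * (4 * (1/2)^j) ^ (d+1)
        = (4 * n) ^ d * 4 ^ (d+1) * (1/2)^j * (((2:ℝ) ^ j) ^ d * ((1/2)^j)^d) := by
          rw [mul_pow (4 * (n:ℝ)), mul_pow 4 (((1:ℝ)/2)^j), pow_succ (((1:ℝ)/2)^j)]; ring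
      _ = _ := by rw [this, mul_one]
  calc _ = (ENNReal.ofReal (4 * n * 2 ^ j) ^ d * ENNReal.ofReal (4 * (1/2)^j) ^ (d+1)) * (N * m) := by
        ring
    _ = _ := by rw [e]; ring

lemma step (n d : ℕ) (hdn : d < n) : ∃ C : ℝ≥0, 1 ≤ C ∧ ∀ (x : Euc n) (r s ρ : ℝ),
    0 < s → n * s ≤ r → ρ + s ≤ 2 * r → ∀ E : Set (Euc n),
    μH[(d:ℝ)] (E ∩ closedBall x (ρ + s)) < ∞ →
    ∃ φ : Euc n → Euc n, (∃ K, LipschitzWith K φ) ∧ (∀ y, ρ + s ≤ dist y x → φ y = y) ∧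
      (∀ y, dist (φ y) y ≤ r) ∧
      μH[(d:ℝ)] (φ '' (E ∩ closedBall x (ρ + s))) ≤
        C * (ENNReal.ofReal (r ^ d * (r / s) ^ (n - d)) +
          μH[(d:ℝ)] (E ∩ (closedBall x (ρ + s) \ closedBall x ρ))) := by
  have : Nonempty (Fin (d+1) ↪ Fin n) := ⟨Fin.castLEEmb hdn⟩
  obtain ⟨C1, hC1⟩ := skel_bound n d hdn.le
  set N : ℝ≥0∞ := (Fintype.card (Fin (d+1) ↪ Fin n) : ℝ≥0∞) with hN
  set c2 : ℝ≥0∞ := ENNReal.ofReal ((4 * n) ^ d * 4 ^ (d+1)) * N with hc2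
  have hc2top : c2 ≠ ∞ := ENNReal.mul_ne_top ENNReal.ofReal_ne_top (ENNReal.natCast_ne_top _)
  refine ⟨C1 + 2 * c2.toNNReal + 1, by simp, fun x r s ρ hs hnr hρ E hfin => ?_⟩
  have hn1 : 1 ≤ n := by omega
  have hn1' : (1:ℝ) ≤ n := by exact_mod_cast hn1
  have hsr : s ≤ r := by nlinarith
  have hr : 0 < r := by linarith
  set T : ℝ := r ^ d * (r / s) ^ (n - d) with hT
  have hTpos : 0 < T := by positivity
  set A1 := E ∩ (closedBall x (ρ + s) \ closedBall x ρ) with hA1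
  set A2 := E ∩ closedBall x (ρ + s) with hA2
  have hsub12 : A1 ⊆ A2 := fun y hy => ⟨hy.1, hy.2.1⟩
  have hfin1 : μH[(d:ℝ)] A1 < ∞ := (measure_mono hsub12).trans_lt hfin
  let ν1 : Measure (Euc n) := (μH[(d:ℝ)]).restrict A1
  let ν2 : Measure (Euc n) := (μH[(d:ℝ)]).restrict A2
  have : IsFiniteMeasure ν1 := ⟨by simpa [ν1] using hfin1⟩
  have : IsFiniteMeasure ν2 := ⟨by simpa [ν2] using hfin⟩
  -- choice of the last level
  obtain ⟨J, hJ⟩ : ∃ J : ℕ, ENNReal.ofReal ((1/2)^J) * μH[(d:ℝ)] A2 ≤ ENNReal.ofReal T := by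
    set m := (μH[(d:ℝ)] A2).toReal with hm
    have hm0 : 0 ≤ m := ENNReal.toReal_nonneg
    obtain ⟨J, hJ⟩ := exists_pow_lt_of_lt_one (show 0 < T / (m + 1) by positivity)
      (show (1/2 : ℝ) < 1 by norm_num)
    refine ⟨J, ?_⟩
    rw [← ENNReal.ofReal_toReal hfin.ne, ← ENNReal.ofReal_mul (by positivity)]
    apply ENNReal.ofReal_le_ofReal
    rw [lt_div_iff₀ (by positivity)] at hJ
    have : (0:ℝ) < (1/2)^J := by positivity
    nlinarith
  let S : ℕ → (Fin n → ℝ) → Set (Euc n) := fun j a =>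
    {y | tau d ((fun i => s⁻¹ * y i) + a) < (1/2)^j}
  have hSmeas : ∀ j a, MeasurableSet (S j a) := by
    intro j a
    apply IsOpen.measurableSet
    refine isOpen_lt (tau_cont.comp ?_) continuous_const
    fun_prop
  let K : ℕ → ℝ≥0∞ := fun j => ENNReal.ofReal (4 * n * 2 ^ j) ^ d
  let G : (Fin n → ℝ) → ℝ≥0∞ := fun a =>
    ∑ j ∈ Finset.range J, K j * ν1 (S j a) + K J * ν2 (S J a)
  have hGint : ∫⁻ a, G a ∂(cubeM n) ≤ 2 * c2 * μH[(d:ℝ)] A1 + c2 * ENNReal.ofReal T := by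
    have hm1 : ∀ j, Measurable (fun a => ν1 (S j a)) := fun j => avg_meas ν1 s _
    have hm2 : ∀ j, Measurable (fun a => ν2 (S j a)) := fun j => avg_meas ν2 s _
    have hi1 : ∀ j, ∫⁻ a, K j * ν1 (S j a) ∂(cubeM n) ≤
        c2 * (ENNReal.ofReal ((1/2)^j) * μH[(d:ℝ)] A1) := by
      intro j
      rw [lintegral_const_mul _ (hm1 j), hc2, ← const_calc]
      gcongr
      have := avg_tau (d := d) ν1 s ((1/2)^j)
      rw [show ν1 univ = μH[(d:ℝ)] A1 from Measure.restrict_apply_univ _] at this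
      exact this
    have hi2 : ∀ j, ∫⁻ a, K j * ν2 (S j a) ∂(cubeM n) ≤
        c2 * (ENNReal.ofReal ((1/2)^j) * μH[(d:ℝ)] A2) := by
      intro j
      rw [lintegral_const_mul _ (hm2 j), hc2, ← const_calc]
      gcongr
      have := avg_tau (d := d) ν2 s ((1/2)^j)
      rw [show ν2 univ = μH[(d:ℝ)] A2 from Measure.restrict_apply_univ _] at this
      exact this
    have hs1 : ∑ j ∈ Finset.range J, ENNReal.ofReal ((1/2)^j) ≤ 2 := by
      rw [← ENNReal.ofReal_sum_of_nonneg (fun _ _ => by positivity)]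
      refine (ENNReal.ofReal_le_ofReal (sum_geometric_two_le J)).trans ?_
      simp
    simp only [G]
    rw [lintegral_add_right _ ((hm2 J).const_mul _), lintegral_finsetSum _ (fun j _ => (hm1 j).const_mul _)]
    refine add_le_add ?_ ((hi2 J).trans (by gcongr))
    refine (Finset.sum_le_sum fun j _ => hi1 j).trans ?_
    rw [← Finset.mul_sum, ← Finset.sum_mul]
    calc _ ≤ c2 * (2 * μH[(d:ℝ)] A1) := by gcongr
      _ = _ := by ring
  obtain ⟨a, ha⟩ : ∃ a, G a ≤ ∫⁻ a, G a ∂(cubeM n) := exists_le_lintegral (by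
    refine Measurable.aemeasurable ?_
    refine Measurable.add (Finset.measurable_sum _ fun j _ => ?_) ?_
    · exact (avg_meas ν1 s _).const_mul _
    · exact (avg_meas ν2 s _).const_mul _)
  set σ1 : ℝ := (1/2)^(J+1) with hσ1
  have hσ1p : 0 < σ1 := by positivity
  have hσ1h : σ1 ≤ 1/2 := by
    rw [hσ1, pow_succ]
    have : ((1:ℝ)/2)^J ≤ 1 := pow_le_one₀ (by norm_num) (by norm_num)
    linarith
  refine ⟨phi d x ρ s a σ1, ⟨_, phi_lip x hs hσ1p hσ1h a⟩, fun y hy => ?_, fun y => ?_, ?_⟩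
  · unfold phi; rw [chi_out x hs y hy]; simp
  · exact (phi_near x hs a σ1 y).trans hnr
  -- covering of the image
  let Lay : ℕ → Set (Euc n) := fun j => {y | y ∈ A1 ∩ S j a ∧ (1/2)^(j+1) ≤ tau d (zc s a y)}
  have hcover : phi d x ρ s a σ1 '' A2 ⊆ Skel d x r s a ∪
      ((⋃ j ∈ Finset.range J, phi d x ρ s a σ1 '' Lay j) ∪ phi d x ρ s a σ1 '' (A2 ∩ S J a)) := by
    rintro _ ⟨y, hy, rfl⟩
    by_cases hSJ : y ∈ S J a
    · right; right; exact ⟨y, ⟨hy, hSJ⟩, rfl⟩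
    by_cases hyρ : dist y x ≤ ρ
    · left
      refine phi_skel x hs hσ1p hnr hρ a y hyρ ?_
      have h1 : (1/2)^J ≤ tau d (zc s a y) := not_lt.1 hSJ
      refine le_trans ?_ h1
      exact pow_le_pow_of_le_one (by norm_num) (by norm_num) (by omega)
    · right; left
      have hyA1 : y ∈ A1 := ⟨hy.1, hy.2, fun h => hyρ (mem_closedBall.1 h)⟩
      have hex : ∃ j, y ∉ S j a := ⟨J, hSJ⟩
      classical
      have h0 : Nat.find hex ≠ 0 := by
        intro h
        have := Nat.find_spec hex
        rw [h] at this
        apply this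
        have h3 : tau d (zc s a y) ≤ 1/2 := tau_le_half _
        show tau d (zc s a y) < (1/2)^0
        rw [pow_zero]; linarith
      obtain ⟨j, hj⟩ := Nat.exists_eq_succ_of_ne_zero h0
      have hjJ : j < J := by
        have := Nat.find_min' hex hSJ
        omega
      have hjS : y ∈ S j a := by
        by_contra h
        have := Nat.find_min' hex h
        omega
      have hjS' : y ∉ S (j+1) a := by
        have := Nat.find_spec hex
        rwa [hj] at this
      exact mem_iUnion₂.2 ⟨j, Finset.mem_range.2 hjJ, y, ⟨⟨hyA1, hjS⟩, not_lt.1 hjS'⟩, rfl⟩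
  have hb : μH[(d:ℝ)] (phi d x ρ s a σ1 '' A2) ≤ C1 * ENNReal.ofReal T + G a := by
    refine (measure_mono hcover).trans ((measure_union_le _ _).trans ?_)
    refine add_le_add (hC1 x r s a hs hsr) ((measure_union_le _ _).trans (add_le_add ?_ ?_))
    · refine (measure_biUnion_finset_le _ _).trans (Finset.sum_le_sum fun j hj => ?_)
      have hjJ := Finset.mem_range.1 hj
      refine (phi_layer hn1 x hs a j ?_ _ fun y hy => le_max_of_le_left hy.2).trans ?_
      · exact pow_le_pow_of_le_one (by norm_num) (by norm_num) (by omega)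
      · refine mul_le_mul_right ?_ _
        simp only [ν1]
        rw [Measure.restrict_apply (hSmeas j a)]
        exact measure_mono fun y hy => ⟨hy.1.2, hy.1.1⟩
    · refine (phi_layer hn1 x hs a J le_rfl _ fun y hy => le_max_right _ _).trans ?_
      refine mul_le_mul_right ?_ _
      simp only [ν2]
      rw [Measure.restrict_apply (hSmeas J a)]
      exact measure_mono fun y hy => ⟨hy.2, hy.1⟩
  refine hb.trans ((add_le_add le_rfl (ha.trans hGint)).trans ?_)
  push_cast
  rw [ENNReal.coe_toNNReal hc2top]
  set t := ENNReal.ofReal T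
  set m1 := μH[(d:ℝ)] A1
  calc (C1:ℝ≥0∞) * t + (2 * c2 * m1 + c2 * t)
      ≤ (C1:ℝ≥0∞) * t + (2 * c2 * m1 + c2 * t) + (c2 * t + t + (C1 + 1) * m1) := le_self_add
    _ = _ := by ring

lemma recursion (g : ℕ → ℝ) (ε A D B θ : ℝ) (hA : 1 ≤ A) (hD : 0 < D) (hθ : 1 < θ)
    (hθ2 : θ ≤ 1 + 1 / (2 * A))
    (h : ∀ k, g k ≤ A * (D * θ ^ k) + A * (g (k+1) - g k) + ε) (hB : ∀ k, g k ≤ B) :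
    g 0 ≤ 2 * A * D + ε := by
  by_contra! hc
  have hA0 : 0 < A := by linarith
  set u := g 0 - ε with hu
  have hu1 : 2 * A * D < u := by linarith
  have hu0 : 0 < u := lt_trans (by positivity) hu1
  have hind : ∀ k, θ ^ k * u ≤ g k - ε := by
    intro k
    induction k with
    | zero => simp [hu]
    | succ k ih =>
      have h1 := h k
      have hp : 0 < θ ^ k := by positivity
      have h2 : A * (θ ^ (k+1) * u) ≤ A * (g (k+1) - ε) := by
        have e1 : A * (θ ^ (k+1) * u) = θ ^ k * (A * θ * u) := by rw [pow_succ]; ring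
        have e2 : A * θ ≤ A + 1/2 := by
          calc A * θ ≤ A * (1 + 1 / (2 * A)) := by gcongr
            _ = A + 1/2 := by field_simp
        have e3 : A * θ * u ≤ (A + 1) * u - A * D := by nlinarith
        have e4 : θ ^ k * (A * θ * u) ≤ θ ^ k * ((A + 1) * u - A * D) := by gcongr
        have e5 : (A + 1) * (θ ^ k * u) ≤ (A + 1) * (g k - ε) := by gcongr
        rw [e1]
        nlinarith
      exact le_of_mul_le_mul_left h2 hA0
  obtain ⟨k, hk⟩ := pow_unbounded_of_one_lt ((B - ε) / u) hθ
  rw [div_lt_iff₀ hu0] at hk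
  linarith [hind k, hB k]

lemma homotopic_id {n : ℕ} (φ : C(Euc n, Euc n)) : (ContinuousMap.id (Euc n)).Homotopic φ := by
  refine ⟨{ toFun := fun p => p.2 + (p.1 : ℝ) • (φ p.2 - p.2)
            continuous_toFun := by fun_prop
            map_zero_left := fun y => by simp
            map_one_left := fun y => by simp }⟩

/-- one step of the iteration, in terms of the quasiminimality -/
lemma qm_step (n d : ℕ) (C : ℝ≥0) (U : Set (Euc n)) (M ε : ℝ → ℝ)
    (hM : MonotoneOn M (Ici (0 : ℝ))) (hM1 : ∀ r, 0 ≤ r → 1 ≤ M r)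
    (hε : MonotoneOn ε (Ici (0 : ℝ))) (hε0 : ∀ r, 0 ≤ r → 0 ≤ ε r)
    (E : Set (Euc n))
    (hE : MemQM n d U (fun r => ENNReal.ofReal (M r)) (fun r => ENNReal.ofReal (ε r)) E)
    (η r ρ s T : ℝ) (x : Euc n) (hη : 6 ≤ η) (hr : 0 < r) (hrU : η * r < infDist x Uᶜ)
    (hs : 0 < s) (hρ : ρ + s ≤ 2 * r) (hT : 0 ≤ T)
    (hfin : μH[(d:ℝ)] (E ∩ closedBall x (ρ + s)) < ∞)
    (φ : Euc n → Euc n) (hφL : ∃ K, LipschitzWith K φ) (hφ1 : ∀ y, ρ + s ≤ dist y x → φ y = y)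
    (hφ2 : ∀ y, dist (φ y) y ≤ r)
    (hφ3 : μH[(d:ℝ)] (φ '' (E ∩ closedBall x (ρ + s))) ≤
        C * (ENNReal.ofReal T + μH[(d:ℝ)] (E ∩ (closedBall x (ρ + s) \ closedBall x ρ)))) :
    (μH[(d:ℝ)] (E ∩ closedBall x ρ)).toReal ≤
      2 * M (η * r) * C * T + 2 * M (η * r) * C * ((μH[(d:ℝ)] (E ∩ closedBall x (ρ + s))).toReal
        - (μH[(d:ℝ)] (E ∩ closedBall x ρ)).toReal) + ε (η * r) := by
  set W : Set (Euc n) := {y | φ y ≠ y} with hW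
  have hηr : 0 ≤ η * r := by positivity
  have hWb : W ⊆ closedBall x (ρ + s) := by
    intro y hy
    rw [mem_closedBall]
    by_contra! h
    exact hy (hφ1 y h.le)
  have hb2 : closedBall x (ρ + s) ⊆ closedBall x (2 * r) := closedBall_subset_closedBall hρ
  have hclW : closure W ⊆ closedBall x (2 * r) := closure_minimal (hWb.trans hb2) isClosed_closedBall
  have hBU : closedBall x (2 * r) ⊆ U := by
    intro y hy
    by_contra h
    have h1 : infDist x Uᶜ ≤ dist x y := infDist_le_dist_of_mem h
    rw [mem_closedBall, dist_comm] at hy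
    nlinarith
  have hdef : IsDeformation n U φ := by
    refine ⟨hφL, ?_, ?_, hclW.trans hBU⟩
    · obtain ⟨K, hK⟩ := hφL
      exact ⟨hK.continuous, homotopic_id _⟩
    · exact (isCompact_closedBall x (2 * r)).of_isClosed_subset isClosed_closure hclW
  have hq := hE.2.2 φ hdef
  have hsub3 : W ∪ φ '' W ⊆ closedBall x (3 * r) := by
    rintro y (hy | ⟨y, hy, rfl⟩)
    · exact closedBall_subset_closedBall (by linarith) (hb2 (hWb hy))
    · have h1 := hφ2 y
      have h2 := mem_closedBall.1 (hb2 (hWb hy))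
      rw [mem_closedBall]
      linarith [dist_triangle (φ y) y x]
  have hdiam : diam (W ∪ φ '' W) ≤ η * r := by
    refine (diam_mono hsub3 isBounded_closedBall).trans ((diam_closedBall (by positivity)).trans ?_)
    nlinarith
  have hMd : M (diam (W ∪ φ '' W)) ≤ M (η * r) := hM diam_nonneg hηr hdiam
  have hεd : ε (diam (W ∪ φ '' W)) ≤ ε (η * r) := hε diam_nonneg hηr hdiam
  set M1 := M (η * r)
  set ε1 := ε (η * r)
  have hM11 : 1 ≤ M1 := hM1 _ hηr
  have hε10 : 0 ≤ ε1 := hε0 _ hηr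
  set X := μH[(d:ℝ)] (φ '' (E ∩ closedBall x (ρ + s))) with hX
  have hq2 : μH[(d:ℝ)] (E ∩ W) ≤ ENNReal.ofReal M1 * X + ENNReal.ofReal ε1 := by
    refine hq.trans (add_le_add (mul_le_mul' (ENNReal.ofReal_le_ofReal hMd) ?_)
      (ENNReal.ofReal_le_ofReal hεd))
    exact measure_mono (image_mono (inter_subset_inter_right _ hWb))
  have hcov : E ∩ closedBall x ρ ⊆ (E ∩ W) ∪ φ '' (E ∩ closedBall x (ρ + s)) := by
    rintro y ⟨hy1, hy2⟩
    by_cases h : φ y = y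
    · right; exact ⟨y, ⟨hy1, closedBall_subset_closedBall (by linarith) hy2⟩, h⟩
    · left; exact ⟨hy1, h⟩
  have hq3 : μH[(d:ℝ)] (E ∩ closedBall x ρ) ≤
      ENNReal.ofReal M1 * X + ENNReal.ofReal ε1 + ENNReal.ofReal M1 * X := by
    refine (measure_mono hcov).trans ((measure_union_le _ _).trans (add_le_add hq2 ?_))
    calc X = 1 * X := (one_mul _).symm
      _ ≤ _ := by gcongr; simpa using hM11
  set g1 := μH[(d:ℝ)] (E ∩ closedBall x ρ) with hg1
  set g2 := μH[(d:ℝ)] (E ∩ closedBall x (ρ + s)) with hg2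
  set m1 := μH[(d:ℝ)] (E ∩ (closedBall x (ρ + s) \ closedBall x ρ)) with hm1
  have hadd : g1 + m1 = g2 := by
    have := measure_inter_add_sdiff (μ := μH[(d:ℝ)]) (E ∩ closedBall x (ρ + s))
      (isClosed_closedBall (x := x) (ε := ρ)).measurableSet
    rw [inter_assoc, inter_eq_self_of_subset_right
      (closedBall_subset_closedBall (by linarith : ρ ≤ ρ + s)), inter_sdiff_assoc] at this
    exact this
  have hg1f : g1 ≠ ∞ := ne_top_of_le_ne_top hfin.ne (hadd ▸ le_self_add)
  have hm1f : m1 ≠ ∞ := ne_top_of_le_ne_top hfin.ne (hadd ▸ le_add_self)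
  have hm1r : g2.toReal - g1.toReal = m1.toReal := by
    rw [← hadd, ENNReal.toReal_add hg1f hm1f]; ring
  rw [hm1r]
  have hXr : X ≤ ENNReal.ofReal (C * (T + m1.toReal)) := by
    refine hφ3.trans (le_of_eq ?_)
    rw [ENNReal.ofReal_mul (by positivity), ENNReal.ofReal_add hT ENNReal.toReal_nonneg,
      ENNReal.ofReal_toReal hm1f, ENNReal.ofReal_coe_nnreal]
  have hm0 : 0 ≤ m1.toReal := ENNReal.toReal_nonneg
  refine ENNReal.toReal_le_of_le_ofReal (by positivity) (hq3.trans ?_)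
  calc _ ≤ ENNReal.ofReal M1 * ENNReal.ofReal (C * (T + m1.toReal)) + ENNReal.ofReal ε1
        + ENNReal.ofReal M1 * ENNReal.ofReal (C * (T + m1.toReal)) := by gcongr
    _ = _ := by
      rw [← ENNReal.ofReal_mul (by positivity), ← ENNReal.ofReal_add (by positivity) hε10,
        ← ENNReal.ofReal_add (by positivity) (by positivity)]
      congr 1; ring

set_option maxHeartbeats 1000000

/-- Lemma 3.4: local Ahlfors upper regularity of quasiminimal sets.
There exist `c0 = c0(n,d) ≥ 1` and `c1 = c1(n,d) > 0` such that if `η > 1` and `r0 > 0`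
satisfy `2(n−d) c0 (ln η)^{−1/2} M(η r0) ≤ 1`, then for every `x ∈ E ∩ U` and
`0 < r < min(r0, η⁻¹ dist(x, ℝⁿ∖U))` one has
`H^d(E ∩ B̄(x,r)) ≤ 2 c1 M(2ηr)(ηr)^d + ε(2ηr)`. -/
theorem local_upper_bound
    (n d : ℕ) (hd : 1 ≤ d) (hdn : d < n) :
    ∃ c0 c1 : ℝ, 1 ≤ c0 ∧ 0 < c1 ∧
      ∀ (U : Set (Euc n)), IsOpen U → U.Nonempty →
      ∀ (M ε : ℝ → ℝ),
      MonotoneOn M (Ici (0 : ℝ)) → (∀ r, 0 ≤ r → 1 ≤ M r) →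
      MonotoneOn ε (Ici (0 : ℝ)) → (∀ r, 0 ≤ r → 0 ≤ ε r) →
      ∀ E : Set (Euc n),
      MemQM n d U (fun r => ENNReal.ofReal (M r)) (fun r => ENNReal.ofReal (ε r)) E →
      ∀ η r0 : ℝ, 1 < η → 0 < r0 →
      2 * ((n : ℝ) - d) * c0 * (Real.sqrt (Real.log η))⁻¹ * M (η * r0) ≤ 1 →
      ∀ x ∈ E ∩ U, ∀ r : ℝ, 0 < r → r < min r0 (η⁻¹ * infDist x Uᶜ) →
        μH[(d : ℝ)] (E ∩ closedBall x r) ≤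
          ENNReal.ofReal (2 * c1 * M (2 * η * r) * (η * r) ^ d) +
            ENNReal.ofReal (ε (2 * η * r)) := by
  obtain ⟨C, hC1, hC⟩ := step n d hdn
  obtain ⟨N, hNdef⟩ : ∃ N, N = n - d := ⟨_, rfl⟩
  have hN1 : 1 ≤ N := by omega
  have hNr : (1:ℝ) ≤ N := by exact_mod_cast hN1
  have hn1 : (1:ℝ) ≤ n := by
    have : 1 ≤ n := by omega
    exact_mod_cast this
  have hCr : (1:ℝ) ≤ C := by exact_mod_cast hC1
  have hC0 : (0:ℝ) < C := by linarith
  have hnN : (n:ℝ) - d = N := by rw [hNdef, Nat.cast_sub hdn.le]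
  refine ⟨1, 2 * C * (8 * C * N * n) ^ N * N.factorial, le_rfl, by positivity, ?_⟩
  intro U hU hUne M ε hM hM1 hε hε0 E hE η r0 hη hr0 hsmall x hx r hr hrlt
  have hrr0 : r < r0 := hrlt.trans_le (min_le_left _ _)
  have hη0 : 0 < η := by linarith
  have hrU : η * r < infDist x Uᶜ := by
    have := hrlt.trans_le (min_le_right _ _)
    rwa [lt_inv_mul_iff₀ hη0] at this
  have hηr : 0 < η * r := by positivity
  set M1 := M (η * r) with hM1def
  have hM11 : 1 ≤ M1 := hM1 _ hηr.le
  have hM10 : M1 ≤ M (η * r0) := hM (mem_Ici.2 hηr.le) (mem_Ici.2 (by positivity)) (by gcongr)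
  have hM12 : M1 ≤ M (2 * η * r) := hM (mem_Ici.2 hηr.le) (mem_Ici.2 (by positivity)) (by nlinarith)
  have hε12 : ε (η * r) ≤ ε (2 * η * r) :=
    hε (mem_Ici.2 hηr.le) (mem_Ici.2 (by positivity)) (by nlinarith)
  -- largeness of `η`
  have hlog : 4 * M1 ≤ Real.log η := by
    have hl : 0 < Real.log η := Real.log_pos hη
    have hL : 0 < Real.sqrt (Real.log η) := Real.sqrt_pos.2 hl
    have hsq : Real.sqrt (Real.log η) ^ 2 = Real.log η := Real.sq_sqrt hl.le
    set L := Real.sqrt (Real.log η)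
    rw [hnN] at hsmall
    have e : 2 * (N:ℝ) * 1 * L⁻¹ * M (η * r0) = (2 * N * M (η * r0)) / L := by
      field_simp
    rw [e, div_le_one hL] at hsmall
    have h2 : 2 * M1 ≤ L := by
      have : 1 * M1 ≤ N * M (η * r0) := by gcongr
      linarith
    rw [← hsq]
    nlinarith
  have hexp : Real.exp (4 * M1) ≤ η := by
    rw [← Real.exp_log hη0]; exact Real.exp_le_exp.2 hlog
  have hη6 : 6 ≤ η := by
    have h1 : Real.exp 4 ≤ Real.exp (4 * M1) := Real.exp_le_exp.2 (by linarith)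
    have h2 : Real.exp 4 = Real.exp 2 * Real.exp 2 := by rw [← Real.exp_add]; norm_num
    have h3 := Real.add_one_le_exp (2:ℝ)
    nlinarith
  have hMη : M1 ^ N ≤ N.factorial * η ^ d := by
    have h1 : M1 ^ N / N.factorial ≤ Real.exp M1 := Real.pow_div_factorial_le_exp M1 (by linarith) N
    have h2 : Real.exp M1 ≤ Real.exp (4 * M1) := Real.exp_le_exp.2 (by linarith)
    have h3 : η ≤ η ^ d := le_self_pow₀ hη.le (by omega)
    rw [div_le_iff₀ (by positivity)] at h1
    calc M1 ^ N ≤ Real.exp M1 * N.factorial := h1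
      _ ≤ η ^ d * N.factorial := by gcongr; linarith
      _ = _ := by ring
  -- parameters
  set A : ℝ := 2 * M1 * C with hA
  have hA1 : 1 ≤ A := by nlinarith
  have hA0 : 0 < A := by linarith
  set p : ℝ := 1 / (4 * A * N) with hp
  have hp0 : 0 < p := by positivity
  have hp4 : p ≤ 1/4 := by
    rw [hp]
    apply one_div_le_one_div_of_le (by norm_num)
    nlinarith
  set q : ℝ := 1 - p with hq
  have hq0 : 0 < q := by linarith
  have hq1 : q < 1 := by linarith
  set s0 : ℝ := r * p / n with hs0
  have hs0p : 0 < s0 := by positivity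
  set θ : ℝ := (q ^ N)⁻¹ with hθ
  have hqN : 0 < q ^ N := by positivity
  have hθ1 : 1 < θ := by
    rw [hθ]; exact (one_lt_inv₀ hqN).2 (pow_lt_one₀ hq0.le hq1 (by omega))
  have hθ2 : θ ≤ 1 + 1 / (2 * A) := by
    have hb : 1 - 1 / (4 * A) ≤ q ^ N := by
      have := one_add_mul_le_pow (show (-2:ℝ) ≤ -p by linarith) N
      have e : (N:ℝ) * -p = - (1 / (4 * A)) := by rw [hp]; field_simp
      rw [e] at this
      have e2 : 1 + -p = q := by rw [hq]; ring
      rw [e2] at this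
      linarith
    rw [hθ, inv_le_iff_one_le_mul₀ hqN]
    set w := 1 / (4 * A) with hw
    have hw0 : 0 < w := by positivity
    have hw4 : w ≤ 1/4 := by
      rw [hw]; apply one_div_le_one_div_of_le (by norm_num); linarith
    have e3 : 1 / (2 * A) = 2 * w := by rw [hw]; field_simp; norm_num
    rw [e3]
    nlinarith
  let s : ℕ → ℝ := fun k => s0 * q ^ k
  have hsp : ∀ k, 0 < s k := fun k => mul_pos hs0p (pow_pos hq0 k)
  let ρ : ℕ → ℝ := fun k => r + ∑ i ∈ Finset.range k, s i
  have hρ0 : ρ 0 = r := by simp [ρ]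
  have hρs : ∀ k, ρ (k+1) = ρ k + s k := fun k => by simp [ρ, Finset.sum_range_succ]; ring
  have hρ2 : ∀ k, ρ k ≤ 2 * r := by
    intro k
    have h1 : (∑ i ∈ Finset.range k, q ^ i) * p ≤ 1 := by
      have := geom_sum_mul_neg q k
      have e : 1 - q = p := by rw [hq]; ring
      rw [e] at this
      rw [this]
      linarith [pow_pos hq0 k]
    have h2 : ∑ i ∈ Finset.range k, s i = (r / n) * ((∑ i ∈ Finset.range k, q ^ i) * p) := by
      simp only [s]
      rw [← Finset.mul_sum, hs0]; ring
    have h3 : r / n ≤ r := div_le_self hr.le hn1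
    have h4 : 0 < r / n := by positivity
    simp only [ρ]
    rw [h2]
    nlinarith
  have hns : ∀ k, n * s k ≤ r := by
    intro k
    have h1 : q ^ k ≤ 1 := pow_le_one₀ hq0.le hq1.le
    have h2 : (n:ℝ) * s k = r * (p * q ^ k) := by
      simp only [s]; rw [hs0]; field_simp
    rw [h2]
    have : p * q ^ k ≤ 1 * 1 := by
      have := pow_pos hq0 k
      gcongr
      linarith
    nlinarith
  have hlf := hE.1
  have hfin2 : μH[(d:ℝ)] (E ∩ closedBall x (2 * r)) < ∞ := by
    have := (isCompact_closedBall x (2 * r)).measure_lt_top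
      (μ := (μH[(d : ℝ)] : Measure (Euc n)).restrict E)
    rwa [Measure.restrict_apply isClosed_closedBall.measurableSet, inter_comm] at this
  have hfin : ∀ k, μH[(d:ℝ)] (E ∩ closedBall x (ρ k)) < ∞ := fun k =>
    (measure_mono (inter_subset_inter_right _ (closedBall_subset_closedBall (hρ2 k)))).trans_lt hfin2
  set D : ℝ := r ^ d * (r / s0) ^ N with hD
  have hDp : 0 < D := by positivity
  have hrec := recursion (fun k => (μH[(d:ℝ)] (E ∩ closedBall x (ρ k))).toReal) (ε (η * r)) A D
    (μH[(d:ℝ)] (E ∩ closedBall x (2 * r))).toReal θ hA1 hDp hθ1 hθ2 (by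
      intro k
      have h2 := hρ2 (k+1)
      have hf := hfin (k+1)
      rw [hρs] at h2 hf
      obtain ⟨φ, hφL, hφ1, hφ2, hφ3⟩ := hC x r (s k) (ρ k) (hsp k) (hns k) h2 E hf
      have hTe : r ^ d * (r / s k) ^ (n - d) = D * θ ^ k := by
        rw [← hNdef, hD, hθ, inv_pow, ← pow_mul, mul_comm N k, pow_mul]
        simp only [s]
        rw [div_pow, div_pow, mul_pow]
        field_simp
      rw [hTe] at hφ3
      have := qm_step n d C U M ε hM hM1 hε hε0 E hE η r (ρ k) (s k) (D * θ ^ k) x hη6 hr hrU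
        (hsp k) h2 (by positivity) hf φ hφL hφ1 hφ2 hφ3
      simp only [hρs]
      exact this) (by
      intro k
      exact ENNReal.toReal_mono hfin2.ne
        (measure_mono (inter_subset_inter_right _ (closedBall_subset_closedBall (hρ2 k)))))
  simp only [hρ0] at hrec
  have hfr : μH[(d:ℝ)] (E ∩ closedBall x r) ≠ ∞ := by
    have := (hfin 0).ne
    rwa [hρ0] at this
  have hrs0 : r / s0 = 8 * C * N * n * M1 := by
    rw [hs0, hp, hA]; field_simp; norm_num
  rw [← ENNReal.ofReal_toReal hfr, ← ENNReal.ofReal_add _ (hε0 _ (by positivity))]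
  · have hMnn : 0 ≤ M (2 * η * r) := by linarith
    apply ENNReal.ofReal_le_ofReal
    refine hrec.trans (add_le_add ?_ hε12)
    rw [hD, hrs0, mul_pow _ M1, hA]
    calc 2 * (2 * M1 * C) * (r ^ d * ((8 * C * N * n) ^ N * M1 ^ N))
        = 4 * M1 * C * r ^ d * (8 * C * N * n) ^ N * M1 ^ N := by ring
      _ ≤ 4 * M (2 * η * r) * C * r ^ d * (8 * C * N * n) ^ N * (N.factorial * η ^ d) := by gcongr
      _ = _ := by rw [mul_pow η r d]; ring
  · have : 0 ≤ M (2 * η * r) := by linarith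
    positivity
end
end
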